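/- arXiv:1507.08841 — 3 statements merged into one kernel-verified Lean document; each statement's English description precedes it below -/
import Mathlib

section
/- Let Γ be a finitely generated group that is linear over some field. Suppose that for some n ≥ 1 and some nontrivial word w ∈ F_n there exists ε > 0 such that for every finite quotient G of Γ one has max_{g ∈ G} P_{G,w}(g) ≥ ε, where P_{G,w}(g) is the probability that w(g_1,…,g_n) = g for independent uniformly random g_1,…,g_n ∈ G. Then Γ is virtually solvable. -/
universe u v

/-- A group is linear (over some field) if it admits a faithful homomorphism into
`GL_k(F)` for some `k` and some field `F`. -/
def IsLinearGroup (Γ : Type u) [Group Γ] : Prop :=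
  ∃ (F : Type v) (_ : Field F) (k : ℕ)
    (ρ : Γ →* Matrix.GeneralLinearGroup (Fin k) F), Function.Injective ρ

/-- A group is virtually solvable if it has a solvable subgroup of finite index. -/
def IsVirtuallySolvable (Γ : Type u) [Group Γ] : Prop :=
  ∃ H : Subgroup Γ, H.FiniteIndex ∧ IsSolvable H

/-- `P_{G,w}(g)`: the probability that the word `w ∈ F_n` evaluates to `g` at an
independent uniformly random `n`-tuple of elements of `G`. -/
noncomputable def wordFiberProb (G : Type*) [Group G] {n : ℕ} (w : FreeGroup (Fin n))
    (g : G) : ℝ :=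
  (Nat.card {h : Fin n → G // FreeGroup.lift h w = g} : ℝ) / (Nat.card G : ℝ) ^ n


theorem integral_mem_of_algClosed {F K : Type*} [Field F] [IsAlgClosed F] [Field K] [Algebra F K]
    (x : K) (hx : IsIntegral F x) : ∃ c : F, algebraMap F K c = x :=
  minpoly.mem_range_of_degree_eq_one F x
    (IsAlgClosed.degree_eq_one_of_irreducible F (minpoly.irreducible hx))

/-- Growth lemma. -/
theorem growth_lemma {F B : Type*} [Field F] [IsAlgClosed F] [CommRing B] [IsDomain B] [Algebra F B]
    (U : Submodule F B) (hU : U.FG) (P : B) (hP : P ≠ 0) (L N : ℕ) (hL : 0 < L)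
    (h : ∀ b ∈ U ^ (N + L), ∃ c ∈ U ^ N, b = P * c) (f g : B) (hf : f ∈ U) (hg : g ∈ U)
    (hg0 : g ≠ 0) : ∃ c : F, f = c • g := by
  let K := FractionRing B
  have hinj : Function.Injective (algebraMap B K) := IsFractionRing.injective B K
  have hPK : algebraMap B K P ≠ 0 := by
    rw [Ne, map_eq_zero_iff _ hinj]; exact hP
  have hgK : algebraMap B K g ≠ 0 := by
    rw [Ne, map_eq_zero_iff _ hinj]; exact hg0
  let M : Submodule F K := (U ^ N).map (IsScalarTower.toAlgHom F B K).toLinearMap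
  have hM : M ≠ ⊥ := by
    rw [Submodule.ne_bot_iff]
    refine ⟨algebraMap B K (g ^ N), ⟨g ^ N, Submodule.pow_mem_pow U hg N, rfl⟩, ?_⟩
    rw [map_pow]; exact pow_ne_zero _ hgK
  have hMfg : M.FG := (hU.pow N).map _
  have key : ∀ u ∈ U, ∃ c : F, algebraMap B K u ^ L = algebraMap F K c * algebraMap B K P := by
    intro u hu
    have hint : IsIntegral F (algebraMap B K u ^ L / algebraMap B K P) := by
      refine isIntegral_of_smul_mem_submodule M hM hMfg _ ?_
      rintro _ ⟨b, hb, rfl⟩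
      obtain ⟨c, hc, hbc⟩ := h (b * u ^ L) (by
        rw [pow_add]; exact Submodule.mul_mem_mul hb (Submodule.pow_mem_pow U hu L))
      refine ⟨c, hc, ?_⟩
      have := congrArg (algebraMap B K) hbc
      simp only [map_mul, map_pow] at this
      change algebraMap B K c = _ * algebraMap B K b
      rw [div_mul_eq_mul_div, eq_div_iff hPK, mul_comm, ← this, mul_comm]
    obtain ⟨c, hc⟩ := integral_mem_of_algClosed _ hint
    exact ⟨c, by rw [hc, div_mul_cancel₀ _ hPK]⟩
  obtain ⟨c, hc⟩ := key f hf
  obtain ⟨c', hc'⟩ := key g hg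
  have hint : IsIntegral F ((algebraMap B K f / algebraMap B K g) ^ L) := by
    rw [div_pow, hc, hc', mul_div_mul_right _ _ hPK, ← map_div₀]
    exact isIntegral_algebraMap
  obtain ⟨e, he⟩ := integral_mem_of_algClosed _ (IsIntegral.of_pow hL hint)
  refine ⟨e, hinj ?_⟩
  rw [Algebra.smul_def, map_mul, ← IsScalarTower.algebraMap_apply, he, div_mul_cancel₀ _ hgK]

theorem rank_factorization {F : Type*} [Field F] {d : ℕ} (x : Matrix (Fin d) (Fin d) F) :
    ∃ (a : Matrix (Fin d) (Fin x.rank) F) (b : Matrix (Fin x.rank) (Fin d) F)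
      (a' : Matrix (Fin x.rank) (Fin d) F) (b' : Matrix (Fin d) (Fin x.rank) F),
      x = a * b ∧ a' * a = 1 ∧ b * b' = 1 := by
  classical
  let T := Matrix.toLin' x
  have hr : Module.finrank F (LinearMap.range T) = x.rank := rfl
  let bas : Module.Basis (Fin x.rank) F (LinearMap.range T) := Module.finBasisOfFinrankEq F _ hr
  let e : LinearMap.range T ≃ₗ[F] (Fin x.rank → F) := bas.equivFun
  let inc : (Fin x.rank → F) →ₗ[F] (Fin d → F) := (LinearMap.range T).subtype ∘ₗ e.symm.toLinearMap
  let pr : (Fin d → F) →ₗ[F] (Fin x.rank → F) := e.toLinearMap ∘ₗ T.rangeRestrict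
  have hinc : Function.Injective inc := by
    exact (Subtype.val_injective).comp e.symm.injective
  have hpr : Function.Surjective pr := e.surjective.comp T.surjective_rangeRestrict
  obtain ⟨inc', hinc'⟩ := inc.exists_leftInverse_of_injective (LinearMap.ker_eq_bot.2 hinc)
  obtain ⟨pr', hpr'⟩ := pr.exists_rightInverse_of_surjective (LinearMap.range_eq_top.2 hpr)
  refine ⟨LinearMap.toMatrix' inc, LinearMap.toMatrix' pr, LinearMap.toMatrix' inc',
    LinearMap.toMatrix' pr', ?_, ?_, ?_⟩
  · rw [← LinearMap.toMatrix'_comp]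
    have : inc ∘ₗ pr = T := by ext i; simp [inc, pr]
    rw [this]; simp [T]
  · rw [← LinearMap.toMatrix'_comp, hinc', LinearMap.toMatrix'_id]
  · rw [← LinearMap.toMatrix'_comp, hpr', LinearMap.toMatrix'_id]

section ConeSection

variable {F : Type*} [Field F] {Δ : Type*} [Group Δ] {𝒦 : Type*} {d : ℕ}

/-- Polynomial functions on tuples of matrices. -/
def PolyFun (F : Type*) [Field F] (𝒦 : Type*) (d : ℕ) :
    Subalgebra F ((𝒦 → Matrix (Fin d) (Fin d) F) → F) :=
  Algebra.adjoin F (Set.range fun (v : 𝒦 × Fin d × Fin d)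
    (x : 𝒦 → Matrix (Fin d) (Fin d) F) => x v.1 v.2.1 v.2.2)

theorem coord_mem_polyFun (κ : 𝒦) (i j : Fin d) :
    (fun x : 𝒦 → Matrix (Fin d) (Fin d) F => x κ i j) ∈ PolyFun F 𝒦 d :=
  Algebra.subset_adjoin ⟨(κ, i, j), rfl⟩

theorem polyFun_comp {Y : Type*} (S : Subalgebra F (Y → F))
    (Φ : Y → 𝒦 → Matrix (Fin d) (Fin d) F) (hΦ : ∀ κ i j, (fun y => Φ y κ i j) ∈ S)
    {f : (𝒦 → Matrix (Fin d) (Fin d) F) → F} (hf : f ∈ PolyFun F 𝒦 d) :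
    (fun y => f (Φ y)) ∈ S := by
  induction hf using Algebra.adjoin_induction with
  | mem x hx =>
    obtain ⟨v, rfl⟩ := hx
    exact hΦ _ _ _
  | algebraMap r => exact S.algebraMap_mem r
  | add x y _ _ hx hy => exact S.add_mem hx hy
  | mul x y _ _ hx hy => exact S.mul_mem hx hy

/-- The multi-cone Zariski closure of the image of `σ`. -/
def Cone (σ : 𝒦 → Δ →* Matrix (Fin d) (Fin d) F) : Set (𝒦 → Matrix (Fin d) (Fin d) F) :=
  {x | ∀ f ∈ PolyFun F 𝒦 d, (∀ (c : 𝒦 → F) (δ : Δ), f (fun κ => c κ • σ κ δ) = 0) → f x = 0}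

variable (σ : 𝒦 → Δ →* Matrix (Fin d) (Fin d) F)

theorem base_mem_cone (c : 𝒦 → F) (δ : Δ) : (fun κ => c κ • σ κ δ) ∈ Cone σ :=
  fun _ _ h => h c δ

theorem sigma_mem_cone (δ : Δ) : (fun κ => σ κ δ) ∈ Cone σ := by
  have := base_mem_cone σ (fun _ => 1) δ
  simpa using this

theorem cone_mul_left (c : 𝒦 → F) (δ : Δ) {x : 𝒦 → Matrix (Fin d) (Fin d) F} (hx : x ∈ Cone σ) :
    (fun κ => (c κ • σ κ δ) * x κ) ∈ Cone σ := by
  intro f hf h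
  have h1 : (fun x : 𝒦 → Matrix (Fin d) (Fin d) F => f (fun κ => (c κ • σ κ δ) * x κ))
      ∈ PolyFun F 𝒦 d := by
    refine polyFun_comp (PolyFun F 𝒦 d) (fun x κ => (c κ • σ κ δ) * x κ) ?_ hf
    intro κ i j
    simp only [Matrix.mul_apply]
    have : (fun y : 𝒦 → Matrix (Fin d) (Fin d) F => ∑ l, (c κ • σ κ δ) i l * y κ l j)
        = ∑ l, (c κ • σ κ δ) i l • (fun y : 𝒦 → Matrix (Fin d) (Fin d) F => y κ l j) := by
      ext y; simp [Finset.sum_apply]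
    rw [this]
    exact Subalgebra.sum_mem _ fun l _ => Subalgebra.smul_mem _ (coord_mem_polyFun _ _ _) _
  refine hx _ h1 fun c' δ' => ?_
  have := h (fun κ => c κ * c' κ) (δ * δ')
  rw [← this]
  congr 1
  ext1 κ
  rw [map_mul, Matrix.smul_mul, Matrix.mul_smul, smul_smul]

theorem cone_mul {x y : 𝒦 → Matrix (Fin d) (Fin d) F} (hx : x ∈ Cone σ) (hy : y ∈ Cone σ) :
    (fun κ => x κ * y κ) ∈ Cone σ := by
  intro f hf h
  have h1 : (fun x : 𝒦 → Matrix (Fin d) (Fin d) F => f (fun κ => x κ * y κ))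
      ∈ PolyFun F 𝒦 d := by
    refine polyFun_comp (PolyFun F 𝒦 d) (fun x κ => x κ * y κ) ?_ hf
    intro κ i j
    simp only [Matrix.mul_apply]
    have : (fun x : 𝒦 → Matrix (Fin d) (Fin d) F => ∑ l, x κ i l * y κ l j)
        = ∑ l, y κ l j • (fun x : 𝒦 → Matrix (Fin d) (Fin d) F => x κ i l) := by
      ext y; simp [Finset.sum_apply, mul_comm]
    rw [this]
    exact Subalgebra.sum_mem _ fun l _ => Subalgebra.smul_mem _ (coord_mem_polyFun _ _ _) _
  exact hx _ h1 fun c' δ' => cone_mul_left σ c' δ' hy f hf h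

/-- generic choice of one element -/
theorem exists_common_ne_zero {X : Type*} (B : Subalgebra F (X → F)) [IsDomain B] {ι : Type*}
    (s : Finset ι) (f : ι → X → F) (hf : ∀ i ∈ s, f i ∈ B) (h : ∀ i ∈ s, ∃ x, f i x ≠ 0) :
    ∃ x, ∀ i ∈ s, f i x ≠ 0 := by
  classical
  have hne : (∏ i ∈ s.attach, (⟨f i.1, hf i.1 i.2⟩ : B)) ≠ 0 := by
    rw [Finset.prod_ne_zero_iff]
    intro i _ h0
    obtain ⟨x, hx⟩ := h i.1 i.2
    exact hx (congrFun (congrArg Subtype.val h0) x)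
  by_contra hcon
  push Not at hcon
  apply hne
  apply Subtype.ext
  ext x
  obtain ⟨i, hi, hix⟩ := hcon x
  have : ((∏ i ∈ s.attach, (⟨f i.1, hf i.1 i.2⟩ : B) : B) : X → F)
    = ∏ i ∈ s.attach, f i.1 := by
    rw [SubmonoidClass.coe_finsetProd]
  rw [this, Finset.prod_apply]
  exact Finset.prod_eq_zero (Finset.mem_attach s ⟨i, hi⟩) hix

theorem entries_mul_mem (B : Subalgebra F (Δ → F)) {κ : 𝒦}
    (hB : ∀ i j, (fun δ => σ κ δ i j) ∈ B) {m n : Type*}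
    (a : Matrix m (Fin d) F) (b : Matrix (Fin d) n F) (i : m) (j : n) :
    (fun δ => (a * σ κ δ * b) i j) ∈ B := by
  have : (fun δ => (a * σ κ δ * b) i j)
      = ∑ l, ∑ l', (a i l' * b l j) • (fun δ => σ κ δ l' l) := by
    ext δ
    simp only [Matrix.mul_apply, Finset.sum_apply, Pi.smul_apply, smul_eq_mul, Finset.sum_mul]
    refine Finset.sum_congr rfl fun _ _ => Finset.sum_congr rfl fun _ _ => by ring
  rw [this]
  exact Subalgebra.sum_mem _ fun l _ => Subalgebra.sum_mem _ fun l' _ =>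
    Subalgebra.smul_mem _ (hB _ _) _

theorem span_linear_zero {κ : 𝒦} (hspan : Submodule.span F (Set.range (σ κ)) = ⊤)
    {E : Type*} [AddCommGroup E] [Module F E]
    (T : Matrix (Fin d) (Fin d) F →ₗ[F] E) (h : ∀ δ, T (σ κ δ) = 0) : T = 0 := by
  apply LinearMap.ext_on_range hspan
  simpa using h

theorem exists_mul_mul_ne_zero {κ : 𝒦} (hspan : Submodule.span F (Set.range (σ κ)) = ⊤)
    {x y : Matrix (Fin d) (Fin d) F} (hx : x ≠ 0) (hy : y ≠ 0) :
    ∃ δ i j, (x * σ κ δ * y) i j ≠ 0 := by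
  by_contra hcon
  push Not at hcon
  have h := span_linear_zero σ hspan
    ((LinearMap.mulRight F y) ∘ₗ (LinearMap.mulLeft F x)) (by
      intro δ; ext i j; simpa using hcon δ i j)
  obtain ⟨i, j, hij⟩ : ∃ i j, x i j ≠ 0 := by
    by_contra hc; push Not at hc; exact hx (by ext i j; exact hc i j)
  obtain ⟨k, l, hkl⟩ : ∃ i j, y i j ≠ 0 := by
    by_contra hc; push Not at hc; exact hy (by ext i j; exact hc i j)
  have h2 := congrFun (congrFun (LinearMap.congr_fun h (Matrix.single j k 1)) i) l
  simp only [LinearMap.comp_apply, LinearMap.mulLeft_apply, LinearMap.mulRight_apply,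
    LinearMap.zero_apply, Matrix.zero_apply] at h2
  rw [Matrix.mul_apply, Finset.sum_eq_single k] at h2
  · simp [hij, hkl] at h2
  · intro b _ hb
    simp [Matrix.mul_single_apply_of_ne, hb]
  · simp

end ConeSection


section RankOne

open scoped Pointwise

variable {F : Type*} [Field F] {Δ : Type*} [Group Δ] {𝒦 : Type*} {d : ℕ}

theorem mvPoly_eq_zero_of_eval [Infinite F] (B : Subalgebra F (Δ → F))
    (p : MvPolynomial 𝒦 B)
    (h : ∀ (δ : Δ) (c : 𝒦 → F),
      MvPolynomial.eval c (MvPolynomial.map ((Pi.evalRingHom (fun _ : Δ => F) δ).comp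
        B.val.toRingHom) p) = 0) : p = 0 := by
  ext m δ
  have : MvPolynomial.map ((Pi.evalRingHom (fun _ : Δ => F) δ).comp B.val.toRingHom) p = 0 :=
    MvPolynomial.funext fun c => by rw [h δ c, map_zero]
  have h2 := congrArg (MvPolynomial.coeff m) this
  simpa [MvPolynomial.coeff_map] using h2

variable [IsAlgClosed F] [Fintype 𝒦]
  (σ : 𝒦 → Δ →* Matrix (Fin d) (Fin d) F) (B : Subalgebra F (Δ → F)) [IsDomain B]

theorem prod_mem_prod_submodule {F B ι : Type*} [Field F] [CommRing B] [Algebra F B]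
    (s : Finset ι) (S : ι → Submodule F B) (b : ι → B) (h : ∀ i ∈ s, b i ∈ S i) :
    ∏ i ∈ s, b i ∈ ∏ i ∈ s, S i := by
  classical
  induction s using Finset.induction_on with
  | empty => simp only [Finset.prod_empty]; exact Submodule.mem_one.2 ⟨1, map_one _⟩
  | insert a s ha ih =>
    rw [Finset.prod_insert ha, Finset.prod_insert ha]
    exact Submodule.mul_mem_mul (h _ (Finset.mem_insert_self _ _))
      (ih fun i hi => h i (Finset.mem_insert_of_mem hi))

theorem prod_X_pow_mul_C {B 𝒦 : Type*} [Fintype 𝒦] [CommRing B] (e : 𝒦 → ℕ) (b : 𝒦 → B) :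
    ∏ κ, ((MvPolynomial.X κ : MvPolynomial 𝒦 B) ^ (e κ) * MvPolynomial.C (b κ))
      = MvPolynomial.monomial (Finsupp.equivFunOnFinite.symm e) (∏ κ, b κ) := by
  rw [MvPolynomial.monomial_eq, Finset.prod_mul_distrib, mul_comm, map_prod,
    Finsupp.prod_fintype _ _ (by simp)]
  simp

/-- the graded statement: abstract version. `f κ i j ∈ B` -/
theorem graded_core (r : 𝒦 → ℕ) (hr : ∀ κ, 0 < r κ)
    (f : ∀ κ, Matrix (Fin (r κ)) (Fin (r κ)) B)
    (hdet : ∀ κ, (f κ).det ≠ 0)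
    (hpt : ∀ y : ∀ κ, Matrix (Fin (r κ)) (Fin (r κ)) F,
      (∀ q : MvPolynomial (Σ κ, Fin (r κ) × Fin (r κ)) F,
        (∀ (c : 𝒦 → F) (δ : Δ),
          MvPolynomial.eval (fun v => c v.1 * (f v.1 v.2.1 v.2.2 : Δ → F) δ) q = 0) →
        MvPolynomial.eval (fun v => y v.1 v.2.1 v.2.2) q = 0) →
      (∀ κ, y κ ≠ 0) → ∀ κ, (y κ).det ≠ 0)
    (κ : 𝒦) (i j i' j' : Fin (r κ)) (hne : f κ i' j' ≠ 0) :
    ∃ c : F, f κ i j = c • f κ i' j' := by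
  classical
  let τ := Σ κ, Fin (r κ) × Fin (r κ)
  let φ : MvPolynomial τ F →ₐ[F] MvPolynomial 𝒦 B :=
    MvPolynomial.aeval (fun v : τ => MvPolynomial.X v.1 * MvPolynomial.C (f v.1 v.2.1 v.2.2))
  let Fs : 𝒦 → Submodule F B := fun κ => Submodule.span F (Set.range fun v : Fin (r κ) × Fin (r κ) => f κ v.1 v.2)
  let U : Submodule F B := ∏ κ, Fs κ
  have hfF : ∀ κ i j, f κ i j ∈ Fs κ := fun κ i j => Submodule.subset_span ⟨(i, j), rfl⟩
  have hU : U.FG := by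
    have : ∀ s : Finset 𝒦, (∏ κ ∈ s, Fs κ).FG := by
      intro s
      induction s using Finset.induction_on with
      | empty => rw [Finset.prod_empty]; exact Submodule.one_eq_span (R := F) (A := B) ▸ Submodule.fg_span_singleton _
      | insert a s ha ih =>
        rw [Finset.prod_insert ha]
        exact Submodule.FG.mul (Submodule.fg_span (Set.finite_range _)) ih
    exact this _
  -- coefficients
  let ν : ℕ → (𝒦 →₀ ℕ) := fun n => Finsupp.equivFunOnFinite.symm (fun _ => n)
  have hcoef : ∀ (q : MvPolynomial τ F) (n : ℕ), MvPolynomial.coeff (ν n) (φ q) ∈ U ^ n := by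
    intro q n
    induction q using MvPolynomial.induction_on' with
    | add p q hp hq => rw [map_add, MvPolynomial.coeff_add]; exact Submodule.add_mem _ hp hq
    | monomial u a =>
      have h1 : φ (MvPolynomial.monomial u a) = a • MvPolynomial.monomial
          (Finsupp.equivFunOnFinite.symm (fun κ => ∑ w, u ⟨κ, w⟩))
          (∏ κ, ∏ w, f κ w.1 w.2 ^ (u ⟨κ, w⟩)) := by
        rw [← prod_X_pow_mul_C]
        simp only [φ]
        rw [MvPolynomial.aeval_monomial, Finsupp.prod_fintype _ _ (by simp), Fintype.prod_sigma,
          Algebra.smul_def]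
        congr 1
        refine Finset.prod_congr rfl fun κ _ => ?_
        simp only [mul_pow]
        rw [Finset.prod_mul_distrib, Finset.prod_pow_eq_pow_sum, map_prod]
        simp only [map_pow]
      rw [h1, MvPolynomial.coeff_smul, MvPolynomial.coeff_monomial]
      refine Submodule.smul_mem _ _ ?_
      split_ifs with hν
      · have hn : ∀ κ, ∑ w, u ⟨κ, w⟩ = n := by
          intro κ
          have := DFunLike.congr_fun hν κ
          simpa [ν] using this
        have hUn : U ^ n = ∏ κ, ∏ w, Fs κ ^ (u ⟨κ, w⟩) := by
          simp only [U]
          rw [← Finset.prod_pow]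
          refine Finset.prod_congr rfl fun κ _ => ?_
          rw [Finset.prod_pow_eq_pow_sum, hn]
        rw [hUn]
        refine prod_mem_prod_submodule _ _ _ fun κ _ => prod_mem_prod_submodule _ _ _ fun w _ => ?_
        exact Submodule.pow_mem_pow _ (hfF _ _ _) _
      · exact Submodule.zero_mem _
  let L := ∏ κ, r κ
  let Lk : 𝒦 → ℕ := fun κ => ∏ κ' ∈ Finset.univ.erase κ, r κ'
  have hL : ∀ κ, r κ * Lk κ = L := fun κ => Finset.mul_prod_erase _ _ (Finset.mem_univ κ)
  have hLpos : 0 < L := Finset.prod_pos fun κ _ => hr κ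
  let P : B := ∏ κ, (f κ).det ^ (Lk κ)
  have hP : P ≠ 0 := Finset.prod_ne_zero_iff.2 fun κ _ => pow_ne_zero _ (hdet κ)
  let Xm : ∀ κ, Matrix (Fin (r κ)) (Fin (r κ)) (MvPolynomial τ F) :=
    fun κ => Matrix.of fun i j => MvPolynomial.X ⟨κ, i, j⟩
  let pP : MvPolynomial τ F := ∏ κ, (Xm κ).det ^ (Lk κ)
  have hpP : φ pP = MvPolynomial.monomial (ν L) P := by
    have h1 : ∀ κ, φ (Xm κ).det = MvPolynomial.X κ ^ (r κ) * MvPolynomial.C (f κ).det := by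
      intro κ
      rw [Matrix.det_apply', Matrix.det_apply', map_sum, map_sum, Finset.mul_sum]
      refine Finset.sum_congr rfl fun π _ => ?_
      rw [map_mul, map_mul, map_prod, map_prod, map_intCast, map_intCast]
      have h2 : ∀ i, φ (Xm κ (π i) i) = MvPolynomial.X κ * MvPolynomial.C (f κ (π i) i) := by
        intro i
        simp [φ, Xm]
      simp only [h2]
      rw [Finset.prod_mul_distrib, Finset.prod_const, Finset.card_univ, Fintype.card_fin]
      ring
    simp only [pP, map_prod, map_pow, h1, mul_pow]
    have h2 := prod_X_pow_mul_C (fun _ : 𝒦 => L) (fun κ => (f κ).det ^ (Lk κ))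
    simp only [ν, P]
    rw [← h2]
    refine Finset.prod_congr rfl fun κ _ => ?_
    rw [← pow_mul, hL, map_pow]
  let 𝔞 : Ideal (MvPolynomial τ F) := Ideal.span (Set.range fun I : (∀ κ, Fin (r κ) × Fin (r κ)) =>
    ∏ κ, MvPolynomial.X (⟨κ, I κ⟩ : τ))
  let 𝔭 : Ideal (MvPolynomial τ F) := RingHom.ker φ ⊔ Ideal.span {pP}
  have hrad : 𝔞 ≤ 𝔭.radical := by
    rw [← MvPolynomial.vanishingIdeal_zeroLocus_eq_radical (K := F), Ideal.span_le]
    rintro _ ⟨I, rfl⟩ y hy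
    by_contra hne0
    simp only [map_prod, MvPolynomial.aeval_X] at hne0
    rw [Finset.prod_eq_zero_iff] at hne0
    push Not at hne0
    have hk := hpt (fun κ => Matrix.of fun i j => y ⟨κ, i, j⟩) (by
      intro q hq
      have hφ : φ q = 0 := by
        apply mvPoly_eq_zero_of_eval B
        intro δ c
        rw [← hq c δ]
        clear hq
        induction q using MvPolynomial.induction_on with
        | C a =>
          simp only [φ, MvPolynomial.algHom_C, MvPolynomial.eval_C]
          rw [MvPolynomial.algebraMap_apply, MvPolynomial.map_C, MvPolynomial.eval_C]
          rfl
        | add p q hp hq => simp only [map_add, hp, hq]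
        | mul_X p v hp =>
          simp only [map_mul, hp]
          simp [φ]
      have := hy q (Ideal.mem_sup_left ((RingHom.mem_ker).2 hφ))
      have h' : MvPolynomial.eval y q = 0 := by rw [← MvPolynomial.coe_aeval_eq_eval]; exact this
      exact h') (by
      intro κ h0
      exact hne0 κ (Finset.mem_univ _) (congrFun (congrFun h0 (I κ).1) (I κ).2))
    have h4 := hy pP (Ideal.mem_sup_right (Ideal.mem_span_singleton_self _))
    simp only [pP, map_prod, map_pow] at h4
    rw [Finset.prod_eq_zero_iff] at h4
    obtain ⟨κ, -, h5⟩ := h4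
    apply hk κ
    have h6 := eq_zero_of_pow_eq_zero h5
    rw [AlgHom.map_det] at h6
    rw [← h6]
    congr 1
    ext i j
    simp [Xm]
  obtain ⟨N, hN⟩ := Ideal.exists_pow_le_of_le_radical_of_fg hrad
    ((isNoetherianRing_iff_ideal_fg _).1 inferInstance 𝔞)
  have hUmem : ∀ n, ∀ b ∈ U ^ n, ∃ q ∈ 𝔞 ^ n, φ q = MvPolynomial.monomial (ν n) b := by
    have h1 : ∀ b ∈ U, ∃ q ∈ 𝔞, φ q = MvPolynomial.monomial (ν 1) b := by
      intro b hb
      have hUs : U = Submodule.span F (∏ κ, Set.range fun v : Fin (r κ) × Fin (r κ) => f κ v.1 v.2) :=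
        Submodule.prod_span _ _
      rw [hUs] at hb
      induction hb using Submodule.span_induction with
      | mem x hx =>
        obtain ⟨g, hg, rfl⟩ := (Set.mem_finsetProd _ _ _).1 hx
        have hg' : ∀ κ, ∃ v : Fin (r κ) × Fin (r κ), f κ v.1 v.2 = g κ := fun κ => hg (Finset.mem_univ κ)
        choose I hI using hg'
        refine ⟨_, Ideal.subset_span ⟨I, rfl⟩, ?_⟩
        simp only [ν]
        rw [← prod_X_pow_mul_C, map_prod]
        refine Finset.prod_congr rfl fun κ _ => ?_
        simp [φ, hI]
      | zero => exact ⟨0, Submodule.zero_mem _, by simp⟩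
      | add x y _ _ hx hy =>
        obtain ⟨q, hq, h⟩ := hx
        obtain ⟨q', hq', h'⟩ := hy
        exact ⟨q + q', Submodule.add_mem _ hq hq', by rw [map_add, h, h', map_add]⟩
      | smul a x _ hx =>
        obtain ⟨q, hq, h⟩ := hx
        refine ⟨a • q, Submodule.smul_of_tower_mem _ a hq, ?_⟩
        rw [map_smul, h, MvPolynomial.smul_monomial]
    intro n
    induction n with
    | zero =>
      intro b hb
      rw [pow_zero] at hb
      obtain ⟨c, rfl⟩ := Submodule.mem_one.1 hb
      refine ⟨MvPolynomial.C c, by simp, ?_⟩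
      have : ν 0 = 0 := by ext; simp [ν]
      rw [this]
      simp only [φ, MvPolynomial.algHom_C]
      rfl
    | succ n ih =>
      intro b hb
      rw [pow_succ] at hb
      induction hb using Submodule.mul_induction_on' with
      | mem_mul_mem x hx y hy =>
        obtain ⟨q, hq, h⟩ := ih x hx
        obtain ⟨q', hq', h'⟩ := h1 y hy
        refine ⟨q * q', by rw [pow_succ]; exact Ideal.mul_mem_mul hq hq', ?_⟩
        have hν : ν n + ν 1 = ν (n + 1) := by ext; simp [ν]
        rw [map_mul, h, h', MvPolynomial.monomial_mul, hν]
      | add x _ y _ hx hy =>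
        obtain ⟨q, hq, h⟩ := hx
        obtain ⟨q', hq', h'⟩ := hy
        exact ⟨q + q', Submodule.add_mem _ hq hq', by rw [map_add, h, h', map_add]⟩
  have hmain : ∀ b ∈ U ^ (N + L), ∃ c ∈ U ^ N, b = P * c := by
    intro b hb
    obtain ⟨q, hq, hqb⟩ := hUmem _ b hb
    have hq' : q ∈ 𝔭 := hN (Ideal.pow_le_pow_right (Nat.le_add_right _ _) hq)
    obtain ⟨k, hk, s, hs, rfl⟩ := Submodule.mem_sup.1 hq'
    obtain ⟨t, rfl⟩ := Ideal.mem_span_singleton'.1 hs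
    rw [map_add, (RingHom.mem_ker).1 hk, zero_add, map_mul, hpP] at hqb
    refine ⟨MvPolynomial.coeff (ν N) (φ t), hcoef t N, ?_⟩
    have h3 := congrArg (MvPolynomial.coeff (ν N + ν L)) hqb
    rw [MvPolynomial.coeff_mul_monomial] at h3
    have : ν (N + L) = ν N + ν L := by ext; simp [ν]
    rw [← this, MvPolynomial.coeff_monomial, if_pos rfl] at h3
    rw [← h3, mul_comm]
  -- conclusion
  have hex : ∀ κ, ∃ v : Fin (r κ) × Fin (r κ), f κ v.1 v.2 ≠ 0 := by
    intro κ
    by_contra hcon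
    push Not at hcon
    apply hdet κ
    have h0 : f κ = 0 := by ext1 i j; exact hcon (i, j)
    have hnon : Nonempty (Fin (r κ)) := ⟨⟨0, hr κ⟩⟩
    rw [h0, Matrix.det_zero]
  choose v hv using hex
  let G : B := ∏ κ' ∈ Finset.univ.erase κ, f κ' (v κ').1 (v κ').2
  have hG : G ≠ 0 := Finset.prod_ne_zero_iff.2 fun κ _ => hv κ
  have hmem : ∀ i j, f κ i j * G ∈ U := by
    intro i j
    have : U = Fs κ * ∏ κ' ∈ Finset.univ.erase κ, Fs κ' :=
      (Finset.mul_prod_erase _ _ (Finset.mem_univ κ)).symm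
    rw [this]
    refine Submodule.mul_mem_mul (hfF _ _ _) ?_
    exact prod_mem_prod_submodule _ _ _ fun κ' _ => hfF _ _ _
  obtain ⟨c, hc⟩ := growth_lemma U hU P hP L N hLpos hmain _ _ (hmem i j) (hmem i' j')
    (mul_ne_zero hne hG)
  refine ⟨c, mul_right_cancel₀ hG ?_⟩
  rw [hc, smul_mul_assoc]

end RankOne


section RankOneB

variable {F : Type*} [Field F]

theorem rank_pos_of_ne_zero {d : ℕ} {x : Matrix (Fin d) (Fin d) F} (hx : x ≠ 0) : 0 < x.rank := by
  by_contra h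
  have h0 : x.rank = 0 := by omega
  obtain ⟨a, b, -, -, hab, -, -⟩ := rank_factorization x
  apply hx
  rw [hab]
  ext i j
  rw [Matrix.mul_apply, Matrix.zero_apply]
  apply Finset.sum_eq_zero
  intro l
  exact absurd l.2 (by omega)

theorem det_ne_zero_of_rank_eq {r : ℕ} {y : Matrix (Fin r) (Fin r) F} (h : y.rank = r) :
    y.det ≠ 0 := by
  intro h0
  obtain ⟨v, hv, hyv⟩ := Matrix.exists_mulVec_eq_zero_iff.2 h0
  have hsurj : Function.Surjective y.mulVecLin := by
    rw [← LinearMap.range_eq_top]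
    apply Submodule.eq_top_of_finrank_eq
    rw [Module.finrank_fin_fun]
    exact h
  have hinj := LinearMap.injective_iff_surjective.2 hsurj
  exact hv (hinj (by simp [hyv]))

variable {Δ : Type*} [Group Δ] {𝒦 : Type*} {d : ℕ} [IsAlgClosed F] [Fintype 𝒦]
  (σ : 𝒦 → Δ →* Matrix (Fin d) (Fin d) F) (B : Subalgebra F (Δ → F)) [IsDomain B]

theorem exists_rank_one (hd : 0 < d) (hB : ∀ κ i j, (fun δ => σ κ δ i j) ∈ B)
    (hspan : ∀ κ, Submodule.span F (Set.range (σ κ)) = ⊤) :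
    ∃ x ∈ Cone σ, ∀ κ, (x κ).rank = 1 := by
  classical
  have hne1 : Nonempty (Fin d) := ⟨⟨0, hd⟩⟩
  have hex : ∃ m, ∃ x ∈ Cone σ, (∀ κ, x κ ≠ 0) ∧ ∑ κ, (x κ).rank = m :=
    ⟨_, _, sigma_mem_cone σ 1, by intro κ; simp, rfl⟩
  obtain ⟨x, hx, hx0, hxm⟩ := Nat.find_spec hex
  have hmin : ∀ y ∈ Cone σ, (∀ κ, y κ ≠ 0) → (∀ κ, (y κ).rank ≤ (x κ).rank) →
      ∀ κ, (y κ).rank = (x κ).rank := by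
    intro y hy hy0 hle
    have h1 := Nat.find_min' hex ⟨y, hy, hy0, rfl⟩
    rw [← hxm] at h1
    have h2 := (Finset.sum_eq_sum_iff_of_le (fun κ _ => hle κ)).1
      (le_antisymm (Finset.sum_le_sum fun κ _ => hle κ) h1)
    exact fun κ => h2 κ (Finset.mem_univ _)
  choose a b a' b' hab ha hb using fun κ => rank_factorization (x κ)
  have hr : ∀ κ, 0 < (x κ).rank := fun κ => rank_pos_of_ne_zero (hx0 κ)
  let f : ∀ κ, Matrix (Fin (x κ).rank) (Fin (x κ).rank) B := fun κ =>
    Matrix.of fun i j => ⟨fun δ => (b κ * σ κ δ * a κ) i j, entries_mul_mem σ B (hB κ) _ _ i j⟩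
  have hfdet : ∀ κ δ, ((f κ).det : Δ → F) δ = (b κ * σ κ δ * a κ).det := by
    intro κ δ
    have := RingHom.map_det ((Pi.evalRingHom (fun _ : Δ => F) δ).comp B.val.toRingHom) (f κ)
    exact this
  -- determinant nonvanishing
  have hdet : ∀ κ, (f κ).det ≠ 0 := by
    have hδ : ∃ δ, ∀ κ, x κ * σ κ δ * x κ ≠ 0 := by
      have h1 : ∀ κ, ∃ δ i j, (x κ * σ κ δ * x κ) i j ≠ 0 := fun κ =>
        exists_mul_mul_ne_zero σ (hspan κ) (hx0 κ) (hx0 κ)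
      choose δ i j hij using h1
      obtain ⟨δ0, h0⟩ := exists_common_ne_zero B Finset.univ
        (fun κ δ => (x κ * σ κ δ * x κ) (i κ) (j κ))
        (fun κ _ => entries_mul_mem σ B (hB κ) _ _ _ _) (fun κ _ => ⟨δ κ, hij κ⟩)
      refine ⟨δ0, fun κ h => h0 κ (Finset.mem_univ _) ?_⟩
      simp only [h, Matrix.zero_apply]
    obtain ⟨δ, hδ⟩ := hδ
    have hmem : (fun κ => x κ * σ κ δ * x κ) ∈ Cone σ :=
      cone_mul σ (cone_mul σ hx (sigma_mem_cone σ δ)) hx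
    have hrk := hmin _ hmem hδ (fun κ => Matrix.rank_mul_le_right _ _)
    intro κ h0
    have h1 := hrk κ
    have h2 : x κ * σ κ δ * x κ = a κ * (b κ * σ κ δ * a κ) * b κ := by
      have : x κ * σ κ δ * x κ = (a κ * b κ) * σ κ δ * (a κ * b κ) := by rw [← hab κ]
      rw [this]
      simp only [Matrix.mul_assoc]
    have h3 : (x κ).rank ≤ (b κ * σ κ δ * a κ).rank := by
      calc (x κ).rank = (a κ * (b κ * σ κ δ * a κ) * b κ).rank := by rw [← h2]; exact h1.symm
        _ ≤ _ := (Matrix.rank_mul_le_left _ _).trans (Matrix.rank_mul_le_right _ _)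
    have h4 := det_ne_zero_of_rank_eq (le_antisymm (Matrix.rank_le_width _) h3)
    apply h4
    rw [← hfdet, h0]
    rfl
  have hcore := graded_core B (fun κ => (x κ).rank) hr f hdet (by
    intro y hy hy0 κ
    have hmem : (fun κ => a κ * y κ * b κ) ∈ Cone σ := by
      intro g hg hgv
      let Y := (Σ κ, Fin (x κ).rank × Fin (x κ).rank) → F
      let ev : MvPolynomial (Σ κ, Fin (x κ).rank × Fin (x κ).rank) F →ₐ[F] (Y → F) :=
        MvPolynomial.aeval fun v y => y v
      have hev : ∀ q y, ev q y = MvPolynomial.eval y q := by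
        intro q y
        induction q using MvPolynomial.induction_on with
        | C a => simp only [ev, MvPolynomial.algHom_C, MvPolynomial.eval_C]; rfl
        | add p q hp hq => simp only [map_add, Pi.add_apply, hp, hq]
        | mul_X p v hp => simp only [map_mul, Pi.mul_apply, hp]; simp [ev]
      have hin := polyFun_comp ev.range
        (fun (y : Y) κ => a κ * (Matrix.of fun i j => y ⟨κ, i, j⟩) * b κ) (by
          intro κ i j
          have : (fun y : Y => (a κ * (Matrix.of fun i j => y ⟨κ, i, j⟩) * b κ) i j)
            = ∑ l, ∑ l', (a κ i l' * b κ l j) • (fun y : Y => y ⟨κ, l', l⟩) := by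
            ext y
            simp only [Matrix.mul_apply, Finset.sum_apply, Pi.smul_apply, smul_eq_mul,
              Finset.sum_mul, Matrix.of_apply]
            refine Finset.sum_congr rfl fun _ _ => Finset.sum_congr rfl fun _ _ => by ring
          rw [this]
          refine Subalgebra.sum_mem _ fun l _ => Subalgebra.sum_mem _ fun l' _ =>
            Subalgebra.smul_mem _ ?_ _
          exact ⟨MvPolynomial.X ⟨κ, l', l⟩, by simp [ev]⟩) hg
      obtain ⟨q, hq⟩ := hin
      have hq' : ∀ y, MvPolynomial.eval y q
          = g (fun κ => a κ * (Matrix.of fun i j => y ⟨κ, i, j⟩) * b κ) := by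
        intro y
        rw [← hev]
        exact congrFun hq y
      have := hy q (by
        intro c δ
        rw [hq']
        have h2 : ∀ κ, a κ * (Matrix.of fun i j => c κ * (f κ i j : Δ → F) δ) * b κ
            = x κ * (c κ • σ κ δ) * x κ := by
          intro κ
          have e1 : (Matrix.of fun i j => c κ * (f κ i j : Δ → F) δ)
            = c κ • (b κ * σ κ δ * a κ) := by
            ext i j
            simp [f]
          have : x κ * (c κ • σ κ δ) * x κ = (a κ * b κ) * (c κ • σ κ δ) * (a κ * b κ) := by
            rw [← hab κ]
          rw [this, e1]
          simp only [Matrix.mul_assoc, Matrix.mul_smul, Matrix.smul_mul]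
        simp only [h2]
        exact cone_mul σ (cone_mul σ hx (base_mem_cone σ c δ)) hx g hg hgv)
      rw [hq'] at this
      exact this
    have hback : ∀ κ, a' κ * (a κ * y κ * b κ) * b' κ = y κ := by
      intro κ
      calc a' κ * (a κ * y κ * b κ) * b' κ = (a' κ * a κ) * y κ * (b κ * b' κ) := by
            simp only [Matrix.mul_assoc]
        _ = y κ := by rw [ha, hb, Matrix.one_mul, Matrix.mul_one]
    have hrk := hmin _ hmem (by
      intro κ h0
      apply hy0 κ
      rw [← hback κ]
      rw [h0]
      simp) (fun κ => ((Matrix.rank_mul_le_right _ _).trans (Matrix.rank_le_height _)))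
    apply det_ne_zero_of_rank_eq
    refine le_antisymm (Matrix.rank_le_width _) ?_
    refine (hrk κ).symm.le.trans ?_
    exact (Matrix.rank_mul_le_left _ _).trans (Matrix.rank_mul_le_right _ _))
  refine ⟨x, hx, fun κ => ?_⟩
  by_contra hne
  have h2 : 1 < (x κ).rank := by have := hr κ; omega
  let i0 : Fin (x κ).rank := ⟨0, hr κ⟩
  let i1 : Fin (x κ).rank := ⟨1, h2⟩
  -- linear functionals
  have hsurj : ∀ (s t : F), (∀ δ, s * (b κ * σ κ δ * a κ) i0 i0 + t * (b κ * σ κ δ * a κ) i0 i1 = 0) →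
      s = 0 ∧ t = 0 := by
    intro s t h
    let T : Matrix (Fin d) (Fin d) F →ₗ[F] F :=
      { toFun := fun m => s * (b κ * m * a κ) i0 i0 + t * (b κ * m * a κ) i0 i1
        map_add' := by intro m m'; simp only [Matrix.mul_add, Matrix.add_mul, Matrix.add_apply]; ring
        map_smul' := by
          intro c m
          simp only [Matrix.mul_smul, Matrix.smul_mul, Matrix.smul_apply, smul_eq_mul,
            RingHom.id_apply]; ring }
    have hT := span_linear_zero σ (hspan κ) T h
    have key : ∀ E : Matrix (Fin (x κ).rank) (Fin (x κ).rank) F, s * E i0 i0 + t * E i0 i1 = 0 := by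
      intro E
      have h5 := LinearMap.congr_fun hT (b' κ * E * a' κ)
      have h6 : b κ * (b' κ * E * a' κ) * a κ = E := by
        calc b κ * (b' κ * E * a' κ) * a κ = (b κ * b' κ) * E * (a' κ * a κ) := by
              simp only [Matrix.mul_assoc]
          _ = E := by rw [ha, hb, Matrix.one_mul, Matrix.mul_one]
      simp only [T, LinearMap.coe_mk, AddHom.coe_mk, h6, LinearMap.zero_apply] at h5
      exact h5
    have hi : i0 ≠ i1 := by simp [i0, i1, Fin.ext_iff]
    have k1 := key (Matrix.single i0 i0 1)
    have k2 := key (Matrix.single i0 i1 1)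
    simp [Matrix.single_apply, hi, hi.symm] at k1 k2
    exact ⟨k1, k2⟩
  have hne0 : f κ i0 i0 ≠ 0 := by
    intro h0
    have := hsurj 1 0 (by
      intro δ
      have := congrFun (congrArg Subtype.val h0) δ
      rw [one_mul, zero_mul, add_zero]
      exact this)
    exact one_ne_zero this.1
  obtain ⟨c, hc⟩ := hcore κ i0 i1 i0 i0 hne0
  have := hsurj c (-1) (by
    intro δ
    have h7 := congrFun (congrArg Subtype.val hc) δ
    have h8 : (b κ * σ κ δ * a κ) i0 i1 = c * (b κ * σ κ δ * a κ) i0 i0 := h7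
    rw [h8]; ring)
  exact absurd this.2 (by norm_num)

end RankOneB


section WordArg

variable {F : Type*} [Field F] {Δ : Type*} [Group Δ]

/-- functions on a power which are regular in each coordinate. -/
def SepReg {X : Type*} (B : Subalgebra F (X → F)) (V : Type*) [DecidableEq V] :
    Subalgebra F ((V → X) → F) where
  carrier := {G | ∀ δ v, (fun t => G (Function.update δ v t)) ∈ B}
  mul_mem' := fun ha hb δ v => B.mul_mem (ha δ v) (hb δ v)
  add_mem' := fun ha hb δ v => B.add_mem (ha δ v) (hb δ v)
  algebraMap_mem' := fun r _ _ => B.algebraMap_mem r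

theorem coord_mem_sepReg {X : Type*} (B : Subalgebra F (X → F)) {V : Type*} [DecidableEq V]
    {f : X → F} (hf : f ∈ B) (v : V) : (fun δ : V → X => f (δ v)) ∈ SepReg B V := by
  intro δ w
  by_cases h : v = w
  · subst h
    simpa using hf
  · simp only [Function.update_of_ne h]
    exact B.algebraMap_mem _

theorem sepReg_mul_ne_zero {X : Type*} (B : Subalgebra F (X → F)) [IsDomain B] {V : Type*}
    [DecidableEq V] (S : Finset V) : ∀ {G H : (V → X) → F}, G ∈ SepReg B V → H ∈ SepReg B V →
    ∀ δ δ' : V → X, (∀ v, v ∉ S → δ v = δ' v) → G δ ≠ 0 → H δ' ≠ 0 →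
      ∃ e, G e ≠ 0 ∧ H e ≠ 0 := by
  induction S using Finset.induction_on with
  | empty =>
    intro G H _ _ δ δ' h h1 h2
    have : δ = δ' := funext fun v => h v (by simp)
    subst this
    exact ⟨δ, h1, h2⟩
  | insert v S hv ih =>
    intro G H hG hH δ δ' h h1 h2
    obtain ⟨t, ht⟩ := exists_common_ne_zero B (Finset.univ : Finset Bool)
      (fun b t => if b then G (Function.update δ v t) else H (Function.update δ' v t))
      (by
        intro b _
        cases b
        · simpa using hH δ' v
        · simpa using hG δ v)
      (by
        intro b _
        cases b
        · exact ⟨δ' v, by simpa using h2⟩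
        · exact ⟨δ v, by simpa using h1⟩)
    refine ih hG hH (Function.update δ v t) (Function.update δ' v t) ?_ ?_ ?_
    · intro w hw
      by_cases hwv : w = v
      · subst hwv; simp
      · rw [Function.update_of_ne hwv, Function.update_of_ne hwv]
        exact h w (by simp [hwv, hw])
    · simpa using ht true (Finset.mem_univ _)
    · simpa using ht false (Finset.mem_univ _)

theorem sepReg_common {X : Type*} [Nonempty X] (B : Subalgebra F (X → F)) [IsDomain B] {V : Type*}
    [DecidableEq V] [Fintype V] {ι : Type*} (s : Finset ι) (G : ι → (V → X) → F)
    (hG : ∀ i, G i ∈ SepReg B V) (h : ∀ i, ∃ δ, G i δ ≠ 0) :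
    ∃ δ, ∀ i ∈ s, G i δ ≠ 0 := by
  classical
  have : ∃ δ, (∏ i ∈ s, G i) δ ≠ 0 := by
    induction s using Finset.induction_on with
    | empty => exact ⟨fun _ => Classical.arbitrary X, by simp⟩
    | insert a s ha ih =>
      obtain ⟨δ, hδ⟩ := ih
      obtain ⟨δ', hδ'⟩ := h a
      obtain ⟨e, h1, h2⟩ := sepReg_mul_ne_zero B Finset.univ (hG a)
        (Subalgebra.prod_mem _ fun i (_ : i ∈ s) => hG i) δ' δ (by simp) hδ' hδ
      refine ⟨e, ?_⟩
      rw [Finset.prod_insert ha]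
      exact mul_ne_zero h1 h2
  obtain ⟨δ, hδ⟩ := this
  refine ⟨δ, fun i hi h0 => hδ ?_⟩
  rw [Finset.prod_apply]
  exact Finset.prod_eq_zero hi h0

/-- transpose or not -/
def trb {d : ℕ} (s : Bool) (m : Matrix (Fin d) (Fin d) F) : Matrix (Fin d) (Fin d) F :=
  if s then m else m.transpose

theorem prod_vecMulVec {d : ℕ} : ∀ {ℓ : ℕ} (p q : Fin (ℓ + 1) → Fin d → F),
    (∀ k : Fin ℓ, q k.castSucc ⬝ᵥ p k.succ ≠ 0) →
    ∃ c : F, c ≠ 0 ∧ (List.ofFn fun k => Matrix.vecMulVec (p k) (q k)).prod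
      = c • Matrix.vecMulVec (p 0) (q (Fin.last ℓ)) := by
  intro ℓ
  induction ℓ with
  | zero =>
    intro p q _
    refine ⟨1, one_ne_zero, ?_⟩
    simp
  | succ ℓ ih =>
    intro p q h
    obtain ⟨c, hc, hp⟩ := ih (fun k => p k.succ) (fun k => q k.succ) (fun k => h k.succ)
    refine ⟨(q 0 ⬝ᵥ p 1) * c, mul_ne_zero (h 0) hc, ?_⟩
    rw [List.ofFn_succ, List.prod_cons, hp, Matrix.mul_smul, Matrix.vecMulVec_mul_vecMulVec]
    ext a b
    simp [Matrix.vecMulVec_apply]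
    ring

variable {d ℓ : ℕ} {ι : Type*} [Fintype ι] [DecidableEq ι]
  (i : Fin (ℓ + 1) → ι) (s : Fin (ℓ + 1) → Bool)

theorem wprod_polyFun (X : ι → Fin (ℓ + 1) → Matrix (Fin d) (Fin d) F) (i0 : ι)
    (l : List (Fin (ℓ + 1))) : ∀ p q : Fin d,
    (fun x : Fin (ℓ + 1) → Matrix (Fin d) (Fin d) F =>
      (l.map fun k => trb (s k) (Function.update X i0 x (i k) k)).prod p q)
        ∈ PolyFun F (Fin (ℓ + 1)) d := by
  induction l with
  | nil =>
    intro p q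
    simp only [List.map_nil, List.prod_nil]
    exact Subalgebra.algebraMap_mem _ _
  | cons k l ih =>
    intro p q
    simp only [List.map_cons, List.prod_cons, Matrix.mul_apply]
    have : (fun x : Fin (ℓ + 1) → Matrix (Fin d) (Fin d) F =>
      ∑ j, trb (s k) (Function.update X i0 x (i k) k) p j *
        (l.map fun k => trb (s k) (Function.update X i0 x (i k) k)).prod j q)
      = ∑ j, (fun x : Fin (ℓ + 1) → Matrix (Fin d) (Fin d) F =>
        trb (s k) (Function.update X i0 x (i k) k) p j) *
        (fun x : Fin (ℓ + 1) → Matrix (Fin d) (Fin d) F =>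
        (l.map fun k => trb (s k) (Function.update X i0 x (i k) k)).prod j q) := by
      ext x; simp [Finset.sum_apply]
    rw [this]
    refine Subalgebra.sum_mem _ fun j _ => Subalgebra.mul_mem _ ?_ (ih _ _)
    by_cases h : i k = i0
    · simp only [h, Function.update_self]
      cases hs : s k
      · simp only [trb, Bool.false_eq_true, if_false, Matrix.transpose_apply]
        exact coord_mem_polyFun _ _ _
      · simp only [trb, if_true]
        exact coord_mem_polyFun _ _ _
    · simp only [Function.update_of_ne h]
      exact Subalgebra.algebraMap_mem _ _

theorem wprod_cone (σ : Fin (ℓ + 1) → Δ →* Matrix (Fin d) (Fin d) F)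
    (Λ : Matrix (Fin d) (Fin d) F →ₗ[F] F)
    (h0 : ∀ (c : ι → Fin (ℓ + 1) → F) (δ : ι → Δ),
      Λ ((List.finRange (ℓ + 1)).map fun k => trb (s k) (c (i k) k • σ k (δ (i k)))).prod = 0)
    (S : Finset ι) : ∀ (X : ι → Fin (ℓ + 1) → Matrix (Fin d) (Fin d) F),
    (∀ j ∈ S, X j ∈ Cone σ) →
    (∀ j, j ∉ S → ∃ (c : Fin (ℓ + 1) → F) (δ : Δ), X j = fun k => c k • σ k δ) →
    Λ ((List.finRange (ℓ + 1)).map fun k => trb (s k) (X (i k) k)).prod = 0 := by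
  induction S using Finset.induction_on with
  | empty =>
    intro X _ h
    choose c δ hX using fun j => h j (by simp)
    have := h0 c δ
    simpa [hX] using this
  | insert j0 S hj ih =>
    intro X hX h
    have hpoly : (fun x : Fin (ℓ + 1) → Matrix (Fin d) (Fin d) F =>
      Λ ((List.finRange (ℓ + 1)).map fun k => trb (s k) (Function.update X j0 x (i k) k)).prod)
        ∈ PolyFun F (Fin (ℓ + 1)) d := by
      have : ∀ m, Λ m = ∑ a, ∑ b, Λ (Matrix.single a b 1) * m a b := by
        intro m
        conv_lhs => rw [Matrix.matrix_eq_sum_single m]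
        simp only [map_sum]
        refine Finset.sum_congr rfl fun a _ => Finset.sum_congr rfl fun b _ => ?_
        have e : Matrix.single a b (m a b) = m a b • Matrix.single a b (1 : F) := by simp
        rw [e, map_smul, smul_eq_mul, mul_comm]
      have e2 : (fun x : Fin (ℓ + 1) → Matrix (Fin d) (Fin d) F =>
        Λ ((List.finRange (ℓ + 1)).map fun k => trb (s k) (Function.update X j0 x (i k) k)).prod)
        = ∑ a, ∑ b, Λ (Matrix.single a b 1) • (fun x : Fin (ℓ + 1) → Matrix (Fin d) (Fin d) F =>
        ((List.finRange (ℓ + 1)).map fun k => trb (s k) (Function.update X j0 x (i k) k)).prod a b) := by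
        ext x; rw [this]; simp [Finset.sum_apply]
      rw [e2]
      exact Subalgebra.sum_mem _ fun a _ => Subalgebra.sum_mem _ fun b _ =>
        Subalgebra.smul_mem _ (wprod_polyFun i s X j0 _ a b) _
    have := hX j0 (Finset.mem_insert_self _ _) _ hpoly (by
      intro c δ
      apply ih
      · intro j hjS
        have : j ≠ j0 := fun e => hj (e ▸ hjS)
        rw [Function.update_of_ne this]
        exact hX j (Finset.mem_insert_of_mem hjS)
      · intro j hjS
        by_cases e : j = j0
        · subst e
          exact ⟨c, δ, by simp⟩
        · rw [Function.update_of_ne e]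
          exact h j (by simp [e, hjS]))
    simpa using this


/-- The main algebraic contradiction. -/
theorem no_identity [IsAlgClosed F] (hd : 2 ≤ d)
    (hred : ∀ k : Fin ℓ, i k.castSucc = i k.succ → s k.castSucc = s k.succ)
    (σ : Fin (ℓ + 1) → Δ →* Matrix (Fin d) (Fin d) F)
    (B : Subalgebra F (Δ → F)) [IsDomain B]
    (hB : ∀ κ i j, (fun δ => σ κ δ i j) ∈ B)
    (hspan : ∀ κ, Submodule.span F (Set.range (σ κ)) = ⊤)
    (hid : ∀ δ : ι → Δ, (List.ofFn fun k => trb (s k) (σ k (δ (i k)))).prod = 1) : False := by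
  classical
  obtain ⟨x, hx, hx1⟩ := exists_rank_one σ B (by omega) hB hspan
  have hfac : ∀ k, ∃ u φ : Fin d → F, x k = Matrix.vecMulVec u φ ∧ u ≠ 0 ∧ φ ≠ 0 := by
    intro k
    obtain ⟨a, b, -, -, hab, -, -⟩ := rank_factorization (x k)
    have h0 : 0 < (x k).rank := by rw [hx1]; norm_num
    have hsub : ∀ j : Fin (x k).rank, j = ⟨0, h0⟩ := by
      intro j
      have h1 := hx1 k
      apply Fin.ext
      have := j.2
      change j.1 = 0
      omega
    have he : x k = Matrix.vecMulVec (fun j => a j ⟨0, h0⟩) (fun j => b ⟨0, h0⟩ j) := by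
      conv_lhs => rw [hab]
      ext p q
      rw [Matrix.mul_apply, Matrix.vecMulVec_apply]
      apply Finset.sum_eq_single
      · intro j _ hj
        exact absurd (hsub j) hj
      · simp
    have hne : x k ≠ 0 := by
      intro h
      have h1 := hx1 k
      rw [h, Matrix.rank_zero] at h1
      omega
    refine ⟨_, _, he, ?_, ?_⟩
    · intro h
      rw [h] at he
      apply hne; rw [he]; ext; simp [Matrix.vecMulVec_apply]
    · intro h
      rw [h] at he
      apply hne; rw [he]; ext; simp [Matrix.vecMulVec_apply]
  choose u φ hxu hu hφ using hfac
  let vf : Fin (ℓ + 1) → Bool → Δ → Fin d → F := fun k b δ =>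
    if b then Matrix.vecMul (φ k) (σ k δ) else Matrix.mulVec (σ k δ) (u k)
  have hvf1 : ∀ k b, vf k b 1 ≠ 0 := by
    intro k b
    cases b
    · simpa [vf] using hu k
    · simpa [vf] using hφ k
  have hvfne : ∀ k b (z : Fin d → F), z ≠ 0 → ∃ δ, vf k b δ ⬝ᵥ z ≠ 0 := by
    intro k b z hz
    by_contra hcon
    push Not at hcon
    have aux : ∀ y : Fin d → F, y ≠ 0 → ∃ p, y p ≠ 0 := by
      intro y hy
      by_contra hc
      push Not at hc
      exact hy (funext hc)
    obtain ⟨q, hq⟩ := aux z hz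
    cases b
    · obtain ⟨p, hp⟩ := aux _ (hu k)
      let T : Matrix (Fin d) (Fin d) F →ₗ[F] F :=
        { toFun := fun m => Matrix.mulVec m (u k) ⬝ᵥ z
          map_add' := by intro m m'; rw [Matrix.add_mulVec, add_dotProduct]
          map_smul' := by intro c m; rw [Matrix.smul_mulVec, smul_dotProduct]; rfl }
      have hT := span_linear_zero σ (hspan k) T (by
        intro δ; have h := hcon δ; simp only [vf] at h; exact h)
      have := LinearMap.congr_fun hT (Matrix.single q p 1)
      have h3 : Matrix.mulVec (Matrix.single q p (1 : F)) (u k) ⬝ᵥ z = u k p * z q := by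
        simp only [dotProduct, Matrix.mulVec, Matrix.single_apply]
        rw [Finset.sum_eq_single q]
        · simp
        · intro b _ hb; simp [hb.symm]
        · simp
      exact mul_ne_zero hp hq (h3.symm.trans this)
    · obtain ⟨p, hp⟩ := aux _ (hφ k)
      let T : Matrix (Fin d) (Fin d) F →ₗ[F] F :=
        { toFun := fun m => Matrix.vecMul (φ k) m ⬝ᵥ z
          map_add' := by intro m m'; rw [Matrix.vecMul_add, add_dotProduct]
          map_smul' := by intro c m; rw [Matrix.vecMul_smul, smul_dotProduct]; rfl }
      have hT := span_linear_zero σ (hspan k) T (by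
        intro δ; have h := hcon δ; simp only [vf] at h; exact h)
      have := LinearMap.congr_fun hT (Matrix.single p q 1)
      have h3 : Matrix.vecMul (φ k) (Matrix.single p q (1 : F)) ⬝ᵥ z = φ k p * z q := by
        simp only [dotProduct, Matrix.vecMul, Matrix.single_apply]
        rw [Finset.sum_eq_single q]
        · simp
        · intro b _ hb; simp [hb.symm]
        · simp
      exact mul_ne_zero hp hq (h3.symm.trans this)
  have hvfB : ∀ k b p, (fun δ => vf k b δ p) ∈ B := by
    intro k b p
    cases b
    · have : (fun δ => vf k false δ p) = ∑ j, u k j • (fun δ => σ k δ p j) := by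
        ext δ; simp [vf, Matrix.mulVec, dotProduct, Finset.sum_apply, mul_comm]
      rw [this]
      exact Subalgebra.sum_mem _ fun j _ => Subalgebra.smul_mem _ (hB _ _ _) _
    · have : (fun δ => vf k true δ p) = ∑ j, φ k j • (fun δ => σ k δ j p) := by
        ext δ; simp [vf, Matrix.vecMul, dotProduct, Finset.sum_apply]
      rw [this]
      exact Subalgebra.sum_mem _ fun j _ => Subalgebra.smul_mem _ (hB _ _ _) _
  have hone : ∀ k b, ∃ p, vf k b 1 p ≠ 0 := by
    intro k b
    by_contra hc
    push Not at hc
    exact hvf1 k b (funext hc)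
  obtain ⟨p0, hp0⟩ := hone 0 (!s 0)
  obtain ⟨q0, hq0⟩ := hone (Fin.last ℓ) (s (Fin.last ℓ))
  let G : Option (Option (Fin ℓ)) → (ι × Bool → Δ) → F := fun o => match o with
    | none => fun δ => vf 0 (!s 0) (δ (i 0, !s 0)) p0
    | some none => fun δ => vf (Fin.last ℓ) (s (Fin.last ℓ)) (δ (i (Fin.last ℓ), s (Fin.last ℓ))) q0
    | some (some k) => fun δ => vf k.castSucc (s k.castSucc) (δ (i k.castSucc, s k.castSucc)) ⬝ᵥ
        vf k.succ (!s k.succ) (δ (i k.succ, !s k.succ))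
  obtain ⟨δ, hδ⟩ := sepReg_common B Finset.univ G (by
    intro o
    match o with
    | none => exact coord_mem_sepReg B (hvfB 0 (!s 0) p0) _
    | some none => exact coord_mem_sepReg B (hvfB (Fin.last ℓ) (s (Fin.last ℓ)) q0) _
    | some (some k) =>
      have : G (some (some k)) = ∑ p, (fun δ : ι × Bool → Δ =>
        vf k.castSucc (s k.castSucc) (δ (i k.castSucc, s k.castSucc)) p) *
        (fun δ : ι × Bool → Δ => vf k.succ (!s k.succ) (δ (i k.succ, !s k.succ)) p) := by
        ext δ
        simp only [G, dotProduct, Finset.sum_apply, Pi.mul_apply]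
      rw [this]
      exact Subalgebra.sum_mem _ fun p _ => Subalgebra.mul_mem _
        (coord_mem_sepReg B (hvfB _ _ p) _) (coord_mem_sepReg B (hvfB _ _ p) _)) (by
    intro o
    match o with
    | none => exact ⟨fun _ => 1, hp0⟩
    | some none => exact ⟨fun _ => 1, hq0⟩
    | some (some k) =>
      obtain ⟨t, ht⟩ := hvfne k.castSucc (s k.castSucc) (vf k.succ (!s k.succ) 1) (hvf1 _ _)
      refine ⟨Function.update (fun _ => 1) (i k.castSucc, s k.castSucc) t, ?_⟩
      have hne : (i k.succ, !s k.succ) ≠ (i k.castSucc, s k.castSucc) := by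
        intro h
        rw [Prod.mk.injEq] at h
        have := hred k h.1.symm
        rw [this] at h
        simp at h
      simp only [G, Function.update_self, Function.update_of_ne hne]
      exact ht)
  have hδ' : ∀ o, G o δ ≠ 0 := fun o => hδ o (Finset.mem_univ _)
  -- the special point
  let X : ι → Fin (ℓ + 1) → Matrix (Fin d) (Fin d) F := fun j k =>
    σ k (δ (j, false)) * x k * σ k (δ (j, true))
  have hX : ∀ j, X j ∈ Cone σ := fun j =>
    cone_mul σ (cone_mul σ (sigma_mem_cone σ _) hx) (sigma_mem_cone σ _)
  have htr : ∀ k, trb (s k) (X (i k) k) = Matrix.vecMulVec (vf k (!s k) (δ (i k, !s k)))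
      (vf k (s k) (δ (i k, s k))) := by
    intro k
    have h1 : ∀ j, X j k = Matrix.vecMulVec (vf k false (δ (j, false))) (vf k true (δ (j, true))) := by
      intro j
      simp only [X, hxu, vf, Bool.false_eq_true, if_false, if_true]
      rw [Matrix.mul_vecMulVec, Matrix.vecMulVec_mul]
    rw [h1]
    cases hs : s k
    · simp only [trb, Bool.false_eq_true, if_false, Bool.not_false, Matrix.transpose_vecMulVec]
    · simp only [trb, if_true, Bool.not_true]
  have hscal : ∀ (Λ : Matrix (Fin d) (Fin d) F →ₗ[F] F), Λ 1 = 0 →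
      Λ (List.ofFn fun k => trb (s k) (X (i k) k)).prod = 0 := by
    intro Λ hΛ
    rw [List.ofFn_eq_map]
    refine wprod_cone i s σ Λ ?_ Finset.univ X (fun j _ => hX j) (by simp)
    intro c δ
    have h1 : ∀ l : List (Fin (ℓ + 1)), ∃ e : F,
        (l.map fun k => trb (s k) (c (i k) k • σ k (δ (i k)))).prod
        = e • (l.map fun k => trb (s k) (σ k (δ (i k)))).prod := by
      intro l
      induction l with
      | nil => exact ⟨1, by simp⟩
      | cons k l ih =>
        obtain ⟨e, he⟩ := ih
        refine ⟨c (i k) k * e, ?_⟩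
        simp only [List.map_cons, List.prod_cons, he]
        have : trb (s k) (c (i k) k • σ k (δ (i k))) = c (i k) k • trb (s k) (σ k (δ (i k))) := by
          cases s k <;> simp [trb]
        rw [this, Matrix.smul_mul, Matrix.mul_smul, smul_smul]
    obtain ⟨e, he⟩ := h1 (List.finRange (ℓ + 1))
    rw [he, ← List.ofFn_eq_map, hid, map_smul, hΛ, smul_zero]
  obtain ⟨c, hc, hprod⟩ := prod_vecMulVec (fun k => vf k (!s k) (δ (i k, !s k)))
    (fun k => vf k (s k) (δ (i k, s k))) (fun k => hδ' (some (some k)))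
  simp only [htr] at hscal
  rw [hprod] at hscal
  set p := vf 0 (!s 0) (δ (i 0, !s 0)) with hp
  set q := vf (Fin.last ℓ) (s (Fin.last ℓ)) (δ (i (Fin.last ℓ), s (Fin.last ℓ))) with hq
  have hpp : p p0 ≠ 0 := hδ' none
  have hqq : q q0 ≠ 0 := hδ' (some none)
  have hoff : ∀ a b, a ≠ b → p a * q b = 0 := by
    intro a b hab
    have := hscal (Matrix.entryLinearMap F F a b) (by simp [hab])
    simpa [Matrix.vecMulVec_apply, hc] using this
  have hdiag : ∀ a b, p a * q a = p b * q b := by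
    intro a b
    have := hscal (Matrix.entryLinearMap F F a a - Matrix.entryLinearMap F F b b) (by simp)
    simp only [LinearMap.sub_apply, Matrix.entryLinearMap_apply, Matrix.smul_apply, smul_eq_mul,
      Matrix.vecMulVec_apply] at this
    have h2 := sub_eq_zero.1 this
    exact mul_left_cancel₀ hc h2
  have h00 : p0 = q0 := by
    by_contra h
    exact mul_ne_zero hpp hqq (hoff _ _ h)
  subst h00
  obtain ⟨b, hb⟩ : ∃ b : Fin d, b ≠ p0 := by
    have : Nontrivial (Fin d) := Fin.nontrivial_iff_two_le.2 hd
    exact exists_ne p0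
  have h5 := hdiag p0 b
  have h6 : p b * q b ≠ 0 := by rw [← h5]; exact mul_ne_zero hpp hqq
  exact mul_ne_zero hpp (right_ne_zero_of_mul h6) (hoff _ _ hb.symm)

end WordArg


section Wedder

open scoped commutatorElement

theorem solvable_of_nilpotent_comm {R Δ : Type*} [Ring R] [Group Δ] (J : Ideal R) [J.IsTwoSided]
    (N : ℕ) (hN : J ^ N = ⊥) (θ : Δ →* R) (hθ : Function.Injective θ)
    (hcomm : ∀ x y : R, x * y - y * x ∈ J) : IsSolvable Δ := by
  let K : ℕ → Subgroup Δ := fun n =>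
    MonoidHom.ker (((Ideal.Quotient.mk (J ^ n) : R →* R ⧸ J ^ n)).comp θ)
  have hK : ∀ n δ, δ ∈ K n ↔ θ δ - 1 ∈ J ^ n := by
    intro n δ
    rw [← Ideal.Quotient.eq]
    rfl
  have hinv : ∀ δ, θ δ * θ δ⁻¹ = 1 := fun δ => by rw [← map_mul]; simp
  have hform : ∀ x y : Δ, θ ⁅x, y⁆ - 1 = (θ x * θ y - θ y * θ x) * (θ x⁻¹ * θ y⁻¹) := by
    intro x y
    have : (1 : R) = θ y * θ x * (θ x⁻¹ * θ y⁻¹) := by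
      calc (1 : R) = θ y * θ y⁻¹ := (hinv y).symm
        _ = θ y * (θ x * θ x⁻¹) * θ y⁻¹ := by rw [hinv x, mul_one, hinv y]
        _ = _ := by simp only [mul_assoc]
    rw [sub_mul, ← this, commutatorElement_def]
    simp only [map_mul, mul_assoc]
  have hstep : ∀ n, derivedSeries Δ (n + 1) ≤ K (n + 1) := by
    intro n
    induction n with
    | zero =>
      rw [derivedSeries_succ, Subgroup.commutator_le]
      intro x _ y _
      rw [hK, hform, zero_add, Submodule.pow_one]
      exact J.mul_mem_right _ (hcomm _ _)
    | succ n ih =>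
      rw [derivedSeries_succ, Subgroup.commutator_le]
      intro x hx y hy
      rw [hK, hform]
      refine Ideal.mul_mem_right _ _ ?_
      have hx' := (hK _ _).1 (ih hx)
      have hy' := (hK _ _).1 (ih hy)
      have e : θ x * θ y - θ y * θ x = (θ x - 1) * (θ y - 1) - (θ y - 1) * (θ x - 1) := by
        noncomm_ring
      rw [e]
      have hJ : J ^ (n + 1) * J ^ (n + 1) ≤ J ^ (n + 1 + 1) := by
        rw [← Ideal.IsTwoSided.pow_add]
        exact Ideal.pow_le_pow_right (by omega)
      exact Ideal.sub_mem _ (hJ (Ideal.mul_mem_mul hx' hy')) (hJ (Ideal.mul_mem_mul hy' hx'))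
  refine ⟨⟨N + 1, ?_⟩⟩
  rw [eq_bot_iff]
  intro δ hδ
  have h1 := (hK _ _).1 (hstep N hδ)
  have h2 : J ^ (N + 1) = ⊥ := by
    rw [eq_bot_iff, ← hN]
    exact Ideal.pow_le_pow_right (by omega)
  rw [h2, Ideal.mem_bot, sub_eq_zero] at h1
  rw [Subgroup.mem_bot]
  exact hθ (by rw [h1, map_one])

theorem solvable_or_rep {F Δ : Type*} [Field F] [IsAlgClosed F] [Group Δ] {k : ℕ}
    (τ : Δ →* Matrix (Fin k) (Fin k) F) (hinj : Function.Injective τ) :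
    IsSolvable Δ ∨ ∃ d, 2 ≤ d ∧ ∃ ρ : Δ →* Matrix (Fin d) (Fin d) F,
      Submodule.span F (Set.range ρ) = ⊤ ∧
      ∀ p q, ∃ c : Fin k → Fin k → F, ∀ δ, ρ δ p q = ∑ a, ∑ b, c a b * τ δ a b := by
  classical
  let 𝒜 : Subalgebra F (Matrix (Fin k) (Fin k) F) := Algebra.adjoin F (Set.range τ)
  have hspan : Subalgebra.toSubmodule 𝒜 = Submodule.span F (Set.range τ) := by
    rw [Algebra.adjoin_eq_span]
    congr 1
    rw [← MonoidHom.coe_mrange, Submonoid.closure_eq]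
  have hfin : FiniteDimensional F 𝒜 := inferInstance
  have hart : IsArtinianRing 𝒜 := IsArtinianRing.of_finite F 𝒜
  let J := Ring.jacobson 𝒜
  obtain ⟨N, hN⟩ : IsNilpotent (Ring.jacobson 𝒜) := IsSemiprimaryRing.isNilpotent
  let θ : Δ →* 𝒜 := τ.codRestrict 𝒜 (fun δ => Algebra.subset_adjoin ⟨δ, rfl⟩)
  have hθ : Function.Injective θ := fun x y h => hinj (congrArg Subtype.val h)
  obtain ⟨n, d, hd, ⟨e⟩⟩ :=
    IsSemisimpleRing.exists_algEquiv_pi_matrix_of_isAlgClosed F (𝒜 ⧸ Ring.jacobson 𝒜)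
  by_cases hall : ∀ i, d i = 1
  · left
    refine solvable_of_nilpotent_comm (Ring.jacobson 𝒜) N hN θ hθ ?_
    intro x y
    rw [← Ideal.Quotient.eq]
    apply e.injective
    simp only [map_mul]
    ext i p q
    have hsub : Subsingleton (Fin (d i)) := by rw [hall i]; infer_instance
    simp only [Pi.mul_apply, Matrix.mul_apply]
    refine Finset.sum_congr rfl fun j _ => ?_
    rw [Subsingleton.elim p j, Subsingleton.elim q j, mul_comm]
  · right
    push Not at hall
    obtain ⟨i, hi⟩ := hall
    have hi2 : 2 ≤ d i := by
      have := (hd i).out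
      omega
    let π : 𝒜 →ₐ[F] Matrix (Fin (d i)) (Fin (d i)) F :=
      ((Pi.evalAlgHom F _ i).comp e.toAlgHom).comp (Ideal.Quotient.mkₐ F (Ring.jacobson 𝒜))
    have hπ : Function.Surjective π := by
      intro m
      obtain ⟨z, hz⟩ := e.surjective (Pi.single i m)
      obtain ⟨x, rfl⟩ := Ideal.Quotient.mk_surjective z
      refine ⟨x, ?_⟩
      change e ((Ideal.Quotient.mk (Ring.jacobson 𝒜)) x) i = m
      rw [hz, Pi.single_eq_same]
    refine ⟨d i, hi2, (π : 𝒜 →* _).comp θ, ?_, ?_⟩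
    · have h1 : Submodule.span F (Set.range θ) = ⊤ := by
        apply Submodule.map_injective_of_injective (f := 𝒜.val.toLinearMap) Subtype.val_injective
        rw [Submodule.map_span, ← Set.range_comp]
        have e1 : (𝒜.val.toLinearMap ∘ θ : Δ → _) = τ := rfl
        rw [e1, ← hspan, Submodule.map_top]
        ext x
        simp
      have h2 : Set.range ((π : 𝒜 →* _).comp θ) = π.toLinearMap '' Set.range θ := by
        rw [← Set.range_comp]; rfl
      rw [h2, ← Submodule.map_span, h1, Submodule.map_top, LinearMap.range_eq_top]
      exact hπ
    · intro p q
      let lin : 𝒜 →ₗ[F] F := (Matrix.entryLinearMap F F p q) ∘ₗ π.toLinearMap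
      obtain ⟨g, hg⟩ := LinearMap.exists_extend (p := Subalgebra.toSubmodule 𝒜) lin
      refine ⟨fun a b => g (Matrix.single a b 1), fun δ => ?_⟩
      have h3 : π (θ δ) p q = g (τ δ) := (LinearMap.congr_fun hg (θ δ)).symm
      change π (θ δ) p q = _
      rw [h3]
      conv_lhs => rw [Matrix.matrix_eq_sum_single (τ δ)]
      simp only [map_sum]
      refine Finset.sum_congr rfl fun a _ => Finset.sum_congr rfl fun b _ => ?_
      have e : Matrix.single a b (τ δ a b) = τ δ a b • Matrix.single a b (1 : F) := by simp
      rw [e, map_smul, smul_eq_mul, mul_comm]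

end Wedder


section Irred

theorem exists_irreducible_subgroup {F Γ : Type*} [Field F] [Group Γ] {k : ℕ}
    (ρ : Γ →* Matrix (Fin k) (Fin k) F) (Δ1 : Subgroup Γ) (hΔ1 : Δ1.FiniteIndex) :
    ∃ T : Subgroup Γ, T.Normal ∧ T.FiniteIndex ∧ T ≤ Δ1 ∧ ∃ B : Subalgebra F (T → F),
      IsDomain B ∧ (∀ i j, (fun t : T => ρ t i j) ∈ B) ∧
      (∀ i j, (fun t : T => ρ (t : Γ)⁻¹ i j) ∈ B) := by
  classical
  let gens : Set (Γ → F) := Set.range (fun (v : Fin k × Fin k) (γ : Γ) => ρ γ v.1 v.2) ∪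
    Set.range (fun (v : Fin k × Fin k) (γ : Γ) => ρ γ⁻¹ v.1 v.2)
  let Reg : Subalgebra F (Γ → F) := Algebra.adjoin F gens
  have hgfin : gens.Finite := (Set.finite_range _).union (Set.finite_range _)
  have hft : Algebra.FiniteType F Reg :=
    (Subalgebra.fg_iff_finiteType _).1 ⟨hgfin.toFinset, by simp [Reg]⟩
  have hnoeth : IsNoetherianRing Reg := Algebra.FiniteType.isNoetherianRing F Reg
  have hmem1 : ∀ i j, (fun γ => ρ γ i j) ∈ Reg := fun i j =>
    Algebra.subset_adjoin (Or.inl ⟨(i, j), rfl⟩)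
  have hmem2 : ∀ i j, (fun γ => ρ γ⁻¹ i j) ∈ Reg := fun i j =>
    Algebra.subset_adjoin (Or.inr ⟨(i, j), rfl⟩)
  -- translation
  have htr : ∀ (γ : Γ) (f : Γ → F), f ∈ Reg → (fun x => f (γ * x)) ∈ Reg := by
    intro γ f hf
    induction hf using Algebra.adjoin_induction with
    | mem x hx =>
      rcases hx with ⟨v, rfl⟩ | ⟨v, rfl⟩
      · have : (fun x => ρ (γ * x) v.1 v.2) = ∑ l, ρ γ v.1 l • (fun x => ρ x l v.2) := by
          ext x; simp [Matrix.mul_apply, Finset.sum_apply]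
        change (fun x => ρ (γ * x) v.1 v.2) ∈ Reg
        rw [this]
        exact Subalgebra.sum_mem _ fun l _ => Subalgebra.smul_mem _ (hmem1 _ _) _
      · have : (fun x => ρ (γ * x)⁻¹ v.1 v.2) = ∑ l, ρ γ⁻¹ l v.2 • (fun x => ρ x⁻¹ v.1 l) := by
          ext x; simp [mul_inv_rev, Matrix.mul_apply, Finset.sum_apply, mul_comm]
        change (fun x => ρ (γ * x)⁻¹ v.1 v.2) ∈ Reg
        rw [this]
        exact Subalgebra.sum_mem _ fun l _ => Subalgebra.smul_mem _ (hmem2 _ _) _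
    | algebraMap r => exact Reg.algebraMap_mem r
    | add x y _ _ hx hy => exact Reg.add_mem hx hy
    | mul x y _ _ hx hy => exact Reg.mul_mem hx hy
  let α : Γ → (Reg →+* Reg) := fun γ =>
    { toFun := fun f => ⟨fun x => (f : Γ → F) (γ * x), htr γ _ f.2⟩
      map_one' := rfl
      map_mul' := fun _ _ => rfl
      map_zero' := rfl
      map_add' := fun _ _ => rfl }
  have hα : ∀ γ (f : Reg) x, (α γ f : Γ → F) x = (f : Γ → F) (γ * x) := fun _ _ _ => rfl
  have hα1 : α 1 = RingHom.id _ := by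
    ext f x
    simp [hα]
  have hαm : ∀ γ γ', (α γ').comp (α γ) = α (γ * γ') := by
    intro γ γ'
    ext f x
    simp [hα, mul_assoc]
  have hcc : ∀ γ γ' (p : Ideal Reg), (p.comap (α γ')).comap (α γ) = p.comap (α (γ * γ')) := by
    intro γ γ' p
    rw [Ideal.comap_comap, hαm]
  have hc1 : ∀ p : Ideal Reg, p.comap (α 1) = p := by
    intro p; rw [hα1, Ideal.comap_id]
  have hminc : ∀ γ (p : Ideal Reg), p ∈ minimalPrimes Reg → p.comap (α γ) ∈ minimalPrimes Reg := by
    intro γ p hp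
    have hpp : p.IsPrime := hp.1.1
    refine ⟨⟨inferInstance, bot_le⟩, ?_⟩
    intro q hq hle
    have hqp : q.IsPrime := hq.1
    have h1 : q.comap (α γ⁻¹) ≤ p := by
      have := Ideal.comap_mono (f := α γ⁻¹) hle
      rwa [hcc, inv_mul_cancel, hc1] at this
    have h2 := hp.2 (y := q.comap (α γ⁻¹)) ⟨inferInstance, bot_le⟩ h1
    have := Ideal.comap_mono (f := α γ) h2
    rwa [hcc, mul_inv_cancel, hc1] at this
  have hfinmin : Finite (minimalPrimes Reg) := (minimalPrimes.finite_of_isNoetherianRing Reg)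
  let act : MulAction Γ (minimalPrimes Reg) :=
    { smul := fun γ p => ⟨p.1.comap (α γ), hminc γ _ p.2⟩
      one_smul := fun p => Subtype.ext (hc1 _)
      mul_smul := fun γ γ' p => Subtype.ext (hcc γ γ' _).symm }
  let S : Subgroup Γ := (MulAction.toPermHom Γ (minimalPrimes Reg)).ker
  have hSfi : S.FiniteIndex := Subgroup.finiteIndex_ker _
  have hSn : S.Normal := MonoidHom.normal_ker _
  have hSact : ∀ γ ∈ S, ∀ p ∈ minimalPrimes Reg, p.comap (α γ) = p := by
    intro γ hγ p hp
    have h1 := Equiv.ext_iff.1 (MonoidHom.mem_ker.1 hγ) ⟨p, hp⟩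
    exact congrArg Subtype.val h1
  have hncf : Δ1.normalCore.FiniteIndex := inferInstance
  let T : Subgroup Γ := S ⊓ Δ1.normalCore
  have hTf : T.FiniteIndex := inferInstance
  have hTn : T.Normal := inferInstance
  -- vanishing ideals
  let I : Set Γ → Ideal Reg := fun A =>
    { carrier := {f | ∀ a ∈ A, (f : Γ → F) a = 0}
      zero_mem' := fun _ _ => rfl
      add_mem' := fun {f g} hf hg a ha => by
        change (f : Γ → F) a + (g : Γ → F) a = 0
        rw [hf a ha, hg a ha, add_zero]
      smul_mem' := fun c f hf a ha => by
        change (c : Γ → F) a * (f : Γ → F) a = 0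
        rw [hf a ha, mul_zero] }
  have hI : ∀ A (f : Reg), f ∈ I A ↔ ∀ a ∈ A, (f : Γ → F) a = 0 := fun _ _ => Iff.rfl
  let ev1 : Reg →+* F := (Pi.evalRingHom (fun _ : Γ => F) 1).comp Reg.val.toRingHom
  have hev1 : ∀ f : Reg, ev1 f = (f : Γ → F) 1 := fun _ => rfl
  have hker : (RingHom.ker ev1).IsPrime := RingHom.ker_isPrime ev1
  obtain ⟨p0, hp0, hp01⟩ := Ideal.exists_minimalPrimes_le (I := ⊥) (J := RingHom.ker ev1) bot_le
  have hp0T : p0 ≤ I (T : Set Γ) := by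
    intro f hf t ht
    rw [← hSact t ht.1 p0 hp0] at hf
    have h1 := hp01 (Ideal.mem_comap.1 hf)
    rw [RingHom.mem_ker, hev1, hα, mul_one] at h1
    exact h1
  have hpp0 : p0.IsPrime := hp0.1.1
  have hTp : (I (T : Set Γ)).IsPrime := by
    have hfq : Fintype (Γ ⧸ T) := Fintype.ofFinite _
    have h1 : (Finset.univ : Finset (Γ ⧸ T)).inf (fun q => I {x | (x : Γ ⧸ T) = q}) ≤ p0 := by
      intro f hf
      have : f = 0 := by
        ext x
        have h2 : f ∈ I {y | (y : Γ ⧸ T) = (x : Γ ⧸ T)} :=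
          (Finset.inf_le (f := fun q => I {x | (x : Γ ⧸ T) = q}) (Finset.mem_univ (x : Γ ⧸ T))) hf
        exact h2 x rfl
      rw [this]; exact zero_mem _
    obtain ⟨q, -, hq⟩ := (hpp0.inf_le').1 h1
    obtain ⟨x, rfl⟩ := QuotientGroup.mk_surjective q
    have h2 : I (T : Set Γ) ≤ p0.comap (α x⁻¹) := by
      intro f hf
      refine hq ?_
      intro y hy
      rw [hα]
      apply hf
      exact (QuotientGroup.eq).1 (Eq.symm hy)
    have h3 := (hminc x⁻¹ p0 hp0).2 (y := p0) ⟨hpp0, bot_le⟩ (hp0T.trans h2)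
    have h4 : I (T : Set Γ) = p0 := le_antisymm (h2.trans h3) hp0T
    rw [h4]; exact hpp0
  let res : (Γ → F) →ₐ[F] (T → F) :=
    { toFun := fun f t => f t
      map_one' := rfl
      map_mul' := fun _ _ => rfl
      map_zero' := rfl
      map_add' := fun _ _ => rfl
      commutes' := fun _ => rfl }
  have hres : ∀ f ∈ Reg, (∀ t : T, f t = 0) ↔ ∃ h : f ∈ Reg, (⟨f, h⟩ : Reg) ∈ I (T : Set Γ) := by
    intro f hf
    constructor
    · intro h
      exact ⟨hf, fun a ha => h ⟨a, ha⟩⟩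
    · rintro ⟨h, h'⟩ t
      exact h' t t.2
  refine ⟨T, hTn, hTf, inf_le_right.trans (Subgroup.normalCore_le _), Reg.map res, ?_, ?_, ?_⟩
  · have hnt : Nontrivial (Reg.map res) := ⟨⟨0, 1, fun h => by
      have := congrFun (congrArg Subtype.val h) 1
      exact zero_ne_one this⟩⟩
    have hnz : NoZeroDivisors (Reg.map res) := by
      constructor
      rintro ⟨_, f, hf, rfl⟩ ⟨_, g, hg, rfl⟩ h
      have h1 : (⟨f, hf⟩ * ⟨g, hg⟩ : Reg) ∈ I (T : Set Γ) := by
        intro a ha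
        exact congrFun (congrArg Subtype.val h) ⟨a, ha⟩
      rcases hTp.mem_or_mem h1 with h2 | h2
      · left
        ext t
        exact h2 t t.2
      · right
        ext t
        exact h2 t t.2
    exact NoZeroDivisors.to_isDomain _
  · intro i j
    exact ⟨_, hmem1 i j, rfl⟩
  · intro i j
    exact ⟨_, hmem2 i j, rfl⟩

end Irred


section Assembly

theorem coset_expand {Γ ι : Type*} [Group Γ] (z : ι → Γ) (L : List (ι × Bool)) (p : Γ) :
    ∃ M : List (Γ × (ι × Bool)), M.map Prod.snd = L ∧ ∀ δ : ι → Γ,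
      p * (L.map fun x => cond x.2 (δ x.1 * z x.1) (δ x.1 * z x.1)⁻¹).prod =
      (M.map fun y => y.1 * (if y.2.2 then δ y.2.1 else (δ y.2.1)⁻¹) * y.1⁻¹).prod *
        (p * (L.map fun x => cond x.2 (z x.1) (z x.1)⁻¹).prod) := by
  induction L generalizing p with
  | nil => exact ⟨[], rfl, fun δ => by simp⟩
  | cons x L ih =>
    obtain ⟨i, b⟩ := x
    cases b with
    | true =>
      obtain ⟨M, hM, h⟩ := ih (p * z i)
      refine ⟨(p, (i, true)) :: M, by simp [hM], fun δ => ?_⟩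
      have := h δ
      simp only [List.map_cons, List.prod_cons, cond_true, if_true]
      calc _ = p * δ i * p⁻¹ * (p * z i * (L.map fun x => cond x.2 (δ x.1 * z x.1) (δ x.1 * z x.1)⁻¹).prod) := by group
        _ = _ := by rw [this]; group
    | false =>
      obtain ⟨M, hM, h⟩ := ih (p * (z i)⁻¹)
      refine ⟨(p * (z i)⁻¹, (i, false)) :: M, by simp [hM], fun δ => ?_⟩
      have := h δ
      simp only [List.map_cons, List.prod_cons, cond_false, Bool.false_eq_true, if_false]
      calc _ = (p * (z i)⁻¹) * (δ i)⁻¹ * (p * (z i)⁻¹)⁻¹ * (p * (z i)⁻¹ * (L.map fun x => cond x.2 (δ x.1 * z x.1) (δ x.1 * z x.1)⁻¹).prod) := by group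
        _ = _ := by rw [this]; group

theorem solvable_of_coset_identity {F Γ ι : Type*} [Field F] [IsAlgClosed F] [Group Γ]
    [Fintype ι] [DecidableEq ι] {k : ℕ} (ρ : Γ →* Matrix (Fin k) (Fin k) F)
    (hinj : Function.Injective ρ) (w : FreeGroup ι) (hw : w ≠ 1) (Δ1 : Subgroup Γ)
    (hΔ1 : Δ1.FiniteIndex) (z : ι → Γ)
    (hid : ∀ δ : ι → Γ, (∀ i, δ i ∈ Δ1) → FreeGroup.lift (fun i => δ i * z i) w = 1) :
    ∃ H : Subgroup Γ, H.FiniteIndex ∧ IsSolvable H := by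
  classical
  obtain ⟨T, hTn, hTf, hTle, B, hBd, hB1, hB2⟩ := exists_irreducible_subgroup ρ Δ1 hΔ1
  rcases solvable_or_rep (ρ.comp T.subtype) (hinj.comp T.subtype_injective) with hs | hr
  · exact ⟨T, hTf, hs⟩
  exfalso
  obtain ⟨d, hd, ρ', hspan, hlin⟩ := hr
  obtain ⟨M, hM, hexp⟩ := coset_expand z w.toWord 1
  have hev : ∀ f : ι → Γ, FreeGroup.lift f w =
      (w.toWord.map fun x => cond x.2 (f x.1) (f x.1)⁻¹).prod := by
    intro f
    conv_lhs => rw [← FreeGroup.mk_toWord (x := w)]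
    rw [FreeGroup.lift_mk]
  have hz : (w.toWord.map fun x => cond x.2 (z x.1) (z x.1)⁻¹).prod = 1 := by
    rw [← hev]
    simpa using hid 1 (fun i => Δ1.one_mem)
  have hexp2 : ∀ δ : ι → T, (M.map fun y => y.1 * (if y.2.2 then (δ y.2.1 : Γ)
      else (δ y.2.1 : Γ)⁻¹) * y.1⁻¹).prod = 1 := by
    intro δ
    have h1 := hexp (fun i => δ i)
    have h2 := hid (fun i => δ i) (fun i => hTle (δ i).2)
    rw [hev] at h2
    rw [h2, hz] at h1
    simpa using h1.symm
  have hMne : M ≠ [] := by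
    rintro rfl
    exact hw (FreeGroup.toWord_eq_nil_iff.1 (by simpa using hM.symm))
  obtain ⟨ℓ, f, rfl⟩ : ∃ (ℓ : ℕ) (f : Fin (ℓ + 1) → Γ × (ι × Bool)), M = List.ofFn f := by
    cases M with
    | nil => exact absurd rfl hMne
    | cons a M' => exact ⟨M'.length, (a :: M').get, (List.ofFn_get _).symm⟩
  have hred := FreeGroup.isReduced_toWord (x := w)
  rw [← hM, List.map_ofFn] at hred
  let σ : Fin (ℓ + 1) → T →* Matrix (Fin d) (Fin d) F := fun κ =>
    if (f κ).2.2 then ρ'.comp (MulAut.conjNormal (f κ).1).toMonoidHom else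
      { toFun := fun t => (ρ' (MulAut.conjNormal (f κ).1 t⁻¹)).transpose
        map_one' := by simp
        map_mul' := fun x y => by
          rw [mul_inv_rev, map_mul, map_mul, Matrix.transpose_mul] }
  have hσt : ∀ κ t, (f κ).2.2 = true → σ κ t = ρ' (MulAut.conjNormal (f κ).1 t) := by
    intro κ t h
    simp [σ, h]
  have hσf : ∀ κ t, (f κ).2.2 = false →
      σ κ t = (ρ' (MulAut.conjNormal (f κ).1 t⁻¹)).transpose := by
    intro κ t h
    simp only [σ, h]
    rfl
  have hconj : ∀ (c : Γ) (p q), (fun t : T => ρ' (MulAut.conjNormal c t) p q) ∈ B ∧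
      (fun t : T => ρ' (MulAut.conjNormal c t⁻¹) p q) ∈ B := by
    intro c p q
    obtain ⟨co, hco⟩ := hlin p q
    have key : ∀ t : T, ρ' (MulAut.conjNormal c t) p q =
        ∑ a, ∑ b, co a b * ∑ m, (∑ l, ρ c a l * ρ t l m) * ρ c⁻¹ m b := by
      intro t
      rw [hco]
      simp [Matrix.mul_apply]
    constructor
    · have : (fun t : T => ρ' (MulAut.conjNormal c t) p q) =
        ∑ a, ∑ b, co a b • ∑ m, ρ c⁻¹ m b • (∑ l, ρ c a l • fun t : T => ρ t l m) := by
        ext t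
        simp [key, Finset.sum_apply, mul_comm]
      rw [this]
      exact sum_mem fun a _ => sum_mem fun b _ => B.smul_mem (sum_mem fun m _ => B.smul_mem
        (sum_mem fun l _ => B.smul_mem (hB1 l m) _) _) _
    · have : (fun t : T => ρ' (MulAut.conjNormal c t⁻¹) p q) =
        ∑ a, ∑ b, co a b • ∑ m, ρ c⁻¹ m b • (∑ l, ρ c a l • fun t : T => ρ (t : Γ)⁻¹ l m) := by
        ext t
        rw [key]
        simp [Finset.sum_apply, mul_comm]
      rw [this]
      exact sum_mem fun a _ => sum_mem fun b _ => B.smul_mem (sum_mem fun m _ => B.smul_mem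
        (sum_mem fun l _ => B.smul_mem (hB2 l m) _) _) _
  refine no_identity (ι := ι) (fun κ => (f κ).2.1) (fun κ => (f κ).2.2) hd ?_ σ B ?_ ?_ ?_
  · intro κ
    have h1 := (List.isChain_iff_getElem.1 hred) κ (by simp)
    rw [List.getElem_ofFn, List.getElem_ofFn] at h1
    exact h1
  · intro κ p q
    cases hb : (f κ).2.2 with
    | true => simpa only [hσt κ _ hb] using (hconj (f κ).1 p q).1
    | false => simpa only [hσf κ _ hb, Matrix.transpose_apply] using (hconj (f κ).1 q p).2
  · intro κ
    cases hb : (f κ).2.2 with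
    | true =>
      rw [← hspan]
      congr 1
      have : (σ κ : T → _) = ρ' ∘ (MulAut.conjNormal (f κ).1) := funext fun t => hσt κ t hb
      rw [this, (MulEquiv.surjective _).range_comp]
    | false =>
      have : (σ κ : T → _) = (Matrix.transposeLinearEquiv (Fin d) (Fin d) F F) ∘ ρ' ∘ (MulAut.conjNormal (f κ).1) ∘ (Inv.inv) :=
        funext fun t => hσf κ t hb
      rw [this, Set.range_comp, ((MulEquiv.surjective _).comp inv_surjective).range_comp]
      have h2 := Submodule.map_span (Matrix.transposeLinearEquiv (Fin d) (Fin d) F F).toLinearMap (Set.range ρ')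
      rw [hspan, Submodule.map_top, LinearEquiv.range] at h2
      exact h2.symm
  · intro δ
    have h1 := hexp2 δ
    have h2 : (List.ofFn fun κ => trb (f κ).2.2 (σ κ (δ (f κ).2.1))) =
       (List.ofFn fun κ => MulAut.conjNormal (f κ).1 (if (f κ).2.2 then δ (f κ).2.1 else (δ (f κ).2.1)⁻¹)).map ρ' := by
      rw [List.map_ofFn]
      congr 1
      ext1 κ
      simp only [Function.comp]
      cases hb : (f κ).2.2 with
      | true => simp [trb, hσt κ _ hb]
      | false => rw [hσf κ _ hb]; simp [trb]
    rw [h2, ← map_list_prod]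
    have h3 : (List.ofFn fun κ => MulAut.conjNormal (f κ).1 (if (f κ).2.2 then δ (f κ).2.1 else (δ (f κ).2.1)⁻¹)).prod = 1 := by
      apply T.subtype_injective
      rw [map_list_prod, map_one, ← h1, List.map_ofFn, List.map_ofFn]
      congr 2
      ext1 κ
      simp only [Function.comp, Subgroup.subtype_apply, MulAut.conjNormal_apply]
      split_ifs <;> rfl
    rw [h3, map_one]

end Assembly


section Density

theorem fiber_density {G Q Q' : Type*} [Group G] [Group Q] [Group Q'] [Finite Q] [Finite Q']
    (π : G →* Q) (π' : G →* Q') (hπ : Function.Surjective π) (hπ' : Function.Surjective π')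
    (hker : π'.ker ≤ π.ker) (X : Set G) (hX : ∀ x y, π x = π y → x ∈ X → y ∈ X) :
    ((π' '' X).ncard : ℝ) / Nat.card Q' = ((π '' X).ncard : ℝ) / Nat.card Q := by
  classical
  have := Fintype.ofFinite Q
  have := Fintype.ofFinite Q'
  let φ : Q' →* Q := π'.liftOfSurjective hπ' ⟨π, hker⟩
  have hφ : ∀ x, φ (π' x) = π x := fun x =>
    MonoidHom.liftOfRightInverse_comp_apply π' _ _ ⟨π, hker⟩ x
  have hφs : Function.Surjective φ := fun q => by
    obtain ⟨x, rfl⟩ := hπ q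
    exact ⟨π' x, hφ x⟩
  have himg : π' '' X = φ ⁻¹' (π '' X) := by
    ext q
    obtain ⟨x, rfl⟩ := hπ' q
    constructor
    · rintro ⟨y, hy, h⟩
      refine ⟨y, hy, ?_⟩
      rw [← hφ, h]
    · rintro ⟨y, hy, h⟩
      rw [hφ] at h
      exact ⟨x, hX y x h hy, rfl⟩
  have hfib : ∀ q : Q, (Finset.univ.filter fun q' => φ q' = q).card =
      (Finset.univ.filter fun q' => φ q' = 1).card := fun q =>
    MonoidHom.card_fiber_eq_of_mem_range φ (hφs q) (hφs 1)
  set m := (Finset.univ.filter fun q' => φ q' = 1).card with hm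
  have hmpos : 0 < m := Finset.card_pos.2 ⟨1, by simp⟩
  have hcount : ∀ Y : Finset Q, (Finset.univ.filter fun q' => φ q' ∈ Y).card = Y.card * m := by
    intro Y
    rw [Finset.card_eq_sum_card_fiberwise (f := φ) (t := Y) (fun x hx => by simpa using hx)]
    rw [Finset.sum_const_nat (m := m)]
    intro q hq
    rw [← hfib q]
    congr 1
    ext q'
    simp only [Finset.mem_filter, Finset.mem_univ, true_and]
    exact ⟨fun h => h.2, fun h => ⟨h ▸ hq, h⟩⟩
  have h1 : Nat.card Q' = Nat.card Q * m := by
    have := hcount Finset.univ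
    simpa [Nat.card_eq_fintype_card] using this
  have h2 : (π' '' X).ncard = (π '' X).ncard * m := by
    have h3 := hcount (π '' X).toFinset
    rw [← Set.ncard_eq_toFinset_card'] at h3
    rw [himg, ← h3, Set.ncard_eq_toFinset_card']
    congr 1
    ext; simp
  rw [h1, h2]
  push_cast
  have : (m : ℝ) ≠ 0 := by positivity
  rw [mul_div_mul_right _ _ this]

theorem sum_card_le {Q τ : Type*} [Finite Q] [DecidableEq τ] (t : Finset τ) (Y : τ → Set Q) :
    ∑ i ∈ t, (Y i).ncard ≤ Nat.card Q + ∑ p ∈ t.offDiag, (Y p.1 ∩ Y p.2).ncard := by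
  classical
  have := Fintype.ofFinite Q
  have hc : ∀ Z : Set Q, Z.ncard = ∑ q : Q, if q ∈ Z then 1 else 0 := by
    intro Z
    rw [Set.ncard_eq_toFinset_card', Finset.sum_boole]
    congr 1
    ext; simp
  simp_rw [hc]
  rw [Finset.sum_comm, Finset.sum_comm (s := t.offDiag), Nat.card_eq_fintype_card,
    ← Finset.card_univ, Finset.card_eq_sum_ones, ← Finset.sum_add_distrib]
  refine Finset.sum_le_sum fun q _ => ?_
  rw [Finset.sum_boole]
  refine le_trans (b := 1 + (t.offDiag.filter fun p => q ∈ Y p.1 ∩ Y p.2).card) ?_ (le_of_eq ?_)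
  swap
  · rw [Finset.card_filter]
    congr!
  have : (t.offDiag.filter fun p => q ∈ Y p.1 ∩ Y p.2) = (t.filter fun i => q ∈ Y i).offDiag := by
    ext p
    simp only [Finset.mem_filter, Finset.mem_offDiag, Set.mem_inter_iff]
    tauto
  rw [this, Finset.offDiag_card]
  simp only [Nat.cast_id]
  generalize (t.filter fun i => q ∈ Y i).card = m
  rcases m with _ | m
  · simp
  · have : (m + 1) * (m + 1) - (m + 1) = m * (m + 1) := by
      rw [← Nat.sub_one_mul]; simp
    rw [this]
    nlinarith

theorem coset_of_positive {G A κ : Type*} [Group G] [CommRing A] [Nonempty κ]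
    (B : Subalgebra A (G → A)) [IsNoetherianRing B]
    (htr : ∀ (g : G) (f : G → A), f ∈ B → (fun x => f (g * x)) ∈ B)
    (J : κ → Ideal A) (hdir : ∀ a b, ∃ c, J c ≤ J a ∧ J c ≤ J b)
    (hbot : ∀ a : A, (∀ c, a ∈ J c) → a = 0)
    (Q : κ → Type*) [∀ c, Group (Q c)] [∀ c, Finite (Q c)] (π : ∀ c, G →* Q c)
    (hsurj : ∀ c, Function.Surjective (π c))
    (hker : ∀ a c, J c ≤ J a → (π c).ker ≤ (π a).ker)
    (hsat : ∀ c, ∀ f ∈ B, ∀ x y, π c x = π c y → f x - f y ∈ J c)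
    (E : Set (G → A)) (hE : E ⊆ B) (ε : ℝ) (hε : 0 < ε)
    (hpos : ∀ c, ε ≤ ((π c '' {x | ∀ f ∈ E, f x ∈ J c}).ncard : ℝ) / Nat.card (Q c)) :
    ∃ S : Subgroup G, S.FiniteIndex ∧ ∃ z : G, ∀ s ∈ S, ∀ f ∈ E, f (s * z) = 0 := by
  classical
  let α : G → (B →+* B) := fun γ =>
    { toFun := fun f => ⟨fun x => (f : G → A) (γ * x), htr γ _ f.2⟩
      map_one' := rfl
      map_mul' := fun _ _ => rfl
      map_zero' := rfl
      map_add' := fun _ _ => rfl }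
  have hα : ∀ γ (f : B) x, (α γ f : G → A) x = (f : G → A) (γ * x) := fun _ _ _ => rfl
  have hα1 : α 1 = RingHom.id _ := by
    ext f x
    simp [hα]
  have hαm : ∀ γ γ', (α γ').comp (α γ) = α (γ * γ') := by
    intro γ γ'
    ext f x
    simp [hα, mul_assoc]
  have hcc : ∀ γ γ' (p : Ideal B), (p.comap (α γ')).comap (α γ) = p.comap (α (γ * γ')) := by
    intro γ γ' p
    rw [Ideal.comap_comap, hαm]
  have hc1 : ∀ p : Ideal B, p.comap (α 1) = p := by
    intro p; rw [hα1, Ideal.comap_id]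
  let X : κ → Ideal B → Set G := fun c I => {x | ∀ f ∈ I, (f : G → A) x ∈ J c}
  have hXanti : ∀ c I I', I ≤ I' → X c I' ⊆ X c I := fun c I I' h x hx f hf => hx f (h hf)
  have hXJ : ∀ a c I, J c ≤ J a → X c I ⊆ X a I := fun a c I h x hx f hf => h (hx f hf)
  have hXsup : ∀ c I I', X c (I ⊔ I') = X c I ∩ X c I' := by
    intro c I I'
    apply Set.Subset.antisymm
    · exact Set.subset_inter (hXanti _ _ _ le_sup_left) (hXanti _ _ _ le_sup_right)
    · rintro x ⟨h1, h2⟩ f hf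
      obtain ⟨a, ha, b, hb, rfl⟩ := Submodule.mem_sup.1 hf
      exact (J c).add_mem (h1 a ha) (h2 b hb)
  have hXsat : ∀ c I x y, π c x = π c y → x ∈ X c I → y ∈ X c I := by
    intro c I x y hxy hx f hf
    have h1 := hsat c f f.2 x y hxy
    have h2 := (J c).sub_mem (hx f hf) h1
    simpa using h2
  have hXtr : ∀ c g I x, x ∈ X c (I.comap (α g)) ↔ g⁻¹ * x ∈ X c I := by
    intro c g I x
    constructor
    · intro h f hf
      have := h (α g⁻¹ f) (by
        rw [Ideal.mem_comap, ← RingHom.comp_apply, hαm, inv_mul_cancel, hα1]; exact hf)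
      exact this
    · intro h f hf
      have := h (α g f) hf
      rwa [hα, mul_inv_cancel_left] at this
  let D : κ → Set G → ℝ := fun c Y => ((π c '' Y).ncard : ℝ) / Nat.card (Q c)
  have hcard : ∀ c, (0 : ℝ) < Nat.card (Q c) := fun c => by exact_mod_cast Nat.card_pos
  have hDmono : ∀ c Y Y', Y ⊆ Y' → D c Y ≤ D c Y' := by
    intro c Y Y' h
    refine div_le_div_of_nonneg_right ?_ (hcard c).le
    exact_mod_cast Set.ncard_le_ncard (Set.image_mono h) (Set.toFinite _)
  have hDtr : ∀ c g I, D c (X c (I.comap (α g))) = D c (X c I) := by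
    intro c g I
    have : π c '' X c (I.comap (α g)) = (fun q => π c g * q) '' (π c '' X c I) := by
      ext q
      constructor
      · rintro ⟨x, hx, rfl⟩
        exact ⟨_, ⟨_, (hXtr c g I x).1 hx, rfl⟩, by simp⟩
      · rintro ⟨_, ⟨x, hx, rfl⟩, rfl⟩
        exact ⟨g * x, (hXtr c g I _).2 (by simpa using hx), by simp⟩
    simp only [D]
    rw [this, Set.ncard_image_of_injective _ (mul_right_injective _)]
  have hDJ : ∀ a c I, J c ≤ J a → D c (X c I) ≤ D a (X a I) := by
    intro a c I h
    refine (hDmono c _ _ (hXJ a c I h)).trans (le_of_eq ?_)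
    exact fiber_density (π a) (π c) (hsurj a) (hsurj c) (hker a c h) _ (hXsat a I)
  let Pos : Ideal B → Prop := fun I => ∃ δ : ℝ, 0 < δ ∧ ∀ c, δ ≤ D c (X c I)
  have hPtr : ∀ g I, Pos I → Pos (I.comap (α g)) := by
    rintro g I ⟨δ, hδ, h⟩
    exact ⟨δ, hδ, fun c => by rw [hDtr]; exact h c⟩
  let I0 : Ideal B := Ideal.span {f | (f : G → A) ∈ E}
  have hI0 : ∀ c, {x | ∀ f ∈ E, f x ∈ J c} ⊆ X c I0 := by
    intro c x hx f hf
    have : I0 ≤ (J c).comap ((Pi.evalRingHom (fun _ : G => A) x).comp B.val.toRingHom) :=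
      Ideal.span_le.2 fun f hf => hx f hf
    exact this hf
  have hP0 : Pos I0 := ⟨ε, hε, fun c => (hpos c).trans (hDmono c _ _ (hI0 c))⟩
  obtain ⟨M, ⟨hM0, hMP⟩, hMmax⟩ : ∃ M, (I0 ≤ M ∧ Pos M) ∧ ∀ I, I0 ≤ I ∧ Pos I → ¬ M < I := by
    have := (wellFounded_gt (α := Ideal B)).has_min {I | I0 ≤ I ∧ Pos I} ⟨I0, le_rfl, hP0⟩
    obtain ⟨M, hM, h⟩ := this
    exact ⟨M, hM, fun I hI => h I hI⟩
  have hMg : ∀ g I, M.comap (α g) ≤ I → Pos I → I = M.comap (α g) := by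
    intro g I hle hI
    have h1 : M ≤ I.comap (α g⁻¹) := by
      have := Ideal.comap_mono (f := α g⁻¹) hle
      rwa [hcc, inv_mul_cancel, hc1] at this
    have h2 : I.comap (α g⁻¹) = M := by
      by_contra hne
      exact hMmax _ ⟨hM0.trans h1, hPtr _ _ hI⟩ (lt_of_le_of_ne h1 (Ne.symm hne))
    rw [← h2, hcc, mul_inv_cancel, hc1]
  have hfindir : ∀ t : Finset κ, ∃ c, ∀ i ∈ t, J c ≤ J i := by
    intro t
    induction t using Finset.induction_on with
    | empty => exact ⟨Classical.arbitrary κ, by simp⟩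
    | insert a t _ ih =>
      obtain ⟨c, hc⟩ := ih
      obtain ⟨c', h1, h2⟩ := hdir c a
      refine ⟨c', fun i hi => ?_⟩
      rcases Finset.mem_insert.1 hi with rfl | hi
      · exact h2
      · exact h1.trans (hc i hi)
  let act : MulAction G (Ideal B) :=
    { smul := fun γ p => p.comap (α γ)
      one_smul := fun p => hc1 _
      mul_smul := fun γ γ' p => (hcc γ γ' _).symm }
  have hact : ∀ (g : G) (p : Ideal B), g • p = p.comap (α g) := fun _ _ => rfl
  have horb : (MulAction.orbit G M).Finite := by
    obtain ⟨δ, hδ, hδM⟩ := hMP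
    by_contra hinf
    obtain ⟨m, hm⟩ := exists_nat_gt (2 / δ)
    obtain ⟨t, htsub, htc⟩ := Set.Infinite.exists_subset_card_eq hinf m
    have hmpos : (0 : ℝ) < m := lt_trans (by positivity) hm
    have hnp : ∀ p : Ideal B × Ideal B, ∃ c, p ∈ t.offDiag → D c (X c (p.1 ⊔ p.2)) < 1 / (m * m) := by
      intro p
      by_cases hp : p ∈ t.offDiag
      · obtain ⟨hp1, hp2, hne⟩ := Finset.mem_offDiag.1 hp
        obtain ⟨g, hg⟩ := htsub hp1
        obtain ⟨h, hh⟩ := htsub hp2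
        have hg' : M.comap (α g) = p.1 := hg
        have hh' : M.comap (α h) = p.2 := hh
        by_contra hcon
        push Not at hcon
        have hP : Pos (p.1 ⊔ p.2) := ⟨1 / (m * m), by positivity, fun c => (hcon c).2⟩
        have e1 := hMg g (p.1 ⊔ p.2) (hg' ▸ le_sup_left) hP
        have e2 := hMg h (p.1 ⊔ p.2) (hh' ▸ le_sup_right) hP
        exact hne (by rw [← hg', ← hh', ← e1, ← e2])
      · exact ⟨Classical.arbitrary κ, fun h => absurd h hp⟩
    choose u hu using hnp
    obtain ⟨c, hc⟩ := hfindir (t.offDiag.image u)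
    have hsum := sum_card_le t (fun I => π c '' X c I)
    have hint : ∀ I I', π c '' X c I ∩ π c '' X c I' = π c '' X c (I ⊔ I') := by
      intro I I'
      rw [hXsup]
      apply Set.Subset.antisymm
      · rintro _ ⟨⟨x, hx, rfl⟩, ⟨y, hy, h⟩⟩
        exact ⟨x, ⟨hx, hXsat c I' y x h hy⟩, rfl⟩
      · exact Set.image_inter_subset _ _ _
    have h1 : ∑ I ∈ t, D c (X c I) ≤ 1 + ∑ p ∈ t.offDiag, D c (X c (p.1 ⊔ p.2)) := by
      simp only [D]
      rw [← Finset.sum_div, ← Finset.sum_div, div_le_iff₀ (hcard c), add_mul, one_mul,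
        div_mul_cancel₀ _ (hcard c).ne']
      simp_rw [hint] at hsum
      exact_mod_cast hsum
    have h2 : (m : ℝ) * δ ≤ ∑ I ∈ t, D c (X c I) := by
      rw [← htc, ← nsmul_eq_mul]
      refine Finset.card_nsmul_le_sum _ _ _ fun I hI => ?_
      obtain ⟨g, hg⟩ := htsub hI
      have hg' : M.comap (α g) = I := hg
      rw [← hg', hDtr]
      exact hδM c
    have h3 : ∑ p ∈ t.offDiag, D c (X c (p.1 ⊔ p.2)) ≤ (t.offDiag.card : ℝ) * (1 / (m * m)) := by
      rw [← nsmul_eq_mul]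
      refine Finset.sum_le_card_nsmul _ _ _ fun p hp => ?_
      exact (hDJ _ _ _ (hc _ (Finset.mem_image_of_mem u hp))).trans (hu p hp).le
    have h4 : (t.offDiag.card : ℝ) * (1 / (m * m)) ≤ 1 := by
      rw [mul_one_div, div_le_one (by positivity)]
      rw [Finset.offDiag_card, htc]
      exact_mod_cast Nat.sub_le _ _
    rw [div_lt_iff₀ hδ] at hm
    linarith
  let S : Subgroup G := MulAction.stabilizer G M
  have hSf : S.FiniteIndex := by
    refine ⟨?_⟩
    rw [MulAction.index_stabilizer]
    exact ((Set.ncard_pos horb).2 ⟨M, MulAction.mem_orbit_self M⟩).ne'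
  have hSX : ∀ c, ∀ s ∈ S, ∀ x, x ∈ X c M → s * x ∈ X c M := by
    intro c s hs x hx
    have hs' : M.comap (α s) = M := hs
    rw [← hs', hXtr]
    simpa using hx
  have hne : ∀ c, (X c M).Nonempty := by
    intro c
    obtain ⟨δ, hδ, hδM⟩ := hMP
    by_contra h
    rw [Set.not_nonempty_iff_eq_empty] at h
    have := hδM c
    rw [h] at this
    simp [D] at this
    linarith
  obtain ⟨z, hz⟩ : ∃ z, ∀ c, z ∈ X c M := by
    by_contra hcon
    push Not at hcon
    choose u hu using hcon
    have := Fintype.ofFinite (G ⧸ S)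
    obtain ⟨c, hc⟩ := hfindir (Finset.univ.image fun q : G ⧸ S => u (q.out)⁻¹)
    obtain ⟨x, hx⟩ := hne c
    let q : G ⧸ S := ((x⁻¹ : G) : G ⧸ S)
    have hq : (q.out)⁻¹ * x⁻¹ ∈ S := QuotientGroup.eq.1 (QuotientGroup.out_eq' q)
    have h1 := hSX c _ hq x hx
    rw [inv_mul_cancel_right] at h1
    exact hu _ (hXJ _ _ _ (hc _ (Finset.mem_image_of_mem _ (Finset.mem_univ q))) h1)
  refine ⟨S, hSf, z, fun s hs f hf => hbot _ fun c => ?_⟩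
  exact hSX c s hs z (hz c) ⟨f, hE hf⟩ (hM0 (Ideal.subset_span hf))

end Density


section Concentration

theorem int_isJacobsonRing : IsJacobsonRing ℤ := by
  rw [isJacobsonRing_iff_prime_eq]
  intro P hP
  by_cases h : P = ⊥
  · subst h
    rw [eq_bot_iff]
    intro x hx
    have h1 := Ideal.mem_jacobson_bot.1 hx x
    rcases Int.isUnit_iff.1 h1 with h2 | h2
    · rw [Ideal.mem_bot]
      nlinarith
    · nlinarith [mul_self_nonneg x]
  · have : P.IsMaximal := IsPrime.to_maximal_ideal h
    exact Ideal.jacobson_eq_self_of_isMaximal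

theorem finite_of_field_finiteType_int (K : Type*) [Field K] [Algebra.FiniteType ℤ K] :
    Finite K := by
  have := int_isJacobsonRing
  have hf : Module.Finite ℤ K := finite_of_finite_type_of_isJacobsonRing ℤ K
  have hint : Algebra.IsIntegral ℤ K := inferInstance
  have hninj : ¬ Function.Injective (algebraMap ℤ K) := by
    intro h
    have : IsField ℤ := isField_of_isIntegral_of_isField (R := ℤ) (S := K) h (Field.toIsField K)
    exact Int.not_isField this
  rw [injective_iff_map_eq_zero] at hninj
  push Not at hninj
  obtain ⟨m, hm, hm0⟩ := hninj
  apply Module.finite_of_fg_torsion K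
  intro x
  refine ⟨⟨m, mem_nonZeroDivisors_of_ne_zero hm0⟩, ?_⟩
  change m • x = 0
  rw [Algebra.smul_def, hm, zero_mul]

theorem exists_finite_quotient {A : Type*} [CommRing A] [IsDomain A] [Algebra.FiniteType ℤ A]
    (a : A) (h : ∀ J : Ideal A, Finite (A ⧸ J) → a ∈ J) : a = 0 := by
  have := int_isJacobsonRing
  have hj : IsJacobsonRing A := isJacobsonRing_of_finiteType (A := ℤ)
  have h1 : (⊥ : Ideal A).jacobson = ⊥ := hj.out (Ideal.isPrime_bot).isRadical
  have h2 : a ∈ (⊥ : Ideal A).jacobson := by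
    rw [Ideal.jacobson, Ideal.mem_sInf]
    rintro m ⟨-, hm⟩
    apply h
    let := Ideal.Quotient.field m
    have hft : @Algebra.FiniteType ℤ (A ⧸ m) _ _ (Ring.toIntAlgebra _) :=
      Algebra.FiniteType.of_surjective ((Ideal.Quotient.mk m).toIntAlgHom)
        Ideal.Quotient.mk_surjective
    exact @finite_of_field_finiteType_int (A ⧸ m) _ hft
  rw [h1] at h2
  exact h2

theorem finite_quotient_inf {A : Type*} [CommRing A] (J J' : Ideal A) [Finite (A ⧸ J)]
    [Finite (A ⧸ J')] : Finite (A ⧸ (J ⊓ J')) := by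
  let f : A →+* (A ⧸ J) × (A ⧸ J') := (Ideal.Quotient.mk J).prod (Ideal.Quotient.mk J')
  have hf : ∀ a, f a = 0 ↔ a ∈ J ⊓ J' := by
    intro a
    simp only [f, RingHom.prod_apply, Prod.mk_eq_zero, Ideal.Quotient.eq_zero_iff_mem]
    rfl
  refine Finite.of_injective (Ideal.Quotient.lift (J ⊓ J') f fun a ha => (hf a).2 ha) ?_
  apply RingHom.lift_injective_of_ker_le_ideal
  intro a ha
  exact (hf a).1 ha

theorem coset_identity_ring {A Γ ι : Type*} [CommRing A] [IsDomain A] [Algebra.FiniteType ℤ A]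
    [Group Γ] [Fintype ι] {k : ℕ} (ρ : Γ →* Matrix (Fin k) (Fin k) A)
    (hinj : Function.Injective ρ) (w : FreeGroup ι) (ε : ℝ) (hε : 0 < ε)
    (hpos : ∀ (N : Subgroup Γ) (_ : N.Normal), N.FiniteIndex →
      ε ≤ ({h : ι → Γ ⧸ N | FreeGroup.lift h w = 1}.ncard : ℝ) / Nat.card (ι → Γ ⧸ N)) :
    ∃ Δ1 : Subgroup Γ, Δ1.FiniteIndex ∧ ∃ z : ι → Γ, ∀ δ : ι → Γ, (∀ i, δ i ∈ Δ1) →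
      FreeGroup.lift (fun i => δ i * z i) w = 1 := by
  classical
  let G := ι → Γ
  let gens : Set (G → A) :=
    Set.range (fun (v : ι × Fin k × Fin k) (x : G) => ρ (x v.1) v.2.1 v.2.2) ∪
    Set.range (fun (v : ι × Fin k × Fin k) (x : G) => ρ (x v.1)⁻¹ v.2.1 v.2.2)
  let B : Subalgebra A (G → A) := Algebra.adjoin A gens
  have hgfin : gens.Finite := (Set.finite_range _).union (Set.finite_range _)
  have hft : Algebra.FiniteType A B :=
    (Subalgebra.fg_iff_finiteType _).1 ⟨hgfin.toFinset, by simp [B]⟩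
  have hAn : IsNoetherianRing A := Algebra.FiniteType.isNoetherianRing ℤ A
  have hBn : IsNoetherianRing B := Algebra.FiniteType.isNoetherianRing A B
  have hmem1 : ∀ a i j, (fun x : G => ρ (x a) i j) ∈ B := fun a i j =>
    Algebra.subset_adjoin (Or.inl ⟨(a, i, j), rfl⟩)
  have hmem2 : ∀ a i j, (fun x : G => ρ (x a)⁻¹ i j) ∈ B := fun a i j =>
    Algebra.subset_adjoin (Or.inr ⟨(a, i, j), rfl⟩)
  have htr : ∀ (γ : G) (f : G → A), f ∈ B → (fun x => f (γ * x)) ∈ B := by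
    intro γ f hf
    induction hf using Algebra.adjoin_induction with
    | mem x hx =>
      rcases hx with ⟨v, rfl⟩ | ⟨v, rfl⟩
      · have : (fun x : G => ρ ((γ * x) v.1) v.2.1 v.2.2) =
            ∑ l, ρ (γ v.1) v.2.1 l • (fun x : G => ρ (x v.1) l v.2.2) := by
          ext x; rw [Pi.mul_apply, map_mul]; simp [Matrix.mul_apply, Finset.sum_apply]
        change (fun x : G => ρ ((γ * x) v.1) v.2.1 v.2.2) ∈ B
        rw [this]
        exact Subalgebra.sum_mem _ fun l _ => Subalgebra.smul_mem _ (hmem1 _ _ _) _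
      · have : (fun x : G => ρ ((γ * x) v.1)⁻¹ v.2.1 v.2.2) =
            ∑ l, ρ (γ v.1)⁻¹ l v.2.2 • (fun x : G => ρ (x v.1)⁻¹ v.2.1 l) := by
          ext x; rw [Pi.mul_apply, mul_inv_rev, map_mul]; simp [Matrix.mul_apply, Finset.sum_apply, mul_comm]
        change (fun x : G => ρ ((γ * x) v.1)⁻¹ v.2.1 v.2.2) ∈ B
        rw [this]
        exact Subalgebra.sum_mem _ fun l _ => Subalgebra.smul_mem _ (hmem2 _ _ _) _
    | algebraMap r => exact B.algebraMap_mem r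
    | add x y _ _ hx hy => exact B.add_mem hx hy
    | mul x y _ _ hx hy => exact B.mul_mem hx hy
  let κ := {J : Ideal A // Finite (A ⧸ J)}
  have hκ : Nonempty κ := ⟨⟨⊤, inferInstance⟩⟩
  let φ : ∀ c : κ, Γ →* (Matrix (Fin k) (Fin k) (A ⧸ c.1))ˣ := fun c =>
    MonoidHom.toHomUnits (((Ideal.Quotient.mk c.1).mapMatrix : _ →+* Matrix (Fin k) (Fin k) (A ⧸ c.1)).toMonoidHom.comp ρ)
  have hφ : ∀ c γ i j, (φ c γ : Matrix (Fin k) (Fin k) (A ⧸ c.1)) i j =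
    Ideal.Quotient.mk c.1 (ρ γ i j) := fun _ _ _ _ => rfl
  let N : κ → Subgroup Γ := fun c => (φ c).ker
  have hNmem : ∀ c γ, γ ∈ N c ↔ ∀ i j, Ideal.Quotient.mk c.1 (ρ γ i j) =
      Ideal.Quotient.mk c.1 ((1 : Matrix (Fin k) (Fin k) A) i j) := by
    intro c γ
    rw [MonoidHom.mem_ker, Units.ext_iff, ← Matrix.ext_iff]
    refine forall_congr' fun i => forall_congr' fun j => ?_
    rw [hφ]
    have : ((1 : (Matrix (Fin k) (Fin k) (A ⧸ c.1))ˣ) : Matrix (Fin k) (Fin k) (A ⧸ c.1)) i j =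
      Ideal.Quotient.mk c.1 ((1 : Matrix (Fin k) (Fin k) A) i j) := by
      rw [Units.val_one, Matrix.one_apply, Matrix.one_apply]
      split_ifs <;> simp
    rw [this]
  have hNn : ∀ c, (N c).Normal := fun c => MonoidHom.normal_ker _
  have hNf : ∀ c, (N c).FiniteIndex := fun c => by
    have := c.2
    have : Finite (Matrix (Fin k) (Fin k) (A ⧸ c.1)) :=
      inferInstanceAs (Finite (Fin k → Fin k → A ⧸ c.1))
    exact Subgroup.finiteIndex_ker _
  let π : ∀ c : κ, G →* (ι → Γ ⧸ N c) := fun c => (QuotientGroup.mk' (N c)).compLeft ι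
  have hπ : ∀ c x i, π c x i = (x i : Γ ⧸ N c) := fun _ _ _ => rfl
  let E : Set (G → A) := Set.range fun (v : Fin k × Fin k) (x : G) =>
    ρ (FreeGroup.lift x w) v.1 v.2 - (1 : Matrix (Fin k) (Fin k) A) v.1 v.2
  have hword : ∀ (v : FreeGroup ι) (i j), (fun x : G => ρ (FreeGroup.lift x v) i j) ∈ B := by
    intro v
    induction v using FreeGroup.induction_on with
    | C1 =>
      intro i j
      simp only [map_one]
      exact B.algebraMap_mem ((1 : Matrix (Fin k) (Fin k) A) i j)
    | of a =>
      intro i j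
      simpa using hmem1 a i j
    | inv_of a _ =>
      intro i j
      simpa using hmem2 a i j
    | mul u v hu hv =>
      intro i j
      have : (fun x : G => ρ (FreeGroup.lift x (u * v)) i j) =
          ∑ l, (fun x : G => ρ (FreeGroup.lift x u) i l) * (fun x : G => ρ (FreeGroup.lift x v) l j) := by
        ext x
        simp [Matrix.mul_apply, Finset.sum_apply]
      rw [this]
      exact sum_mem fun l _ => B.mul_mem (hu i l) (hv l j)
  have hE : E ⊆ B := by
    rintro _ ⟨v, rfl⟩
    exact B.sub_mem (hword w v.1 v.2) (B.algebraMap_mem ((1 : Matrix (Fin k) (Fin k) A) v.1 v.2))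
  have hsurj : ∀ c, Function.Surjective (π c) := fun c h => by
    choose x hx using fun i => QuotientGroup.mk_surjective (h i)
    exact ⟨x, funext hx⟩
  have hliftπ : ∀ c x, FreeGroup.lift (π c x) w = ((FreeGroup.lift x w : Γ) : Γ ⧸ N c) := by
    intro c x
    have : FreeGroup.lift (π c x) = (QuotientGroup.mk' (N c)).comp (FreeGroup.lift x) := by
      ext i
      simp [hπ]
    rw [this]
    rfl
  obtain ⟨S, hSf, z, hz⟩ := coset_of_positive (G := G) (κ := κ) B htr (fun c => c.1)
    (fun a b => by
      have := a.2
      have := b.2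
      exact ⟨⟨a.1 ⊓ b.1, finite_quotient_inf _ _⟩, inf_le_left, inf_le_right⟩)
    (fun a h => exists_finite_quotient a fun J hJ => h ⟨J, hJ⟩)
    (fun c => ι → Γ ⧸ N c) π hsurj
    (by
      intro a c hle x hx
      rw [MonoidHom.mem_ker] at hx ⊢
      ext1 i
      have h1 : (x i) ∈ N c := (QuotientGroup.eq_one_iff _).1 (congrFun hx i)
      refine (QuotientGroup.eq_one_iff _).2 ?_
      rw [hNmem] at h1 ⊢
      intro p q
      exact Ideal.Quotient.eq.2 (hle (Ideal.Quotient.eq.1 (h1 p q))))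
    (by
      intro c f hf x y hxy
      rw [← Ideal.Quotient.eq]
      have hφeq : ∀ i, φ c (x i) = φ c (y i) := by
        intro i
        have h1 : (x i)⁻¹ * y i ∈ (φ c).ker := QuotientGroup.eq.1 (congrFun hxy i)
        rw [MonoidHom.mem_ker, map_mul, map_inv] at h1
        exact (inv_mul_eq_one.1 h1)
      induction hf using Algebra.adjoin_induction with
      | mem g hg =>
        rcases hg with ⟨v, rfl⟩ | ⟨v, rfl⟩
        · change Ideal.Quotient.mk c.1 (ρ (x v.1) v.2.1 v.2.2) =
            Ideal.Quotient.mk c.1 (ρ (y v.1) v.2.1 v.2.2)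
          rw [← hφ, ← hφ, hφeq]
        · change Ideal.Quotient.mk c.1 (ρ (x v.1)⁻¹ v.2.1 v.2.2) =
            Ideal.Quotient.mk c.1 (ρ (y v.1)⁻¹ v.2.1 v.2.2)
          rw [← hφ, ← hφ, map_inv, map_inv, hφeq]
      | algebraMap r => rfl
      | add f g _ _ h1 h2 => rw [Pi.add_apply, Pi.add_apply, map_add, map_add, h1, h2]
      | mul f g _ _ h1 h2 => rw [Pi.mul_apply, Pi.mul_apply, map_mul, map_mul, h1, h2])
    E hE ε hε
    (by
      intro c
      refine (hpos (N c) (hNn c) (hNf c)).trans ?_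
      refine div_le_div_of_nonneg_right ?_ (by positivity)
      refine Nat.cast_le.2 (Set.ncard_le_ncard ?_ (Set.toFinite _))
      intro h hh
      obtain ⟨x, rfl⟩ := hsurj c h
      refine ⟨x, ?_, rfl⟩
      rintro _ ⟨v, rfl⟩
      have h1 : FreeGroup.lift (π c x) w = 1 := hh
      rw [hliftπ, QuotientGroup.eq_one_iff, hNmem] at h1
      exact Ideal.Quotient.eq.1 (h1 v.1 v.2))
  refine ⟨⨅ i, S.comap (MonoidHom.mulSingle (fun _ : ι => Γ) i),
    Subgroup.finiteIndex_iInf fun i => ⟨by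
      rw [Subgroup.index_comap]
      exact (Subgroup.instFiniteIndex_subgroupOf S _).index_ne_zero⟩, z, ?_⟩
  intro δ hδ
  have hδS : δ ∈ S := Subgroup.pi_mem_of_mulSingle_mem δ fun i =>
    (Subgroup.mem_iInf.1 (hδ i) i)
  apply hinj
  rw [map_one]
  ext i j
  have := hz δ hδS _ ⟨(i, j), rfl⟩
  exact sub_eq_zero.1 this

theorem exists_coset_identity {F Γ ι : Type*} [Field F] [Group Γ] [Group.FG Γ] [Fintype ι]
    {k : ℕ} (ρ : Γ →* Matrix (Fin k) (Fin k) F)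
    (hinj : Function.Injective ρ) (w : FreeGroup ι) (ε : ℝ) (hε : 0 < ε)
    (hpos : ∀ (N : Subgroup Γ) (_ : N.Normal), N.FiniteIndex →
      ε ≤ ({h : ι → Γ ⧸ N | FreeGroup.lift h w = 1}.ncard : ℝ) / Nat.card (ι → Γ ⧸ N)) :
    ∃ Δ1 : Subgroup Γ, Δ1.FiniteIndex ∧ ∃ z : ι → Γ, ∀ δ : ι → Γ, (∀ i, δ i ∈ Δ1) →
      FreeGroup.lift (fun i => δ i * z i) w = 1 := by
  classical
  obtain ⟨T, hT⟩ := Group.fg_def.1 (inferInstance : Group.FG Γ)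
  let gens : Set F := Set.range (fun v : T × Fin k × Fin k => ρ v.1 v.2.1 v.2.2) ∪
    Set.range (fun v : T × Fin k × Fin k => ρ (v.1 : Γ)⁻¹ v.2.1 v.2.2)
  let A : Subalgebra ℤ F := Algebra.adjoin ℤ gens
  have hgfin : gens.Finite := (Set.finite_range _).union (Set.finite_range _)
  have hft : Algebra.FiniteType ℤ A :=
    (Subalgebra.fg_iff_finiteType _).1 ⟨hgfin.toFinset, by simp [A]⟩
  have hA : ∀ γ : Γ, (∀ i j, ρ γ i j ∈ A) ∧ (∀ i j, ρ γ⁻¹ i j ∈ A) := by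
    intro γ
    have hγ : γ ∈ Subgroup.closure (T : Set Γ) := by rw [hT]; trivial
    induction hγ using Subgroup.closure_induction with
    | mem x hx =>
      exact ⟨fun i j => Algebra.subset_adjoin (Or.inl ⟨(⟨x, hx⟩, i, j), rfl⟩),
        fun i j => Algebra.subset_adjoin (Or.inr ⟨(⟨x, hx⟩, i, j), rfl⟩)⟩
    | one =>
      have : ∀ i j, (1 : Matrix (Fin k) (Fin k) F) i j ∈ A := by
        intro i j
        rw [Matrix.one_apply]
        split_ifs
        · exact A.one_mem
        · exact A.zero_mem
      simpa using this
    | mul x y _ _ hx hy =>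
      simp only [mul_inv_rev, map_mul, Matrix.mul_apply]
      exact ⟨fun i j => sum_mem fun l _ => A.mul_mem (hx.1 _ _) (hy.1 _ _),
        fun i j => sum_mem fun l _ => A.mul_mem (hy.2 _ _) (hx.2 _ _)⟩
    | inv x _ hx => exact ⟨hx.2, by simpa using hx.1⟩
  let ρA : Γ →* Matrix (Fin k) (Fin k) A :=
    { toFun := fun γ => Matrix.of fun i j => ⟨ρ γ i j, (hA γ).1 i j⟩
      map_one' := by
        ext i j
        simp [Matrix.one_apply]
        split_ifs <;> rfl
      map_mul' := fun x y => by
        ext i j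
        simp [Matrix.mul_apply] }
  refine coset_identity_ring ρA ?_ w ε hε hpos
  intro x y hxy
  apply hinj
  ext i j
  exact congrArg Subtype.val (congrFun (congrFun hxy i) j)

end Concentration

section Final

theorem lift_map_apply {α β G : Type*} [Group G] (f : α → β) (g : β → G) (w : FreeGroup α) :
    FreeGroup.lift g (FreeGroup.map f w) = FreeGroup.lift (g ∘ f) w := by
  have : (FreeGroup.lift g).comp (FreeGroup.map f) = FreeGroup.lift (g ∘ f) := by
    ext a
    simp
  exact DFunLike.congr_fun this w

theorem double_word_ne_one {n : ℕ} (w : FreeGroup (Fin n)) (hw : w ≠ 1) :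
    FreeGroup.map (Sum.inl : Fin n → Fin n ⊕ Fin n) w * (FreeGroup.map Sum.inr w)⁻¹ ≠ 1 := by
  intro h
  have h1 := congrArg (FreeGroup.lift (Sum.elim FreeGroup.of fun _ : Fin n => (1 : FreeGroup (Fin n)))) h
  rw [map_mul, map_inv, map_one, lift_map_apply, lift_map_apply] at h1
  have h2 : FreeGroup.lift ((Sum.elim FreeGroup.of fun _ : Fin n => (1 : FreeGroup (Fin n))) ∘ Sum.inl) w = w :=
    FreeGroup.lift_of_apply w
  have h3 : FreeGroup.lift ((Sum.elim FreeGroup.of fun _ : Fin n => (1 : FreeGroup (Fin n))) ∘ Sum.inr) w = 1 := by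
    have : FreeGroup.lift ((Sum.elim FreeGroup.of fun _ : Fin n => (1 : FreeGroup (Fin n))) ∘ Sum.inr) = (1 : FreeGroup (Fin n) →* FreeGroup (Fin n)) := by
      ext a
      simp
    rw [this]
    rfl
  rw [h2, h3] at h1
  simp at h1
  exact hw h1

theorem double_word_count {Q : Type*} [Group Q] [Finite Q] {n : ℕ} (w : FreeGroup (Fin n)) (g : Q)
    (ε : ℝ) (hε : 0 < ε) (h : ε ≤ wordFiberProb Q w g) :
    ε * ε ≤ ({x : Fin n ⊕ Fin n → Q | FreeGroup.lift x
      (FreeGroup.map (Sum.inl : Fin n → Fin n ⊕ Fin n) w * (FreeGroup.map Sum.inr w)⁻¹) = 1}.ncard : ℝ) /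
      Nat.card (Fin n ⊕ Fin n → Q) := by
  classical
  have := Fintype.ofFinite Q
  let Fb := {h : Fin n → Q // FreeGroup.lift h w = g}
  set R := {x : Fin n ⊕ Fin n → Q | FreeGroup.lift x
      (FreeGroup.map (Sum.inl : Fin n → Fin n ⊕ Fin n) w * (FreeGroup.map Sum.inr w)⁻¹) = 1} with hR
  have h1 : Nat.card Fb * Nat.card Fb ≤ R.ncard := by
    rw [← Nat.card_prod, ← Nat.card_coe_set_eq]
    refine Nat.card_le_card_of_injective (fun p : Fb × Fb => (⟨Sum.elim p.1.1 p.2.1, ?_⟩ : R)) ?_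
    · change FreeGroup.lift _ _ = 1
      rw [map_mul, map_inv, lift_map_apply, lift_map_apply, Sum.elim_comp_inl, Sum.elim_comp_inr,
        p.1.2, p.2.2, mul_inv_cancel]
    · rintro ⟨a, b⟩ ⟨c, d⟩ hh
      have h2 : Sum.elim a.1 b.1 = Sum.elim c.1 d.1 := congrArg Subtype.val hh
      have h3 : a = c := Subtype.ext (funext fun i => congrFun h2 (Sum.inl i))
      have h4 : b = d := Subtype.ext (funext fun i => congrFun h2 (Sum.inr i))
      rw [h3, h4]
  have h2 : (Nat.card (Fin n ⊕ Fin n → Q) : ℝ) = (Nat.card Q : ℝ) ^ n * (Nat.card Q : ℝ) ^ n := by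
    rw [Nat.card_fun]
    simp [pow_add]
  rw [h2]
  calc ε * ε ≤ wordFiberProb Q w g * wordFiberProb Q w g :=
        mul_le_mul h h hε.le (hε.le.trans h)
    _ = ((Nat.card Fb * Nat.card Fb : ℕ) : ℝ) / ((Nat.card Q : ℝ) ^ n * (Nat.card Q : ℝ) ^ n) := by
        unfold wordFiberProb
        rw [div_mul_div_comm]
        push_cast
        rfl
    _ ≤ _ := by
        refine div_le_div_of_nonneg_right ?_ (by positivity)
        exact_mod_cast h1

end Final

/-- Let `Γ` be a finitely generated linear group. If for some `n ≥ 1` and some nontrivial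
word `w ∈ F_n` there is `ε > 0` such that `‖P_{G,w}‖_∞ ≥ ε` for every finite quotient `G`
of `Γ`, then `Γ` is virtually solvable. -/
theorem virtually_solvable_of_concentrated_word_distribution (Γ : Type u) [Group Γ]
    [Group.FG Γ] (hlin : IsLinearGroup.{u, v} Γ) (n : ℕ) (hn : 1 ≤ n)
    (w : FreeGroup (Fin n)) (hw : w ≠ 1) (ε : ℝ) (hε : 0 < ε)
    (hconc : ∀ (N : Subgroup Γ) (_ : N.Normal), N.FiniteIndex →
      ∃ g : Γ ⧸ N, ε ≤ wordFiberProb (Γ ⧸ N) w g) :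
    IsVirtuallySolvable Γ := by
  classical
  obtain ⟨F, hF, k, ρ, hρ⟩ := hlin
  let K := AlgebraicClosure F
  let ρ' : Γ →* Matrix (Fin k) (Fin k) K :=
    ((algebraMap F K).mapMatrix.toMonoidHom).comp ((Units.coeHom _).comp ρ)
  have hinj : Function.Injective ρ' := by
    intro x y hxy
    apply hρ
    apply Units.ext
    ext i j
    exact (algebraMap F K).injective (congrFun (congrFun hxy i) j)
  obtain ⟨Δ1, hΔ1, z, hz⟩ := exists_coset_identity ρ' hinj
    (FreeGroup.map (Sum.inl : Fin n → Fin n ⊕ Fin n) w * (FreeGroup.map Sum.inr w)⁻¹)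
    (ε * ε) (by positivity) (fun N hN hNf => by
      obtain ⟨g, hg⟩ := hconc N hN hNf
      exact double_word_count w g ε hε hg)
  exact solvable_of_coset_identity ρ' hinj _ (double_word_ne_one w hw) Δ1 hΔ1 z hz
end

section
/- Let p be a prime and G a finite p-group that can be generated by n elements. Then the probability that n independent uniformly random elements of G generate G is at least ∏_{i=1}^{n} (1 − p^{−i}); that is, |{(g_1,…,g_n) ∈ G^n : ⟨g_1,…,g_n⟩ = G}| / |G|^n ≥ ∏_{i=1}^{n} (1 − p^{−i}). -/
/-- Fibers of a surjective homomorphism all have the size of the kernel. -/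
lemma card_preimage_aux {A B : Type*} [Group A] [Group B] [Finite A] [Finite B]
    (f : A →* B) (hf : Function.Surjective f) (P : B → Prop) :
    Nat.card {a // P (f a)} = Nat.card {b // P b} * Nat.card f.ker := by
  have e : {a // P (f a)} ≃ {b // P b} × f.ker :=
    calc {a // P (f a)} ≃ Σ b : {b // P b}, {x : {a // P (f a)} // (⟨f x.1, x.2⟩ : {b // P b}) = b} :=
          (Equiv.sigmaFiberEquiv (fun x : {a // P (f a)} => (⟨f x.1, x.2⟩ : {b // P b}))).symm
      _ ≃ Σ b : {b // P b}, f.ker := Equiv.sigmaCongrRight fun b =>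
          (Equiv.trans
            { toFun := fun x => ⟨x.1.1, congrArg Subtype.val x.2⟩
              invFun := fun y => ⟨⟨y.1, by
                have h : f y.1 = b.1 := y.2
                rw [h]; exact b.2⟩, Subtype.ext y.2⟩
              left_inv := fun x => rfl
              right_inv := fun y => rfl }
            (MonoidHom.fiberEquivKerOfSurjective hf b.1))
      _ ≃ {b // P b} × f.ker := Equiv.sigmaEquivProd _ _
  rw [Nat.card_congr e, Nat.card_prod]

/-- Pushing forward uniform tuples along a surjective homomorphism gives uniform tuples. -/
lemma ratio_aux {A B : Type*} [Group A] [Group B] [Finite A] [Finite B] (n : ℕ)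
    (f : A →* B) (hf : Function.Surjective f) (P : (Fin n → B) → Prop) :
    (Nat.card {a : Fin n → A // P (fun i => f (a i))} : ℝ) / (Nat.card A : ℝ) ^ n =
      (Nat.card {b // P b} : ℝ) / (Nat.card B : ℝ) ^ n := by
  let F : (Fin n → A) →* (Fin n → B) := f.compLeft (Fin n)
  have hF : Function.Surjective F := hf.comp_left
  have h1 := card_preimage_aux F hF P
  have h2 := card_preimage_aux F hF (fun _ => True)
  have h3 : Nat.card {a : Fin n → A // True} = Nat.card A ^ n := by
    rw [Nat.card_congr (Equiv.subtypeUnivEquiv fun _ => trivial)]; simp [Nat.card_fun]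
  have h4 : Nat.card {a : Fin n → B // True} = Nat.card B ^ n := by
    rw [Nat.card_congr (Equiv.subtypeUnivEquiv fun _ => trivial)]; simp [Nat.card_fun]
  rw [h3, h4] at h2
  have h1' : Nat.card {a : Fin n → A // P (fun i => f (a i))} =
      Nat.card {b // P b} * Nat.card F.ker := h1
  have hk : (Nat.card F.ker : ℝ) ≠ 0 := by exact_mod_cast Nat.card_pos.ne'
  have h2' : (Nat.card A : ℝ) ^ n = (Nat.card B : ℝ) ^ n * Nat.card F.ker := by
    exact_mod_cast h2
  rw [h1', h2', Nat.cast_mul, mul_div_mul_right _ _ hk]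

lemma closure_iff_span_aux (p : ℕ) {W : Type*} [AddCommGroup W] [Module (ZMod p) W]
    (s : Set (Multiplicative W)) :
    Subgroup.closure s = ⊤ ↔ Submodule.span (ZMod p) (Multiplicative.ofAdd ⁻¹' s) = ⊤ := by
  constructor
  · intro h
    rw [eq_top_iff]
    intro w _
    have hw : Multiplicative.ofAdd w ∈ Subgroup.closure s := by rw [h]; trivial
    have key : Subgroup.closure s ≤ AddSubgroup.toSubgroup
        (Submodule.span (ZMod p) (Multiplicative.ofAdd ⁻¹' s)).toAddSubgroup := by
      rw [Subgroup.closure_le]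
      intro x hx
      exact Submodule.subset_span (R := ZMod p) (M := W) (s := Multiplicative.ofAdd ⁻¹' s) hx
    exact key hw
  · intro h
    rw [eq_top_iff]
    intro w _
    have key : Submodule.span (ZMod p) (Multiplicative.ofAdd ⁻¹' s) ≤
        AddSubgroup.toZModSubmodule p (AddSubgroup.toSubgroup.symm (Subgroup.closure s)) := by
      rw [Submodule.span_le]
      intro x hx
      exact Subgroup.subset_closure (G := Multiplicative W) (k := s) hx
    have hw : Multiplicative.toAdd w ∈ Submodule.span (ZMod p) (Multiplicative.ofAdd ⁻¹' s) := by
      rw [h]; trivial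
    exact key hw

lemma prod_aux (p : ℕ) (hp : p.Prime) (n : ℕ) :
    (∏ i ∈ Finset.Icc 1 n, (1 - ((p : ℝ)) ⁻¹ ^ i)) =
      ((∏ i : Fin n, (p ^ n - p ^ i.val) : ℕ) : ℝ) / ((p ^ n : ℕ) : ℝ) ^ n := by
  have hp0 : (p : ℝ) ≠ 0 := by exact_mod_cast hp.ne_zero
  rw [Fin.prod_univ_eq_prod_range (fun i => p ^ n - p ^ i) n, ← Finset.prod_range_reflect,
    Finset.range_eq_Ico, Nat.cast_prod]
  have h : (((p ^ n : ℕ) : ℝ)) ^ n = ∏ i ∈ Finset.Ico 0 n, ((p ^ n : ℕ) : ℝ) := by simp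
  rw [h, ← Finset.prod_div_distrib]
  have h2 : Finset.Icc 1 n = Finset.Ico (0 + 1) (n + 1) := by ext; simp
  rw [h2, ← Finset.prod_Ico_add' (fun i => (1 - ((p : ℝ)) ⁻¹ ^ i)) 0 n 1]
  refine Finset.prod_congr rfl fun i hi => ?_
  rw [Finset.mem_Ico] at hi
  rw [Nat.cast_sub (Nat.pow_le_pow_right hp.pos (by lia))]
  push_cast
  rw [sub_div, div_self (pow_ne_zero _ hp0)]
  congr 1
  rw [inv_pow, eq_div_iff (pow_ne_zero _ hp0), inv_mul_eq_iff_eq_mul₀ (pow_ne_zero _ hp0), ← pow_add]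
  congr 1
  lia

lemma main_aux (p : ℕ) (hp : p.Prime) {G : Type*} [Group G] [Finite G] (n : ℕ)
    {W : Type*} [AddCommGroup W] [Module (ZMod p) W] (π : G →* Multiplicative W)
    (hπ : Function.Surjective π) (hK : ∀ K : Subgroup G, K.map π = ⊤ → K = ⊤)
    (hgen : ∃ g : Fin n → G, Subgroup.closure (Set.range g) = ⊤) :
    (∏ i ∈ Finset.Icc 1 n, (1 - ((p : ℝ)) ⁻¹ ^ i)) ≤
      (Nat.card {g : Fin n → G // Subgroup.closure (Set.range g) = ⊤} : ℝ) /
        (Nat.card G : ℝ) ^ n := by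
  have : Fact p.Prime := ⟨hp⟩
  have : Finite (Multiplicative W) := Finite.of_surjective π hπ
  have hiff : ∀ g : Fin n → G, Subgroup.closure (Set.range g) = ⊤ ↔
      Subgroup.closure (Set.range (fun i => π (g i))) = ⊤ := by
    intro g
    have : Set.range (fun i => π (g i)) = π '' Set.range g := Set.range_comp π g
    rw [this, ← MonoidHom.map_closure]
    constructor
    · intro h
      rw [h]; exact Subgroup.map_top_of_surjective π hπ
    · exact hK _
  rw [Nat.card_congr (Equiv.subtypeEquivRight hiff),
    ratio_aux n π hπ (fun b => Subgroup.closure (Set.range b) = ⊤)]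
  obtain ⟨g, hg⟩ := hgen
  rw [hiff, closure_iff_span_aux p] at hg
  let L : (Fin n → ZMod p) →ₗ[ZMod p] W :=
    Fintype.linearCombination (ZMod p) (fun i => Multiplicative.toAdd (π (g i)))
  have hL : Function.Surjective L := by
    rw [← LinearMap.range_eq_top, Fintype.range_linearCombination, ← hg]
    rfl
  let f : Multiplicative (Fin n → ZMod p) →* Multiplicative W :=
    AddMonoidHom.toMultiplicative L.toAddMonoidHom
  have hf : Function.Surjective f := hL
  rw [← ratio_aux n f hf (fun b => Subgroup.closure (Set.range b) = ⊤), prod_aux p hp n]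
  have hc : Nat.card (Multiplicative (Fin n → ZMod p)) = p ^ n := by
    have : Nat.card (Multiplicative (Fin n → ZMod p)) = Nat.card (Fin n → ZMod p) := rfl
    rw [this]; simp
  rw [hc]
  have hli := card_linearIndependent (K := ZMod p) (V := Fin n → ZMod p) (k := n) (by simp)
  simp only [ZMod.card, Module.finrank_fin_fun] at hli
  rw [← hli]
  gcongr
  refine Nat.card_le_card_of_injective
    (fun s => ⟨fun i => Multiplicative.ofAdd (s.1 i), ?_⟩) ?_
  · have hs := s.2.span_eq_top_of_card_eq_finrank' (by simp)
    rw [closure_iff_span_aux p]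
    have h1 := congrArg (Submodule.map L) hs
    rw [Submodule.map_span, Submodule.map_top, LinearMap.range_eq_top.2 hL, ← Set.range_comp] at h1
    exact h1
  · intro s t h
    have h' := congrArg Subtype.val h
    exact Subtype.ext h'

open scoped commutatorElement in
/-- In a finite `p`-group, `p`-th powers and commutators lie in every maximal subgroup. -/
lemma coatom_aux (p : ℕ) (hp : p.Prime) {G : Type*} [Group G] [Finite G] (hpG : IsPGroup p G)
    (M : Subgroup G) (hM : IsCoatom M) :
    (∀ x : G, x ^ p ∈ M) ∧ commutator G ≤ M := by
  have : Fact p.Prime := ⟨hp⟩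
  have hnil : Group.IsNilpotent G := hpG.isNilpotent
  have : M.Normal := Subgroup.NormalizerCondition.normal_of_coatom M
    Group.normalizerCondition_of_isNilpotent hM
  obtain ⟨m, hm⟩ := IsPGroup.iff_card.1 hpG
  obtain ⟨k, hk⟩ := IsPGroup.iff_card.1 (hpG.to_subgroup M)
  have hle : k < m := by
    have h1 : Nat.card M < Nat.card G := by
      refine lt_of_le_of_ne (Subgroup.card_le_card_group M) fun h => hM.1 ?_
      exact Subgroup.eq_top_of_card_eq M h
    rw [hm, hk] at h1
    exact (Nat.pow_lt_pow_iff_right hp.one_lt).1 h1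
  obtain ⟨K, hKc, hMK⟩ := Sylow.exists_subgroup_card_pow_succ (p := p) (n := k)
    (by rw [hm]; exact pow_dvd_pow p hle) hk
  have hKtop : K = ⊤ := by
    refine hM.2 K (lt_of_le_of_ne hMK fun h => ?_)
    rw [← h, hk] at hKc
    have := Nat.pow_right_injective hp.two_le hKc
    lia
  have hGc : Nat.card G = p ^ (k + 1) := by rw [← hKc, hKtop, Subgroup.card_top]
  have hq : Nat.card (G ⧸ M) = p := by
    have h := Subgroup.card_eq_card_quotient_mul_card_subgroup M
    rw [hGc, hk, pow_succ'] at h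
    exact (Nat.eq_of_mul_eq_mul_right (pow_pos hp.pos k) h).symm
  have : IsCyclic (G ⧸ M) := isCyclic_of_prime_card hq
  constructor
  · intro x
    rw [← QuotientGroup.eq_one_iff, QuotientGroup.mk_pow, ← hq, pow_card_eq_one']
  · rw [commutator_def, Subgroup.commutator_le]
    intro a _ b _
    rw [← QuotientGroup.eq_one_iff]
    have : ((⁅a, b⁆ : G) : G ⧸ M) = ⁅(a : G ⧸ M), (b : G ⧸ M)⁆ := rfl
    rw [this, commutatorElement_eq_one_iff_mul_comm]
    exact IsCyclic.isMulCommutative.is_comm.comm _ _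


/-- Let `p` be a prime and `G` a finite `p`-group generated by `n` elements.  The
probability that `n` independent uniformly random elements generate `G` is at least
`∏_{i=1}^{n} (1 - p^{-i})`. -/
theorem pGroup_generation_probability (p : ℕ) (hp : p.Prime) (G : Type*) [Group G]
    [Finite G] (hpG : IsPGroup p G) (n : ℕ)
    (hgen : ∃ g : Fin n → G, Subgroup.closure (Set.range g) = ⊤) :
    (∏ i ∈ Finset.Icc 1 n, (1 - ((p : ℝ)) ⁻¹ ^ i)) ≤
      (Nat.card {g : Fin n → G // Subgroup.closure (Set.range g) = ⊤} : ℝ) /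
        (Nat.card G : ℝ) ^ n := by
  have hc := coatom_aux p hp hpG
  have hcomm : commutator G ≤ frattini G := by
    simp only [frattini, Order.radical, le_iInf_iff]
    exact fun M hM => (hc M hM).2
  have hpow : ∀ x : G, x ^ p ∈ frattini G := by
    intro x
    simp only [frattini, Order.radical, Subgroup.mem_iInf]
    exact fun M hM => (hc M hM).1 x
  let _ : CommGroup (G ⧸ frattini G) :=
    { (inferInstance : Group (G ⧸ frattini G)) with
      mul_comm := by
        intro a b
        obtain ⟨a, rfl⟩ := QuotientGroup.mk_surjective a
        obtain ⟨b, rfl⟩ := QuotientGroup.mk_surjective b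
        rw [← commutatorElement_eq_one_iff_mul_comm]
        have h : ((a * b * a⁻¹ * b⁻¹ : G) : G ⧸ frattini G) = 1 :=
          (QuotientGroup.eq_one_iff _).2
            (hcomm (Subgroup.commutator_mem_commutator (Subgroup.mem_top a) (Subgroup.mem_top b)))
        exact h }
  let _ : Module (ZMod p) (Additive (G ⧸ frattini G)) := AddCommGroup.zmodModule (by
    intro x
    obtain ⟨a, ha⟩ := QuotientGroup.mk_surjective (Additive.toMul x)
    apply Additive.toMul.injective
    rw [toMul_nsmul, ← ha]
    exact (QuotientGroup.eq_one_iff _).2 (hpow a))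
  let π : G →* Multiplicative (Additive (G ⧸ frattini G)) :=
    { toFun := fun x => Multiplicative.ofAdd (Additive.ofMul (x : G ⧸ frattini G))
      map_one' := rfl
      map_mul' := fun _ _ => rfl }
  refine main_aux p hp n π (fun x => ?_) (fun K hK => ?_) hgen
  · obtain ⟨a, ha⟩ := QuotientGroup.mk_surjective (Additive.toMul (Multiplicative.toAdd x))
    exact ⟨a, ha⟩
  · apply frattini_nongenerating
    rw [eq_top_iff]
    intro x _
    have hx : π x ∈ K.map π := by rw [hK]; trivial
    obtain ⟨k, hk, hkx⟩ := hx
    have h : k⁻¹ * x ∈ frattini G := QuotientGroup.eq.1 hkx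
    have := Subgroup.mul_mem_sup hk h
    rwa [mul_inv_cancel_left] at this
end

section
/- Let Γ be a finitely generated group that is linear over some field. If Γ satisfies a coset identity, then Γ is virtually solvable. -/
open scoped Pointwise

universe u v

/-- `Γ` satisfies a coset identity: there are a nontrivial word `w ∈ F_n`, a finite-index
subgroup `Δ ≤ Γ` and elements `g₁, …, gₙ ∈ Γ` such that `w(g₁Δ, …, gₙΔ) = {1}`. -/
def SatisfiesCosetIdentity (Γ : Type u) [Group Γ] : Prop :=
  ∃ (n : ℕ) (w : FreeGroup (Fin n)), w ≠ 1 ∧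
    ∃ (Δ : Subgroup Γ), Δ.FiniteIndex ∧
      ∃ g : Fin n → Γ, ∀ h : Fin n → Γ,
        (∀ i, h i ∈ g i • (Δ : Set Γ)) → FreeGroup.lift h w = 1


section Core

variable {Γ : Type*} [Group Γ] (G : Subgroup Γ) [G.Normal]

/-- If `A * Z` has the same rank as `A`, then anything killing `A * Z` kills `A`. -/
lemma mul_ne_zero_of_rank {κ ι : Type*} [Field κ] [Fintype ι] [DecidableEq ι]
    (C A Z : Matrix ι ι κ) (h : (A * Z).rank = A.rank) (hC : C * A ≠ 0) : C * (A * Z) ≠ 0 := by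
  intro h0
  apply hC
  have hle : LinearMap.range (A * Z).mulVecLin ≤ LinearMap.range A.mulVecLin := by
    rw [Matrix.mulVecLin_mul]
    exact LinearMap.range_comp_le_range _ _
  have heq : LinearMap.range (A * Z).mulVecLin = LinearMap.range A.mulVecLin :=
    Submodule.eq_of_le_of_finrank_eq hle h
  apply Matrix.toLin'.injective
  ext1 i
  ext1
  have : A.mulVecLin (Pi.single i 1) ∈ LinearMap.range (A * Z).mulVecLin := by
    rw [heq]; exact ⟨_, rfl⟩
  obtain ⟨u, hu⟩ := this
  have h1 : (C * (A * Z)).mulVec u = 0 := by rw [h0]; simp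
  rw [← Matrix.mulVec_mulVec] at h1
  simp only [Matrix.mulVecLin_apply] at hu
  rw [hu] at h1
  simpa [← Matrix.mulVec_mulVec] using h1

/-- Twisting a sequence by conjugation and possibly inversion. -/
def cj (γ : Γ) (e : Bool) (x : ℕ → G) : ℕ → G :=
  fun n => MulAut.conjNormal γ (cond e (x n) (x n)⁻¹)

variable {G}

/-- The value of a twisted word. -/
def evw {L : Type*} (bar : L → L) (sg : L → Bool) (c : L → G) (d : L → Γ) (x : G) :
    Γ → List L → G
  | _, [] => 1
  | P, s :: l => MulAut.conjNormal P (c s) *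
      (MulAut.conjNormal (P * d s) (cond (sg s) x x⁻¹) *
      ((MulAut.conjNormal (P * (d s * (d (bar s))⁻¹)) (c (bar s)))⁻¹ *
        evw bar sg c d x (P * (d s * (d (bar s))⁻¹)) l))

lemma evw_coe {L : Type*} (bar : L → L) (sg : L → Bool) (c : L → G) (d : L → Γ) (x : G)
    (P : Γ) (l : List L) :
    ((evw bar sg c d x P l : G) : Γ) = P *
      (l.map fun s => (c s : Γ) * d s * cond (sg s) (x : Γ) (x : Γ)⁻¹ * (d (bar s))⁻¹ *
        (c (bar s) : Γ)⁻¹).prod * (P * (l.map fun s => d s * (d (bar s))⁻¹).prod)⁻¹ := by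
  induction l generalizing P with
  | nil => simp [evw]
  | cons s l ih =>
    simp only [evw, Subgroup.coe_mul, Subgroup.coe_inv, ih, MulAut.conjNormal_apply,
      List.map_cons, List.prod_cons]
    cases sg s <;> simp <;> group

theorem core {κ ι : Type*} [Field κ] [Fintype ι] [DecidableEq ι]
    (σ : G →* Matrix ι ι κ) (Rd : (ℕ → G) → Matrix ι ι κ → Prop)
    (h0 : ∀ x A, Rd x A → A ≠ 0) (h1 : ∀ x, ∃ A, Rd x A)
    (h2 : ∀ x y A B, Rd x A → Rd y B → A * B ≠ 0 → Rd (x * y) (A * B))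
    (h3 : ∀ g : G, Rd (fun _ => g) (σ g))
    (h4 : ∀ (g : G) A, Rd (fun _ => g) A → A.rank = Fintype.card ι)
    (h5 : ∃ x A, Rd x A ∧ A.rank < Fintype.card ι)
    (gen : ∀ S : Set (Γ × Bool × Matrix ι ι κ × Matrix ι ι κ), S.Finite →
      (∀ q ∈ S, q.2.2.1 ≠ 0 ∧ q.2.2.2 ≠ 0) →
      ∃ b : G, ∀ q ∈ S,
        q.2.2.1 * σ (MulAut.conjNormal q.1 (cond q.2.1 b b⁻¹)) * q.2.2.2 ≠ 0)
    {n : ℕ} (w : FreeGroup (Fin n)) (hw : w ≠ 1) (g : Fin n → Γ)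
    (hid : ∀ h : Fin n → Γ, (∀ i, (g i)⁻¹ * h i ∈ G) → FreeGroup.lift h w = 1) : False := by
  classical
  -- minimal rank
  obtain ⟨r, x0, A0, hx0, hr0, hmin⟩ : ∃ r x0 A0, Rd x0 A0 ∧ A0.rank = r ∧
      ∀ x A, Rd x A → r ≤ A.rank := by
    have hex : ∃ r, ∃ x A, Rd x A ∧ A.rank = r := by
      obtain ⟨x, A, hA, -⟩ := h5
      exact ⟨_, x, A, hA, rfl⟩
    obtain ⟨x, A, hA, hr⟩ := Nat.find_spec hex
    exact ⟨Nat.find hex, x, A, hA, hr, fun y B hB => Nat.find_min' hex ⟨y, B, hB, rfl⟩⟩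
  have hrlt : r < Fintype.card ι := by
    obtain ⟨x, A, hA, hlt⟩ := h5
    exact (hmin x A hA).trans_lt hlt
  -- units
  have hσl : ∀ (a : G) (A : Matrix ι ι κ), A ≠ 0 → A * σ a ≠ 0 := by
    intro a A hA h
    apply hA
    have : A * σ a * σ a⁻¹ = 0 := by rw [h, zero_mul]
    rwa [mul_assoc, ← map_mul, mul_inv_cancel, map_one, mul_one] at this
  have hσr : ∀ (a : G) (A : Matrix ι ι κ), A ≠ 0 → σ a * A ≠ 0 := by
    intro a A hA h
    apply hA
    have : σ a⁻¹ * (σ a * A) = 0 := by rw [h, mul_zero]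
    rwa [← mul_assoc, ← map_mul, inv_mul_cancel, map_one, one_mul] at this
  -- simultaneous minimal rank
  have hsim : ∀ T : Finset (Γ × Bool), ∃ x : ℕ → G, ∀ q ∈ T,
      ∃ A, Rd (cj G q.1 q.2 x) A ∧ A.rank = r := by
    intro T
    induction T using Finset.induction_on with
    | empty => exact ⟨1, by simp⟩
    | insert q0 T hq0 ih =>
      obtain ⟨x', hx'⟩ := ih
      let x'' : ℕ → G := fun n => MulAut.conjNormal q0.1⁻¹ (cond q0.2 (x0 n) (x0 n)⁻¹)
      have hx'' : cj G q0.1 q0.2 x'' = x0 := by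
        funext n
        obtain ⟨γ, e⟩ := q0
        have key : ∀ y : G, MulAut.conjNormal γ ((MulAut.conjNormal γ)⁻¹ y) = y := by
          intro y; rw [← MulAut.mul_apply, mul_inv_cancel]; rfl
        cases e <;> simp only [cj, x'', cond_true, cond_false, map_inv, inv_inv, key]
      have hA' : ∀ q : Γ × Bool, ∃ A, Rd (cj G q.1 q.2 x') A ∧ (q ∈ T → A.rank = r) := by
        intro q
        by_cases hq : q ∈ T
        · obtain ⟨A, hA, hr⟩ := hx' q hq
          exact ⟨A, hA, fun _ => hr⟩
        · obtain ⟨A, hA⟩ := h1 (cj G q.1 q.2 x')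
          exact ⟨A, hA, fun h => absurd h hq⟩
      have hA'' : ∀ q : Γ × Bool, ∃ A, Rd (cj G q.1 q.2 x'') A ∧ (q = q0 → A.rank = r) := by
        intro q
        by_cases hq : q = q0
        · subst hq
          exact ⟨A0, by rw [hx'']; exact hx0, fun _ => hr0⟩
        · obtain ⟨A, hA⟩ := h1 (cj G q.1 q.2 x'')
          exact ⟨A, hA, fun h => absurd h hq⟩
      choose A' hA'1 hA'2 using hA'
      choose A'' hA''1 hA''2 using hA''
      obtain ⟨b, hb⟩ := gen
        ((fun q : Γ × Bool => (q.1, q.2, cond q.2 (A' q) (A'' q), cond q.2 (A'' q) (A' q))) ''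
          (insert q0 T : Finset (Γ × Bool))) ((Finset.finite_toSet _).image _) (by
            rintro _ ⟨⟨γ, e⟩, hq, rfl⟩
            cases e
            · exact ⟨h0 _ _ (hA''1 _), h0 _ _ (hA'1 _)⟩
            · exact ⟨h0 _ _ (hA'1 _), h0 _ _ (hA''1 _)⟩)
      refine ⟨x' * (fun _ => b) * x'', fun q hq => ?_⟩
      have hbq := hb _ ⟨q, hq, rfl⟩
      have hor : (A' q).rank = r ∨ (A'' q).rank = r := by
        rcases Finset.mem_insert.1 hq with h | h
        · exact Or.inr (hA''2 q h)
        · exact Or.inl (hA'2 q h)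
      have e1 := hA'1 q
      have e2 := hA''1 q
      obtain ⟨γ, e⟩ := q
      cases e
      · simp only [cond_false] at hbq
        have hR := h2 _ _ _ _ (h2 _ _ _ _ e2 (h3 (MulAut.conjNormal γ b⁻¹))
          (hσl _ _ (h0 _ _ e2))) e1 hbq
        refine ⟨_, ?_, le_antisymm ?_ (hmin _ _ hR)⟩
        · convert hR using 1
          funext n
          simp [cj, mul_assoc]
        · rcases hor with h | h
          · exact (Matrix.rank_mul_le_right _ _).trans h.le
          · exact ((Matrix.rank_mul_le_left _ _).trans (Matrix.rank_mul_le_left _ _)).trans h.le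
      · simp only [cond_true] at hbq
        have hR := h2 _ _ _ _ (h2 _ _ _ _ e1 (h3 (MulAut.conjNormal γ b))
          (hσl _ _ (h0 _ _ e1))) e2 hbq
        refine ⟨_, ?_, le_antisymm ?_ (hmin _ _ hR)⟩
        · convert hR using 1
          funext n
          simp [cj, mul_assoc]
        · rcases hor with h | h
          · exact ((Matrix.rank_mul_le_left _ _).trans (Matrix.rank_mul_le_left _ _)).trans h.le
          · exact (Matrix.rank_mul_le_right _ _).trans h.le
  -- letters
  let bar : Fin n × Bool → Fin n × Bool := fun s => (s.1, !s.2)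
  let d : Fin n × Bool → Γ := fun s => cond s.2 (g s.1) 1
  let val : Fin n × Bool → Γ := fun s => d s * (d (bar s))⁻¹
  let T : Finset Γ := (w.toWord.inits.map fun l => (l.map val).prod).toFinset
  have hT : ∀ l, l <+: w.toWord → (l.map val).prod ∈ T := by
    intro l hl
    simp only [T, List.mem_toFinset, List.mem_map, List.mem_inits]
    exact ⟨l, hl, rfl⟩
  obtain ⟨x, hx⟩ := hsim (T ×ˢ Finset.univ)
  have hx' : ∀ q : Γ × Bool, ∃ A, A ≠ 0 ∧ (q.1 ∈ T → Rd (cj G q.1 q.2 x) A ∧ A.rank = r) := by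
    intro q
    by_cases hq : q.1 ∈ T
    · obtain ⟨A, hA⟩ := hx q (by simp [hq])
      exact ⟨A, h0 _ _ hA.1, fun _ => hA⟩
    · exact ⟨A0, h0 _ _ hx0, fun h => absurd h hq⟩
  choose α hα0 hα using hx'
  let Cond : G → G → Prop := fun a b => ∀ P ∈ T, ∀ q ∈ T ×ˢ (Finset.univ : Finset Bool),
    ∀ q' ∈ T ×ˢ (Finset.univ : Finset Bool),
      α q * σ (MulAut.conjNormal P (a⁻¹ * b)) * α q' ≠ 0
  obtain ⟨f, -, hf⟩ := by
    haveI : Std.Symm (fun a b : G => Cond a b ∧ Cond b a) := ⟨fun a b h => ⟨h.2, h.1⟩⟩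
    refine exists_seq_of_forall_finset_exists' (fun _ : G => True)
      (fun a b => Cond a b ∧ Cond b a) ?_
    intro s _
    let E : Finset (G × Γ × (Γ × Bool) × (Γ × Bool)) :=
      s ×ˢ T ×ˢ (T ×ˢ (Finset.univ : Finset Bool)) ×ˢ (T ×ˢ (Finset.univ : Finset Bool))
    obtain ⟨b, hb⟩ := gen
      (((fun t : G × Γ × (Γ × Bool) × (Γ × Bool) =>
        (t.2.1, true, α t.2.2.1 * σ (MulAut.conjNormal t.2.1 t.1⁻¹), α t.2.2.2)) '' E) ∪
       ((fun t : G × Γ × (Γ × Bool) × (Γ × Bool) =>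
        (t.2.1, false, α t.2.2.1, σ (MulAut.conjNormal t.2.1 t.1) * α t.2.2.2)) '' E))
      (((Finset.finite_toSet _).image _).union ((Finset.finite_toSet _).image _)) (by
        rintro _ (⟨t, _, rfl⟩ | ⟨t, _, rfl⟩)
        · exact ⟨hσl _ _ (hα0 _), hα0 _⟩
        · exact ⟨hα0 _, hσr _ _ (hα0 _)⟩)
    refine ⟨b, trivial, fun a ha => ⟨?_, ?_⟩⟩
    · intro P hP q hq q' hq'
      have := hb _ (Or.inl ⟨(a, P, q, q'), by
        simp only [E, Finset.mem_coe, Finset.mem_product]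
        exact ⟨ha, hP, Finset.mem_product.1 hq, Finset.mem_product.1 hq'⟩, rfl⟩)
      simpa only [cond_true, map_mul, mul_assoc] using this
    · intro P hP q hq q' hq'
      have := hb _ (Or.inr ⟨(a, P, q, q'), by
        simp only [E, Finset.mem_coe, Finset.mem_product]
        exact ⟨ha, hP, Finset.mem_product.1 hq, Finset.mem_product.1 hq'⟩, rfl⟩)
      simpa only [cond_false, map_mul, mul_assoc] using this
  let c : Fin n × Bool → G := fun s => f (Encodable.encode s)
  have hc : ∀ s t, s ≠ t → Cond (c s) (c t) := fun s t hst =>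
    (hf (fun h => hst (Encodable.encode_injective h))).1
  -- the chain argument
  have hPd : ∀ (P : Γ) (s : Fin n × Bool), P ∈ T → P * val s ∈ T → P * d s ∈ T := by
    rintro P ⟨i, e⟩ hP hPs
    cases e
    · simpa [d] using hP
    · simpa [d, val, bar] using hPs
  have main : ∀ (l : List (Fin n × Bool)) (s : Fin n × Bool) (P : Γ),
      FreeGroup.IsReduced (s :: l) →
      (∀ l', l' <+: (s :: l) → P * (l'.map val).prod ∈ T) →
      ∃ Z, Rd (fun k => (MulAut.conjNormal P (c s))⁻¹ *
        evw bar Prod.snd c d (x k) P (s :: l)) (α (P * d s, s.2) * Z) ∧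
        (α (P * d s, s.2) * Z).rank = r := by
    intro l
    induction l with
    | nil =>
      intro s P _ hP
      have hP0 : P ∈ T := by simpa using hP [] (by simp)
      have hP1 : P * val s ∈ T := by simpa using hP [s] (by simp)
      obtain ⟨hA, hrA⟩ := hα (P * d s, s.2) (hPd P s hP0 hP1)
      have hR := h2 _ _ _ _ hA (h3 (MulAut.conjNormal (P * val s) (c (bar s)))⁻¹)
        (hσl _ _ (hα0 _))
      refine ⟨_, ?_, le_antisymm ((Matrix.rank_mul_le_left _ _).trans hrA.le) (hmin _ _ hR)⟩
      convert hR using 1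
      funext k
      simp [evw, cj, val]
    | cons t l ih =>
      intro s P hred hP
      have hP0 : P ∈ T := by simpa using hP [] (by simp)
      have hP1 : P * val s ∈ T := by simpa using hP [s] (by simp)
      have hP2 : P * val s * val t ∈ T := by simpa [mul_assoc] using hP [s, t] (by simp)
      obtain ⟨hA, hrA⟩ := hα (P * d s, s.2) (hPd P s hP0 hP1)
      obtain ⟨hst, hred'⟩ := List.isChain_cons_cons.1 hred
      obtain ⟨Z, hZ, hrZ⟩ := ih t (P * val s) hred' (by
        intro l' hl'
        have := hP (s :: l') (by simpa using hl')
        simpa [mul_assoc] using this)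
      obtain ⟨hA', hrA'⟩ := hα (P * val s * d t, t.2) (hPd _ t hP1 hP2)
      have hne : bar s ≠ t := by
        rintro rfl
        have := hst rfl
        simp [bar] at this
      have hcd := hc _ _ hne (P * val s) hP1 (P * d s, s.2) (by simp [hPd P s hP0 hP1])
        (P * val s * d t, t.2) (by simp [hPd _ t hP1 hP2])
      have hne2 := mul_ne_zero_of_rank _ _ Z (hrZ.trans hrA'.symm) hcd
      have hR := h2 _ _ _ _ (h2 _ _ _ _ hA
        (h3 (MulAut.conjNormal (P * val s) ((c (bar s))⁻¹ * c t))) (hσl _ _ (hα0 _))) hZ hne2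
      refine ⟨σ (MulAut.conjNormal (P * val s) ((c (bar s))⁻¹ * c t)) *
        (α (P * val s * d t, t.2) * Z), ?_, ?_⟩
      · rw [← mul_assoc]
        convert hR using 1
        funext k
        simp only [evw, cj, val, Pi.mul_apply, map_mul, map_inv]
        group
      · exact le_antisymm ((Matrix.rank_mul_le_left _ _).trans hrA.le)
          (by rw [← mul_assoc]; exact hmin _ _ hR)
  -- conclusion
  have hgw : FreeGroup.lift g w = 1 := hid g (by simp [G.one_mem])
  have hval : (w.toWord.map val).prod = 1 := by
    rw [← hgw]
    conv_rhs => rw [← FreeGroup.mk_toWord (x := w)]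
    rw [FreeGroup.lift_mk]
    congr 1
    apply List.map_congr_left
    rintro ⟨i, e⟩ _
    cases e <;> simp [val, d, bar]
  have hev : ∀ y : G, evw bar Prod.snd c d y 1 w.toWord = 1 := by
    intro y
    apply Subtype.ext
    rw [evw_coe, one_mul, one_mul]
    change _ * ((w.toWord.map val).prod)⁻¹ = _
    rw [hval, inv_one, mul_one]
    have hh := hid (fun i => (c (i, true) : Γ) * g i * y * (c (i, false) : Γ)⁻¹) (by
      intro i
      have h1 : (g i)⁻¹ * (c (i, true) : Γ) * (g i)⁻¹⁻¹ ∈ G :=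
        ‹G.Normal›.conj_mem _ (c (i, true)).2 _
      have h2 := G.mul_mem (G.mul_mem h1 y.2) (G.inv_mem (c (i, false)).2)
      convert h2 using 1
      group)
    rw [← FreeGroup.mk_toWord (x := w), FreeGroup.lift_mk] at hh
    rw [Subgroup.coe_one, ← hh]
    congr 1
    apply List.map_congr_left
    rintro ⟨i, e⟩ _
    cases e <;> simp [d, bar, mul_assoc]
  obtain ⟨s, l, hsl⟩ : ∃ s l, w.toWord = s :: l := by
    cases h : w.toWord with
    | nil => exact absurd (FreeGroup.toWord_eq_nil_iff.1 h) hw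
    | cons s l => exact ⟨s, l, rfl⟩
  obtain ⟨Z, hZ, hrZ⟩ := main l s 1 (hsl ▸ FreeGroup.isReduced_toWord) (by
    intro l' hl'
    rw [one_mul]
    exact hT _ (hsl ▸ hl'))
  rw [← hsl] at hZ
  simp only [hev, mul_one] at hZ
  have := h4 _ _ hZ
  omega

end Core

section Reduction

set_option linter.unusedSectionVars false

/-- A field element outside an algebraically closed subfield is a pole of some place. -/
lemma exists_place {F L : Type*} [Field F] [IsAlgClosed F] [Field L] (j : F →+* L) (t : L)
    (ht : t ∉ j.range) : ∃ O : ValuationSubring L, (∀ a, j a ∈ O) ∧ t ∉ O := by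
  have : IsIntegrallyClosedIn j.range L := by
    rw [isIntegrallyClosedIn_iff]
    refine ⟨Subtype.val_injective, fun {x} hx => ?_⟩
    let _ := j.toAlgebra
    have hx' : IsIntegral F x := by
      obtain ⟨p, hp, hpx⟩ := hx
      have hsurj : Function.Surjective j.rangeRestrict := j.rangeRestrict_surjective
      have hbij : Function.Bijective j.rangeRestrict :=
        ⟨fun a b h => j.injective (congrArg Subtype.val h), hsurj⟩
      let e := RingEquiv.ofBijective _ hbij
      refine ⟨p.map (e.symm : j.range →+* F), hp.map _, ?_⟩
      rw [Polynomial.eval₂_map]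
      convert hpx using 2
      ext y
      obtain ⟨z, rfl⟩ := e.surjective y
      rw [RingHom.comp_apply]
      change j (e.symm (e z)) = (e z : L)
      rw [e.symm_apply_apply]
      rfl
    obtain ⟨y, hy⟩ := hx'.mem_range_algebraMap_of_minpoly_splits (K := F) (IsAlgClosed.splits _)
    exact ⟨⟨x, y, hy⟩, rfl⟩
  obtain ⟨V, hV, htV⟩ := Subring.exists_le_valuationSubring_of_isIntegrallyClosedIn ht
  exact ⟨V, fun a => hV ⟨a, rfl⟩, htV⟩

/-- `A` is a reduction of (a scalar multiple of) `M`. -/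
def Red {L : Type*} [Field L] (O : ValuationSubring L) {ι : Type*} (M : Matrix ι ι L)
    (A : Matrix ι ι (IsLocalRing.ResidueField O)) : Prop :=
  A ≠ 0 ∧ ∃ s : L, s ≠ 0 ∧ ∃ N : Matrix ι ι O, N.map (algebraMap O L) = s • M ∧
    N.map (IsLocalRing.residue O) = A

variable {L : Type*} [Field L] (O : ValuationSubring L) {ι : Type*} [Fintype ι] [DecidableEq ι]

lemma Red.exists (M : Matrix ι ι L) (hM : M ≠ 0) : ∃ A, Red O M A := by
  have hne : ∃ p : ι × ι, M p.1 p.2 ≠ 0 := by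
    by_contra! h
    exact hM (by ext i j; exact h (i, j))
  obtain ⟨p0, hp0⟩ := hne
  have : Nonempty (ι × ι) := ⟨p0⟩
  obtain ⟨p, hp⟩ := Finite.exists_max (fun p : ι × ι => O.valuation (M p.1 p.2))
  have hpne : M p.1 p.2 ≠ 0 := by
    intro h
    have := hp p0
    simp only [h, map_zero, le_zero_iff, Valuation.zero_iff] at this
    exact hp0 this
  have hmem : ∀ i j, (M p.1 p.2)⁻¹ * M i j ∈ O := by
    intro i j
    rw [← O.valuation_le_one_iff, map_mul, map_inv₀]
    have := hp (i, j)
    rw [inv_mul_le_iff₀ (by simpa [zero_lt_iff] using hpne), mul_one]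
    exact this
  let N : Matrix ι ι O := fun i j => ⟨_, hmem i j⟩
  refine ⟨N.map (IsLocalRing.residue O), ?_, (M p.1 p.2)⁻¹, inv_ne_zero hpne, N, ?_, rfl⟩
  · intro h
    have h1 := congrFun (congrFun h p.1) p.2
    have h2 : N p.1 p.2 = 1 := Subtype.ext (inv_mul_cancel₀ hpne)
    simp [h2] at h1
  · ext i j; rfl

variable {O}

lemma Red.mul {M N : Matrix ι ι L} {A B} (hA : Red O M A) (hB : Red O N B) (h : A * B ≠ 0) :
    Red O (M * N) (A * B) := by
  obtain ⟨-, s, hs, M', hM', rfl⟩ := hA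
  obtain ⟨-, t, ht, N', hN', rfl⟩ := hB
  refine ⟨h, s * t, mul_ne_zero hs ht, M' * N', ?_, ?_⟩
  · rw [Matrix.map_mul, hM', hN', Matrix.smul_mul, Matrix.mul_smul, smul_smul]
  · rw [Matrix.map_mul]

/-- A reduction of an invertible matrix with entries in `O` and inverse in `O`. -/
lemma Red.const (M : Matrix ι ι O) (h : M.map (IsLocalRing.residue O) ≠ 0) :
    Red O (M.map (algebraMap O L)) (M.map (IsLocalRing.residue O)) :=
  ⟨h, 1, one_ne_zero, M, by simp, rfl⟩

lemma Red.rank_const [Nonempty ι] (M M' : Matrix ι ι O) (hMM' : M * M' = 1) {A}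
    (h : Red O (M.map (algebraMap O L)) A) : A.rank = Fintype.card ι := by
  obtain ⟨h0, s, hs, N, hN, rfl⟩ := h
  have h1 : (N * M').map (algebraMap O L) = s • (1 : Matrix ι ι L) := by
    rw [Matrix.map_mul, hN, Matrix.smul_mul, ← Matrix.map_mul, hMM',
      Matrix.map_one _ (map_zero _) (map_one _)]
  obtain ⟨i⟩ := ‹Nonempty ι›
  have hsO : algebraMap O L ((N * M') i i) = s := by
    have := congrFun (congrFun h1 i) i
    simpa using this
  set s' := (N * M') i i
  have hN' : N = s' • M := by
    apply Matrix.map_injective (f := algebraMap O L) Subtype.val_injective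
    change N.map (algebraMap O L) = (s' • M).map (algebraMap O L)
    rw [hN, ← hsO]
    ext a b
    simp
  rw [Matrix.rank_of_isUnit]
  rw [hN'] at h0 ⊢
  have hs' : IsLocalRing.residue O s' ≠ 0 := by
    intro h
    apply h0
    ext a b
    simp [h]
  refine (Matrix.isUnit_iff_isUnit_det _).2 ?_
  have e : (s' • M).map (IsLocalRing.residue O) =
      IsLocalRing.residue O s' • M.map (IsLocalRing.residue O) := by ext a b; simp
  rw [e, Matrix.det_smul, isUnit_iff_ne_zero]
  refine mul_ne_zero (pow_ne_zero _ hs') ?_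
  have : M.map (IsLocalRing.residue O) * M'.map (IsLocalRing.residue O) = 1 := by
    rw [← Matrix.map_mul, hMM']; simp
  have h2 := congrArg Matrix.det this
  rw [Matrix.det_mul, Matrix.det_one] at h2
  exact left_ne_zero_of_mul_eq_one h2

/-- A matrix of determinant one with an entry outside `O` has singular reductions. -/
lemma Red.rank_lt (M : Matrix ι ι L) (c : L) (hc : c ≠ 0) (hdet : M.det = 1) (i j : ι)
    (hij : M i j ∉ O) {A} (h : Red O (c • M) A) : A.rank < Fintype.card ι := by
  obtain ⟨h0, s, hs, N, hN, rfl⟩ := h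
  rw [smul_smul] at hN
  set u := s * c
  have hu : u ≠ 0 := mul_ne_zero hs hc
  have hui : u⁻¹ ∉ O := by
    intro hm
    apply hij
    have h1 : u * M i j ∈ O := by
      have := congrFun (congrFun hN i) j
      rw [← smul_eq_mul, ← Matrix.smul_apply, ← this]
      exact (N i j).2
    have := O.mul_mem _ _ hm h1
    rwa [inv_mul_cancel_left₀ hu] at this
  have hcard : Fintype.card ι ≠ 0 := by
    have : Nonempty ι := ⟨i⟩
    exact Fintype.card_ne_zero
  have huO : u ∈ O := (O.mem_or_inv_mem u).resolve_right hui
  have hdetN : N.det = (⟨u, huO⟩ : O) ^ Fintype.card ι := by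
    apply Subtype.val_injective
    change algebraMap O L N.det = algebraMap O L ((⟨u, huO⟩ : O) ^ Fintype.card ι)
    rw [RingHom.map_det, RingHom.mapMatrix_apply, hN, Matrix.det_smul, hdet, mul_one, map_pow]
    rfl
  have hres : IsLocalRing.residue O ⟨u, huO⟩ = 0 := by
    rw [IsLocalRing.residue_eq_zero_iff, IsLocalRing.mem_maximalIdeal, mem_nonunits_iff]
    intro hun
    apply hui
    obtain ⟨v, hv⟩ := hun
    have : u * ((v⁻¹ : Oˣ) : O) = 1 := by
      have h3 := congrArg (algebraMap O L) (Units.mul_inv v)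
      rw [hv] at h3
      simpa using h3
    rw [← eq_inv_of_mul_eq_one_right this]
    exact ((v⁻¹ : Oˣ) : O).2
  have hd0 : (N.map (IsLocalRing.residue O)).det = 0 := by
    rw [← RingHom.mapMatrix_apply, ← RingHom.map_det, hdetN, map_pow, hres, zero_pow hcard]
  refine lt_of_le_of_ne (Matrix.rank_le_card_width _) fun hr => ?_
  obtain ⟨v, hv0, hv⟩ := Matrix.exists_mulVec_eq_zero_iff.2 hd0
  have hsurj : LinearMap.range (N.map (IsLocalRing.residue O)).mulVecLin = ⊤ :=
    Submodule.eq_top_of_finrank_eq (by rw [Module.finrank_fintype_fun_eq_card]; exact hr)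
  have hinj := LinearMap.injective_iff_surjective.2 (LinearMap.range_eq_top.1 hsurj)
  exact hv0 (hinj (by simpa using hv))

end Reduction

section Irreducible

variable {Γ : Type*} [Group Γ] {G : Subgroup Γ} [G.Normal]

/-- The genericity data: an algebra of functions on `Γ`, stable under conjugation and inversion,
such that finitely many functions which do not vanish on `G` have a common non-zero. -/
structure GenData {F : Type*} [Field F] (G : Subgroup Γ) (A : Subalgebra F (Γ → F)) : Prop where
  conj : ∀ a ∈ A, ∀ γ : Γ, (fun x => a (γ * x * γ⁻¹)) ∈ A
  inv : ∀ a ∈ A, (fun x => a x⁻¹) ∈ A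
  irr : ∀ S : Set (Γ → F), S.Finite → (∀ a ∈ S, a ∈ A ∧ ∃ x ∈ G, a x ≠ 0) →
    ∃ b ∈ G, ∀ a ∈ S, a b ≠ 0

variable {F : Type*} [Field F] {A : Subalgebra F (Γ → F)}
  {ι : Type*} [Fintype ι] [DecidableEq ι]

lemma exists_regular (hA : GenData G A) (ρ : G →* Matrix ι ι F)
    (hreg : ∀ i j, ∃ a ∈ A, ∀ x : G, a x = ρ x i j) (μ : Matrix ι ι F →ₗ[F] F) (γ : Γ)
    (e : Bool) : ∃ a ∈ A, ∀ x : G, a x = μ (ρ (MulAut.conjNormal γ (cond e x x⁻¹))) := by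
  choose a haA ha using hreg
  let b : Γ → F := ∑ i, ∑ j, μ (Matrix.single i j 1) • a i j
  have hb : b ∈ A := A.sum_mem fun i _ => A.sum_mem fun j _ => A.smul_mem (haA i j) _
  have hbx : ∀ x : G, b x = μ (ρ x) := by
    intro x
    conv_rhs => rw [Matrix.matrix_eq_sum_single (ρ x)]
    simp only [b, Finset.sum_apply, map_sum, Pi.smul_apply, ha]
    refine Finset.sum_congr rfl fun i _ => Finset.sum_congr rfl fun j _ => ?_
    have : Matrix.single i j (ρ x i j) = ρ x i j • Matrix.single i j (1 : F) := by simp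
    rw [this, map_smul, smul_eq_mul, smul_eq_mul, mul_comm]
  cases e
  · refine ⟨_, hA.inv _ (hA.conj _ hb γ), fun x => ?_⟩
    rw [← hbx, cond_false, MulAut.conjNormal_apply]
    simp
  · refine ⟨_, hA.conj _ hb γ, fun x => ?_⟩
    rw [← hbx, cond_true, MulAut.conjNormal_apply]

lemma generic (hA : GenData G A) (ρ : G →* Matrix ι ι F)
    (hreg : ∀ i j, ∃ a ∈ A, ∀ x : G, a x = ρ x i j)
    (hspan : Submodule.span F (Set.range ρ) = ⊤) {κ : Type*} [Field κ] (jκ : F →+* κ)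
    (S : Set (Γ × Bool × Matrix ι ι κ × Matrix ι ι κ)) (hS : S.Finite)
    (hS0 : ∀ q ∈ S, q.2.2.1 ≠ 0 ∧ q.2.2.2 ≠ 0) :
    ∃ b : G, ∀ q ∈ S, q.2.2.1 *
      (jκ.mapMatrix.toMonoidHom.comp ρ) (MulAut.conjNormal q.1 (cond q.2.1 b b⁻¹)) *
        q.2.2.2 ≠ 0 := by
  let _ : Algebra F κ := jκ.toAlgebra
  have key : ∀ q ∈ S, ∃ a : Γ → F, (a ∈ A ∧ ∃ x ∈ G, a x ≠ 0) ∧ ∀ b : G, a b ≠ 0 →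
      q.2.2.1 * (jκ.mapMatrix.toMonoidHom.comp ρ) (MulAut.conjNormal q.1 (cond q.2.1 b b⁻¹)) *
        q.2.2.2 ≠ 0 := by
    rintro ⟨γ, e, X, Y⟩ hq
    obtain ⟨hX, hY⟩ := hS0 _ hq
    dsimp only at hX hY ⊢
    obtain ⟨p, u, hpu⟩ : ∃ p u, X p u ≠ 0 := by
      by_contra! h; exact hX (by ext i j; exact h i j)
    obtain ⟨v, q', hvq⟩ : ∃ v q', Y v q' ≠ 0 := by
      by_contra! h; exact hY (by ext i j; exact h i j)
    let φ : Matrix ι ι F →ₗ[F] κ :=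
      { toFun := fun m => (X * m.map jκ * Y) p q'
        map_add' := by
          intro m m'
          rw [Matrix.map_add _ (map_add jκ)]
          simp [Matrix.mul_add, Matrix.add_mul]
        map_smul' := by
          intro c m
          have : (c • m).map jκ = jκ c • m.map jκ := by ext i j; simp
          rw [this, Matrix.mul_smul, Matrix.smul_mul]
          rfl }
    have hφ : φ ≠ 0 := by
      intro h
      have h1 : φ (Matrix.single u v 1) = X p u * Y v q' := by
        change (X * (Matrix.single u v (1 : F)).map jκ * Y) p q' = _
        rw [Matrix.map_single, map_one, Matrix.mul_apply]
        rw [Finset.sum_eq_single v]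
        · simp
        · intro b _ hb
          rw [Matrix.mul_single_apply_of_ne _ _ _ _ _ hb, zero_mul]
        · simp
      rw [h] at h1
      exact mul_ne_zero hpu hvq h1.symm
    obtain ⟨b0, hb0⟩ : ∃ b0, φ (ρ b0) ≠ 0 := by
      by_contra! h
      apply hφ
      rw [← LinearMap.ker_eq_top, eq_top_iff, ← hspan, Submodule.span_le]
      rintro _ ⟨x, rfl⟩
      exact h x
    obtain ⟨l, hl⟩ : ∃ l : Module.Dual F κ, l (φ (ρ b0)) ≠ 0 := by
      by_contra! h
      exact hb0 ((Module.forall_dual_apply_eq_zero_iff F _).1 h)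
    obtain ⟨a, haA, ha⟩ := exists_regular hA ρ hreg (l ∘ₗ φ) γ e
    refine ⟨a, ⟨haA, ?_⟩, ?_⟩
    · let x0 : G := cond e (MulAut.conjNormal γ⁻¹ b0) (MulAut.conjNormal γ⁻¹ b0)⁻¹
      refine ⟨x0, x0.2, ?_⟩
      rw [ha]
      have hk : MulAut.conjNormal γ (cond e x0 x0⁻¹) = b0 := by
        have key : MulAut.conjNormal γ ((MulAut.conjNormal γ)⁻¹ b0) = b0 := by
          rw [← MulAut.mul_apply, mul_inv_cancel]; rfl
        cases e <;> simp only [x0, cond_true, cond_false, map_inv, inv_inv, key]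
      rw [hk]
      exact hl
    · intro b hb h
      rw [ha] at hb
      apply hb
      have : φ (ρ (MulAut.conjNormal γ (cond e b b⁻¹))) = 0 := congrFun (congrFun h p) q'
      rw [LinearMap.comp_apply, this, map_zero]
  choose! a ha1 ha2 using key
  obtain ⟨b, hbG, hb⟩ := hA.irr (a '' S) (hS.image _) (by
    rintro _ ⟨q, hq, rfl⟩
    exact ha1 q hq)
  exact ⟨⟨b, hbG⟩, fun q hq => ha2 q hq _ (hb _ ⟨q, hq, rfl⟩)⟩

/-- The subgroup of elements acting by scalars. -/
def scalarSubgroup (ρ : G →* Matrix ι ι F) : Subgroup G where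
  carrier := {x | ∃ c : F, ρ x = c • 1}
  one_mem' := ⟨1, by simp⟩
  mul_mem' := by
    rintro x y ⟨c, hc⟩ ⟨c', hc'⟩
    exact ⟨c * c', by rw [map_mul, hc, hc']; simp [smul_smul, mul_comm]⟩
  inv_mem' := by
    rintro x ⟨c, hc⟩
    rcases isEmpty_or_nonempty ι with h | h
    · exact ⟨1, Subsingleton.elim _ _⟩
    refine ⟨c⁻¹, ?_⟩
    have h1 : ρ x * ρ x⁻¹ = 1 := by rw [← map_mul, mul_inv_cancel, map_one]
    rw [hc, Matrix.smul_mul, one_mul] at h1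
    have hc0 : c ≠ 0 := by
      rintro rfl
      rw [zero_smul] at h1
      exact zero_ne_one h1
    rw [← h1, smul_smul, inv_mul_cancel₀ hc0, one_smul]

theorem irr_case [IsAlgClosed F] [Nonempty ι] (hA : GenData G A) (ρ : G →* Matrix ι ι F)
    (hreg : ∀ i j, ∃ a ∈ A, ∀ x : G, a x = ρ x i j)
    (hspan : Submodule.span F (Set.range ρ) = ⊤)
    {n : ℕ} (w : FreeGroup (Fin n)) (hw : w ≠ 1) (g : Fin n → Γ)
    (hid : ∀ h : Fin n → Γ, (∀ i, (g i)⁻¹ * h i ∈ G) → FreeGroup.lift h w = 1) :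
    (scalarSubgroup ρ).FiniteIndex := by
  have hdet : ∀ x, (ρ x).det ≠ 0 := by
    intro x h
    have h1 : ρ x * ρ x⁻¹ = 1 := by rw [← map_mul, mul_inv_cancel, map_one]
    have h2 := congrArg Matrix.det h1
    rw [Matrix.det_mul, h, zero_mul, Matrix.det_one] at h2
    exact zero_ne_one h2
  have hs : ∀ x, ∃ s : F, s ^ Fintype.card ι = (ρ x).det := fun x =>
    IsAlgClosed.exists_pow_nat_eq _ Fintype.card_pos
  choose s hs using hs
  have hs0 : ∀ x, s x ≠ 0 := by
    intro x h
    apply hdet x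
    rw [← hs, h, zero_pow Fintype.card_ne_zero]
  let u : G → Matrix ι ι F := fun x => (s x)⁻¹ • ρ x
  have hu : ∀ x, ρ x = s x • u x := fun x => by simp [u, smul_smul, hs0]
  have hudet : ∀ x, (u x).det = 1 := by
    intro x
    simp only [u, Matrix.det_smul, ← hs, ← mul_pow, inv_mul_cancel₀ (hs0 x), one_pow]
  by_cases hfin : ∀ i j, (Set.range fun x => u x i j).Finite
  · have hf : (Set.range u).Finite := by
      have h1 : (Set.pi Set.univ fun i => Set.pi Set.univ fun j =>
          Set.range fun x => u x i j).Finite :=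
        Set.Finite.pi fun i => Set.Finite.pi fun j => hfin i j
      refine h1.subset ?_
      rintro _ ⟨x, rfl⟩ i _ j _
      exact ⟨x, rfl⟩
    have : Finite (Set.range u) := hf
    have : Finite (G ⧸ scalarSubgroup ρ) := by
      refine Finite.of_surjective (α := Set.range u)
        (fun t => (QuotientGroup.mk t.2.choose : G ⧸ scalarSubgroup ρ)) ?_
      intro y
      obtain ⟨y, rfl⟩ := QuotientGroup.mk_surjective y
      refine ⟨⟨u y, y, rfl⟩, ?_⟩
      have hsp : u (⟨y, rfl⟩ : ∃ z, u z = u y).choose = u y :=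
        (⟨y, rfl⟩ : ∃ z, u z = u y).choose_spec
      refine QuotientGroup.eq.2 ?_
      generalize (⟨y, rfl⟩ : ∃ z, u z = u y).choose = x at hsp
      refine ⟨(s x)⁻¹ * s y, ?_⟩
      have h1 : ρ y = ((s x)⁻¹ * s y) • ρ x := by
        calc ρ y = s y • u y := hu y
          _ = s y • u x := by rw [hsp]
          _ = ((s x)⁻¹ * s y) • ρ x := by
            simp only [u, smul_smul]
            rw [mul_comm]
      rw [map_mul, h1, Matrix.mul_smul, ← map_mul, inv_mul_cancel, map_one]
    exact Subgroup.finiteIndex_of_finite_quotient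
  · exfalso
    push Not at hfin
    obtain ⟨i, j, hinf⟩ := hfin
    let em := hinf.natEmbedding
    choose ξ hξ using fun m => (em m).2
    let L := Filter.Germ (Filter.hyperfilter ℕ : Filter ℕ) F
    let ψ : (ℕ → F) →+* L := Filter.Germ.coeRingHom _
    let cst : F →+* (ℕ → F) := Pi.constRingHom ℕ F
    let j' : F →+* L := ψ.comp cst
    let t : L := ψ fun m => u (ξ m) i j
    have ht : t ∉ j'.range := by
      rintro ⟨c, hc⟩
      have h1 : ∀ᶠ m in (Filter.hyperfilter ℕ : Filter ℕ), c = u (ξ m) i j :=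
        Filter.Germ.coe_eq.1 hc
      have h2 : {m | c = u (ξ m) i j}.Finite := by
        refine Set.Subsingleton.finite ?_
        intro m hm m' hm'
        apply em.injective
        apply Subtype.ext
        rw [← hξ m, ← hξ m']
        exact hm.symm.trans hm'
      exact h2.notMem_hyperfilter h1
    obtain ⟨O, hjO, htO⟩ := exists_place j' t ht
    let jO : F →+* O := j'.codRestrict O.toSubring hjO
    let jκ : F →+* IsLocalRing.ResidueField O := (IsLocalRing.residue O).comp jO
    let pk : (ℕ → Matrix ι ι F) → Matrix ι ι (ℕ → F) := fun x => Matrix.of fun i j m => x m i j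
    have hpkmul : ∀ x y, pk (x * y) = pk x * pk y := by
      intro x y
      ext i j m
      simp [pk, Matrix.mul_apply]
    have hpkone : pk 1 = 1 := by
      ext i j m
      by_cases h : i = j <;> simp [pk, h, Matrix.one_apply]
    let R : (ℕ → G) → Matrix ι ι L := fun x => ψ.mapMatrix (pk fun m => ρ (x m))
    have hRmul : ∀ x y, R (x * y) = R x * R y := by
      intro x y
      simp only [R, ← map_mul, ← hpkmul]
      congr 2
      funext m
      simp
    have hRone : R 1 = 1 := by
      have : (fun m => ρ ((1 : ℕ → G) m)) = 1 := by funext m; simp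
      simp only [R, this, hpkone, map_one]
    have hRne : ∀ x, R x ≠ 0 := by
      intro x h
      have h1 : R x * R x⁻¹ = 1 := by rw [← hRmul, mul_inv_cancel, hRone]
      rw [h, zero_mul] at h1
      exact zero_ne_one h1
    have hRconst : ∀ b : G, R (fun _ => b) = ((ρ b).map jO).map (algebraMap O L) := by
      intro b
      ext i j
      rfl
    refine core (G := G) (jκ.mapMatrix.toMonoidHom.comp ρ) (fun x B => Red O (R x) B)
      (fun x B h => h.1) (fun x => Red.exists O _ (hRne x)) ?_ ?_ ?_ ?_
      (generic hA ρ hreg hspan jκ) w hw g hid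
    · intro x y B C hB hC h
      rw [hRmul]
      exact hB.mul hC h
    · intro b
      rw [hRconst]
      have e1 : (jκ.mapMatrix.toMonoidHom.comp ρ) b =
          ((ρ b).map jO).map (IsLocalRing.residue O) := rfl
      rw [e1]
      refine Red.const _ ?_
      rw [← e1]
      intro h
      have h1 : (jκ.mapMatrix.toMonoidHom.comp ρ) b *
          (jκ.mapMatrix.toMonoidHom.comp ρ) b⁻¹ = 1 := by
        rw [← map_mul, mul_inv_cancel, map_one]
      rw [h, zero_mul] at h1
      exact zero_ne_one h1
    · intro b B hB
      rw [hRconst] at hB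
      refine Red.rank_const _ ((ρ b⁻¹).map jO) ?_ hB
      rw [← Matrix.map_mul, ← map_mul, mul_inv_cancel, map_one]
      exact Matrix.map_one _ (map_zero _) (map_one _)
    · obtain ⟨B, hB⟩ := Red.exists O _ (hRne ξ)
      refine ⟨ξ, B, hB, ?_⟩
      let M : Matrix ι ι L := ψ.mapMatrix (pk fun m => u (ξ m))
      let c : L := ψ fun m => s (ξ m)
      have hRM : R ξ = c • M := by
        ext a b
        simp only [R, M, c, RingHom.mapMatrix_apply, Matrix.map_apply, Matrix.smul_apply,
          smul_eq_mul, ← map_mul]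
        congr 1
        funext m
        simp [pk, hu]
      have hc : c ≠ 0 := by
        intro h
        have : R ξ = 0 := by rw [hRM, h, zero_smul]
        exact hRne ξ this
      have hMdet : M.det = 1 := by
        simp only [M]
        rw [← RingHom.map_det]
        have : (pk fun m => u (ξ m)).det = 1 := by
          funext m
          have := RingHom.map_det (Pi.evalRingHom (fun _ => F) m) (pk fun m => u (ξ m))
          exact this.trans (hudet (ξ m))
        rw [this, map_one]
      rw [hRM] at hB
      exact Red.rank_lt M c hc hMdet i j htO hB

end Irreducible

section Burnside

variable {F : Type*} [Field F] {W : Type*} [AddCommGroup W] [Module F W]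

lemma burnside [IsAlgClosed F] [FiniteDimensional F W] [Nontrivial W] {G : Type*} [Group G]
    (ρ : G →* Module.End F W)
    (h : ∀ U : Submodule F W, (∀ x, ∀ v ∈ U, ρ x v ∈ U) → U = ⊥ ∨ U = ⊤) :
    Submodule.span F (Set.range ρ) = ⊤ := by
  let S : Subalgebra F (Module.End F W) := Algebra.adjoin F (Set.range ρ)
  have hS : Subalgebra.toSubmodule S = Submodule.span F (Set.range ρ) := by
    have h1 : Submonoid.closure (Set.range ρ) = MonoidHom.mrange ρ := by
      rw [← MonoidHom.coe_mrange, Submonoid.closure_eq]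
    rw [Algebra.adjoin_eq_span, h1, MonoidHom.coe_mrange]
  have hsm : ∀ (s : S) (v : W), s • v = (s : Module.End F W) v := fun s v => rfl
  have : IsScalarTower F S W := ⟨fun c s v => rfl⟩
  have hsimple : IsSimpleModule S W := by
    rw [isSimpleModule_iff]
    refine { eq_bot_or_eq_top := fun U => ?_ }
    rcases h (U.restrictScalars F) (fun x v hv =>
      U.smul_mem (⟨ρ x, Algebra.subset_adjoin ⟨x, rfl⟩⟩ : S) hv) with h1 | h1
    · left
      exact (Submodule.restrictScalars_eq_bot_iff F S W).1 h1
    · right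
      exact (Submodule.restrictScalars_eq_top_iff F S W).1 h1
  have hfin : Module.Finite (Module.End S W) W := Module.Finite.of_restrictScalars_finite F _ _
  have hsurj := Module.Finite.toModuleEnd_moduleEnd_surjective (R := S) (M := W)
  have hschur := (IsSimpleModule.algebraMap_end_bijective_of_isAlgClosed (A := S) (V := W) F).2
  rw [← hS, eq_top_iff]
  intro f _
  let f' : Module.End (Module.End S W) W :=
    { toFun := f
      map_add' := map_add f
      map_smul' := by
        intro c v
        obtain ⟨c, rfl⟩ := hschur c
        exact map_smul f c v }
  obtain ⟨s, hs⟩ := hsurj f'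
  have : f = s := by
    ext v
    exact (congrArg (fun g => g v) hs).symm
  rw [this]
  exact s.2

end Burnside

section Induction

/-- The derived series of a subgroup, inside the ambient group. -/
def dser {G : Type*} [Group G] (H : Subgroup G) : ℕ → Subgroup G
  | 0 => H
  | n + 1 => ⁅dser H n, dser H n⁆

lemma dser_mono {G : Type*} [Group G] {H K : Subgroup G} (h : H ≤ K) (n : ℕ) :
    dser H n ≤ dser K n := by
  induction n with
  | zero => exact h
  | succ n ih => exact Subgroup.commutator_mono ih ih

lemma dser_succ_le {G : Type*} [Group G] (H : Subgroup G) (n : ℕ) :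
    dser H (n + 1) ≤ dser H n := by
  refine Subgroup.commutator_le.2 fun x hx y hy => ?_
  exact mul_mem (mul_mem (mul_mem hx hy) (inv_mem hx)) (inv_mem hy)

lemma dser_anti {G : Type*} [Group G] (H : Subgroup G) : Antitone (dser H) :=
  antitone_nat_of_succ_le (dser_succ_le H)

lemma commutator_trivial {G M : Type*} [Group G] [Monoid M] (ρ : G →* M) (K : Subgroup G)
    (h : ∀ x ∈ K, ∀ y ∈ K, ρ x * ρ y = ρ y * ρ x) : ∀ x ∈ ⁅K, K⁆, ρ x = 1 := by
  have : ⁅K, K⁆ ≤ ρ.ker := by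
    refine Subgroup.commutator_le.2 fun x hx y hy => ?_
    rw [MonoidHom.mem_ker, commutatorElement_def, map_mul, map_mul, map_mul, h x hx y hy,
      mul_assoc (ρ y), ← map_mul, mul_inv_cancel, map_one, mul_one, ← map_mul, mul_inv_cancel,
      map_one]
  exact fun x hx => this hx

variable {Γ : Type*} [Group Γ] {G : Subgroup Γ} [G.Normal]
  {F : Type*} [Field F] {A : Subalgebra F (Γ → F)}

theorem induct [IsAlgClosed F] (hA : GenData G A)
    {n : ℕ} (w : FreeGroup (Fin n)) (hw : w ≠ 1) (g : Fin n → Γ)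
    (hid : ∀ h : Fin n → Γ, (∀ i, (g i)⁻¹ * h i ∈ G) → FreeGroup.lift h w = 1) (d : ℕ) :
    ∀ (W : Type*) [AddCommGroup W] [Module F W] [FiniteDimensional F W]
    (_ : Module.finrank F W = d) (ρ : G →* Module.End F W)
    (_ : ∀ (φ : Module.Dual F W) (v : W), ∃ a ∈ A, ∀ x : G, a x = φ (ρ x v)),
    ∃ H : Subgroup G, H.FiniteIndex ∧ ∃ m, ∀ x ∈ dser H m, ρ x = 1 := by
  induction d using Nat.strong_induction_on with
  | _ d ih =>
  intro W _ _ _ hd ρ hreg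
  rcases subsingleton_or_nontrivial W with hW | hW
  · refine ⟨⊤, inferInstance, 0, fun x _ => ?_⟩
    ext v
    exact Subsingleton.elim _ _
  by_cases hirr : ∀ U : Submodule F W, (∀ x, ∀ v ∈ U, ρ x v ∈ U) → U = ⊥ ∨ U = ⊤
  · have hsp := burnside ρ hirr
    let b := Module.finBasis F W
    have : Nonempty (Fin (Module.finrank F W)) := ⟨⟨0, Module.finrank_pos⟩⟩
    let e := LinearMap.toMatrixAlgEquiv b
    let ρ' : G →* Matrix (Fin (Module.finrank F W)) (Fin (Module.finrank F W)) F :=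
      (e : Module.End F W →* _).comp ρ
    have hf : (scalarSubgroup ρ').FiniteIndex := by
      refine irr_case hA ρ' ?_ ?_ w hw g hid
      · intro i j
        obtain ⟨a, ha, hax⟩ := hreg (b.coord i) (b j)
        refine ⟨a, ha, fun x => ?_⟩
        rw [hax]
        change _ = LinearMap.toMatrixAlgEquiv b (ρ x) i j
        rw [LinearMap.toMatrixAlgEquiv_apply]
        rfl
      · have h1 : Set.range ρ' = e.toLinearMap '' Set.range ρ := by
          rw [← Set.range_comp]
          rfl
        rw [h1, Submodule.span_image, hsp, Submodule.map_top, LinearMap.range_eq_top]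
        exact e.surjective
    refine ⟨_, hf, 1, ?_⟩
    apply commutator_trivial
    rintro x ⟨c, hc⟩ y -
    have h1 : ρ x = c • 1 := by
      apply e.injective
      rw [map_smul, map_one]
      exact hc
    rw [h1]
    simp
  · push Not at hirr
    obtain ⟨U, hU, hbot, htop⟩ := hirr
    let ρ1 : G →* Module.End F U :=
      { toFun := fun x => (ρ x).restrict (hU x)
        map_one' := by ext v; simp
        map_mul' := by intro x y; ext v; simp }
    let ρ2 : G →* Module.End F (W ⧸ U) :=
      { toFun := fun x => U.mapQ U (ρ x) (hU x)
        map_one' := by ext v; simp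
        map_mul' := by intro x y; ext v; simp }
    have hlt1 : Module.finrank F U < d := hd ▸ Submodule.finrank_lt htop
    have hlt2 : Module.finrank F (W ⧸ U) < d := by
      have h1 := Submodule.finrank_quotient_add_finrank U
      have h2 : 0 < Module.finrank F U := by
        have := Submodule.nontrivial_iff_ne_bot.2 hbot
        exact Module.finrank_pos
      omega
    obtain ⟨H1, hH1, m1, h1⟩ := ih _ hlt1 U rfl ρ1 (by
      intro φ v
      obtain ⟨φ', hφ'⟩ := LinearMap.exists_extend φ
      obtain ⟨a, ha, hax⟩ := hreg φ' v
      refine ⟨a, ha, fun x => ?_⟩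
      rw [hax, ← hφ']
      rfl)
    obtain ⟨H2, hH2, m2, h2⟩ := ih _ hlt2 (W ⧸ U) rfl ρ2 (by
      intro φ v
      obtain ⟨v, rfl⟩ := U.mkQ_surjective v
      obtain ⟨a, ha, hax⟩ := hreg (φ ∘ₗ U.mkQ) v
      refine ⟨a, ha, fun x => ?_⟩
      rw [hax]
      rfl)
    refine ⟨H1 ⊓ H2, inferInstance, max m1 m2 + 1, ?_⟩
    apply commutator_trivial
    have k1 : ∀ x ∈ dser (H1 ⊓ H2) (max m1 m2), ∀ v ∈ U, ρ x v = v := by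
      intro x hx v hv
      have := h1 x (dser_anti _ (le_max_left m1 m2) (dser_mono inf_le_left _ hx))
      exact congrArg Subtype.val (LinearMap.congr_fun this ⟨v, hv⟩)
    have k2 : ∀ x ∈ dser (H1 ⊓ H2) (max m1 m2), ∀ v, ρ x v - v ∈ U := by
      intro x hx v
      have := h2 x (dser_anti _ (le_max_right m1 m2) (dser_mono inf_le_right _ hx))
      exact (Submodule.Quotient.eq U).1 (LinearMap.congr_fun this (U.mkQ v))
    have k3 : ∀ x ∈ dser (H1 ⊓ H2) (max m1 m2), ∀ y ∈ dser (H1 ⊓ H2) (max m1 m2), ∀ v,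
        ρ x (ρ y v) = ρ x v + ρ y v - v := by
      intro x hx y hy v
      have := k1 x hx _ (k2 y hy v)
      rw [map_sub, sub_eq_iff_eq_add] at this
      rw [this]
      abel
    intro x hx y hy
    ext v
    rw [Module.End.mul_apply, Module.End.mul_apply, k3 x hx y hy, k3 y hy x hx]
    abel

end Induction

section Topological

lemma image_component {X : Type*} [TopologicalSpace X] (f : X ≃ₜ X) {Z : Set X}
    (hZ : Z ∈ irreducibleComponents X) : f '' Z ∈ irreducibleComponents X := by
  refine ⟨hZ.1.image f f.continuous.continuousOn, fun Y hY hle => ?_⟩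
  have h1 : Z ≤ f.symm '' Y := by
    intro z hz
    exact ⟨f z, hle ⟨z, hz, rfl⟩, f.symm_apply_apply z⟩
  have h2 := hZ.2 (hY.image f.symm f.symm.continuous.continuousOn) h1
  intro y hy
  exact ⟨f.symm y, h2 ⟨y, hy, rfl⟩, f.apply_symm_apply y⟩

lemma exists_component {N : Type*} [Group N] [TopologicalSpace N]
    [TopologicalSpace.NoetherianSpace N] (hl : ∀ n : N, Continuous fun x : N => n * x) :
    ∃ G : Subgroup N, G.FiniteIndex ∧ IsIrreducible (G : Set N) ∧
      ∀ f : N ≃ₜ N, f 1 = 1 → ∀ x ∈ G, f x ∈ G := by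
  have hfin := TopologicalSpace.NoetherianSpace.finite_irreducibleComponents (α := N)
  let tr : N → N ≃ₜ N := fun n =>
    { toEquiv := Equiv.mulLeft n
      continuous_toFun := hl n
      continuous_invFun := hl n⁻¹ }
  have htr : ∀ n (Z : Set N), n • Z = tr n '' Z := fun n Z => rfl
  let C : Set N := irreducibleComponent 1
  have hC : C ∈ irreducibleComponents N := irreducibleComponent_mem_irreducibleComponents 1
  have h1C : (1 : N) ∈ C := mem_irreducibleComponent
  obtain ⟨x0, hx0⟩ : ((⋃₀ (irreducibleComponents N \ {C}))ᶜ).Nonempty := by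
    have hZ := closure_sUnion_irreducibleComponents_sdiff_singleton hfin C hC
    contrapose! hZ
    rw [hZ, closure_empty]
    intro h
    rw [← h] at h1C
    exact h1C
  have hx0' : ∀ Z ∈ irreducibleComponents N, x0 ∈ Z → Z = C := by
    intro Z hZ hx
    by_contra hne
    exact hx0 ⟨Z, ⟨hZ, hne⟩, hx⟩
  have huniq : ∀ Z ∈ irreducibleComponents N, 1 ∈ Z → Z = C := by
    intro Z hZ hx
    have key : ∀ Y ∈ irreducibleComponents N, (1 : N) ∈ Y → x0 • Y = C := by
      intro Y hY h1
      refine hx0' _ (htr x0 Y ▸ image_component (tr x0) hY) ?_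
      exact ⟨1, h1, mul_one x0⟩
    exact smul_left_cancel x0 ((key Z hZ hx).trans (key C hC h1C).symm)
  let G := MulAction.stabilizer N C
  have hG : (G : Set N) = C := by
    ext n
    constructor
    · intro hn
      have hn' : n • C = C := hn
      rw [← hn']
      exact ⟨1, h1C, mul_one n⟩
    · intro hn
      have h1 : n⁻¹ ∈ G := by
        refine huniq _ (htr n⁻¹ C ▸ image_component (tr n⁻¹) hC) ?_
        exact ⟨n, hn, inv_mul_cancel n⟩
      exact inv_mem_iff.1 h1
  refine ⟨G, ?_, ?_, ?_⟩
  · have horb : (MulAction.orbit N C).Finite := by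
      refine hfin.subset ?_
      rintro _ ⟨n, rfl⟩
      exact image_component (tr n) hC
    have : Finite (MulAction.orbit N C) := horb
    have : Finite (N ⧸ G) := Finite.of_equiv _ (MulAction.orbitEquivQuotientStabilizer N C)
    exact Subgroup.finiteIndex_of_finite_quotient
  · rw [hG]
    exact hC.1
  · intro f hf x hx
    rw [← SetLike.mem_coe, hG] at hx ⊢
    have := huniq _ (image_component f hC) ⟨1, h1C, hf⟩
    rw [← this]
    exact ⟨x, hx, rfl⟩

end Topological

section Algebraic

variable {Γ : Type*} [Group Γ] {F : Type*} [Field F]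

/-- Precomposition as an algebra homomorphism. -/
def precompHom (F : Type*) [Field F] (τ : Γ → Γ) : (Γ → F) →ₐ[F] (Γ → F) where
  toFun a x := a (τ x)
  map_one' := rfl
  map_mul' _ _ := rfl
  map_zero' := rfl
  map_add' _ _ := rfl
  commutes' _ := rfl

/-- The component argument: a finitely generated algebra of functions which is stable under
two-sided translations and inversion gives genericity data. -/
lemma exists_genData (A : Subalgebra F (Γ → F)) (hfg : A.FG)
    (hmul : ∀ a ∈ A, ∀ p q : Γ, (fun x => a (p * x * q)) ∈ A)
    (hinv : ∀ a ∈ A, (fun x => a x⁻¹) ∈ A) (N : Subgroup Γ) [N.Normal] [N.FiniteIndex] :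
    ∃ G : Subgroup Γ, G.Normal ∧ G.FiniteIndex ∧ G ≤ N ∧ GenData G A := by
  have : IsNoetherianRing A := isNoetherianRing_of_fg hfg
  let ev : Γ → A →+* F := fun x => (Pi.evalRingHom (fun _ => F) x).comp A.val.toRingHom
  let ι : N → PrimeSpectrum A := fun x => ⟨RingHom.ker (ev x), RingHom.ker_isPrime _⟩
  let _ : TopologicalSpace N := TopologicalSpace.induced ι inferInstance
  have hι : Topology.IsInducing ι := ⟨rfl⟩
  have : TopologicalSpace.NoetherianSpace N := hι.noetherianSpace
  have hopen : ∀ a ∈ A, IsOpen {x : N | a x ≠ 0} := by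
    intro a ha
    have := (PrimeSpectrum.basicOpen (⟨a, ha⟩ : A)).isOpen.preimage hι.continuous
    exact this
  have hcont : ∀ f : N → N, (∀ a ∈ A, ∃ a' ∈ A, ∀ x : N, a' x = a (f x)) → Continuous f := by
    intro f hf
    rw [hι.continuous_iff, PrimeSpectrum.isTopologicalBasis_basic_opens.continuous_iff]
    rintro _ ⟨a, rfl⟩
    obtain ⟨a', ha', h⟩ := hf a.1 a.2
    convert hopen a' ha' using 1
    ext x
    change (a.1 (f x) ≠ 0) ↔ a' x ≠ 0
    rw [h]
  obtain ⟨G, hfi, hirr, hf⟩ := exists_component (N := N) (by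
    intro n
    refine hcont _ fun a ha => ⟨_, hmul a ha n 1, fun x => ?_⟩
    simp)
  refine ⟨G.map N.subtype, ⟨?_⟩, ⟨?_⟩, Subgroup.map_subtype_le G, ?_⟩
  · rintro _ ⟨x, hx, rfl⟩ γ
    have hc : ∀ γ : Γ, Continuous fun x : N => MulAut.conjNormal γ x := by
      intro γ
      refine hcont _ fun a ha => ⟨_, hmul a ha γ γ⁻¹, fun x => ?_⟩
      rw [MulAut.conjNormal_apply]
    let f : N ≃ₜ N :=
      { toEquiv := (MulAut.conjNormal γ : MulAut N).toEquiv
        continuous_toFun := hc γ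
        continuous_invFun := by
          have := hc γ⁻¹
          rw [map_inv] at this
          exact this }
    exact ⟨f x, hf f (map_one (MulAut.conjNormal γ : MulAut N)) x hx, MulAut.conjNormal_apply γ x⟩
  · rw [Subgroup.index_map_subtype]
    exact mul_ne_zero hfi.index_ne_zero Subgroup.FiniteIndex.index_ne_zero
  · refine ⟨fun a ha γ => hmul a ha γ γ⁻¹, hinv, ?_⟩
    intro S hS hSA
    classical
    let U : Finset (Set N) := hS.toFinset.image fun a => {x : N | a x ≠ 0}
    obtain ⟨b, hbG, hb⟩ := isIrreducible_iff_sInter.1 hirr U (by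
      intro u hu
      obtain ⟨a, ha, rfl⟩ := Finset.mem_image.1 hu
      exact hopen a (hSA a (hS.mem_toFinset.1 ha)).1) (by
      intro u hu
      obtain ⟨a, ha, rfl⟩ := Finset.mem_image.1 hu
      obtain ⟨_, ⟨x, hx, rfl⟩, hne⟩ := (hSA a (hS.mem_toFinset.1 ha)).2
      exact ⟨x, hx, hne⟩)
    refine ⟨b, ⟨b, hbG, rfl⟩, fun a ha => ?_⟩
    exact hb {x : N | a x ≠ 0}
      (Finset.mem_coe.2 (Finset.mem_image.2 ⟨a, hS.mem_toFinset.2 ha, rfl⟩))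

/-- The coordinate algebra of a matrix representation. -/
lemma exists_algebra {k : ℕ} (σ : Γ →* Matrix (Fin k) (Fin k) F) :
    ∃ A : Subalgebra F (Γ → F), A.FG ∧ (∀ a ∈ A, ∀ p q : Γ, (fun x => a (p * x * q)) ∈ A) ∧
      (∀ a ∈ A, (fun x => a x⁻¹) ∈ A) ∧ ∀ i j, (fun x => σ x i j) ∈ A := by
  let gen : Set (Γ → F) := (Set.range fun p : Fin k × Fin k => fun x => σ x p.1 p.2) ∪
    Set.range fun p : Fin k × Fin k => fun x => σ x⁻¹ p.1 p.2
  let A := Algebra.adjoin F gen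
  have h1 : ∀ i j, (fun x => σ x i j) ∈ A := fun i j =>
    Algebra.subset_adjoin (Or.inl ⟨(i, j), rfl⟩)
  have h2 : ∀ i j, (fun x => σ x⁻¹ i j) ∈ A := fun i j =>
    Algebra.subset_adjoin (Or.inr ⟨(i, j), rfl⟩)
  have hst : ∀ τ : Γ → Γ, (∀ i j, (fun x => σ (τ x) i j) ∈ A) →
      (∀ i j, (fun x => σ (τ x)⁻¹ i j) ∈ A) → ∀ a ∈ A, (fun x => a (τ x)) ∈ A := by
    intro τ hτ1 hτ2
    have : A ≤ A.comap (precompHom F τ) := by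
      refine Algebra.adjoin_le ?_
      rintro _ (⟨p, rfl⟩ | ⟨p, rfl⟩)
      · exact hτ1 p.1 p.2
      · exact hτ2 p.1 p.2
    exact fun a ha => this ha
  have hexp : ∀ (P Q : Matrix (Fin k) (Fin k) F) (τ : Γ → Γ), (∀ i j, (fun x => σ (τ x) i j) ∈ A) →
      ∀ i j, (fun x => (P * σ (τ x) * Q) i j) ∈ A := by
    intro P Q τ hτ i j
    have : (fun x => (P * σ (τ x) * Q) i j) =
        ∑ l, Q l j • ∑ m, P i m • fun x => σ (τ x) m l := by
      funext x
      simp [Matrix.mul_apply, Finset.sum_apply, mul_comm]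
    rw [this]
    exact A.sum_mem fun l _ => A.smul_mem (A.sum_mem fun m _ => A.smul_mem (hτ m l) _) _
  refine ⟨A, ?_, ?_, ?_, h1⟩
  · have hg : gen.Finite := (Set.finite_range _).union (Set.finite_range _)
    exact ⟨hg.toFinset, by rw [Set.Finite.coe_toFinset]⟩
  · intro a ha p q
    refine hst (fun x => p * x * q) ?_ ?_ a ha
    · simpa using hexp (σ p) (σ q) id h1
    · simpa [mul_assoc] using hexp (σ q⁻¹) (σ p⁻¹) (fun x => x⁻¹) h2
  · refine hst (fun x => x⁻¹) h2 ?_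
    simpa using h1

lemma map_derivedSeries_le {G : Type*} [Group G] (H : Subgroup G) (n : ℕ) :
    (derivedSeries H n).map H.subtype ≤ dser H n := by
  induction n with
  | zero =>
    rintro _ ⟨x, -, rfl⟩
    exact x.2
  | succ n ih =>
    rw [derivedSeries_succ, Subgroup.map_commutator]
    exact Subgroup.commutator_mono ih ih

theorem main_aux_s16 [IsAlgClosed F] {k : ℕ} (σ : Γ →* Matrix (Fin k) (Fin k) F)
    (hσ : Function.Injective σ) {n : ℕ} (w : FreeGroup (Fin n)) (hw : w ≠ 1) (g : Fin n → Γ)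
    (Δ : Subgroup Γ) [Δ.FiniteIndex]
    (hid : ∀ h : Fin n → Γ, (∀ i, (g i)⁻¹ * h i ∈ Δ) → FreeGroup.lift h w = 1) :
    ∃ H : Subgroup Γ, H.FiniteIndex ∧ IsSolvable H := by
  obtain ⟨A, hfg, hmul, hinv, hent⟩ := exists_algebra σ
  obtain ⟨G, hGn, hGf, hGN, hA⟩ := exists_genData A hfg hmul hinv Δ.normalCore
  have hGΔ : G ≤ Δ := hGN.trans Δ.normalCore_le
  let ρ : G →* Module.End F (Fin k → F) :=
    ((Matrix.toLinAlgEquiv' : Matrix (Fin k) (Fin k) F ≃ₐ[F] _) :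
      Matrix (Fin k) (Fin k) F →* Module.End F (Fin k → F)).comp (σ.comp G.subtype)
  have hρ : ∀ (x : G) v, ρ x v = (σ x).mulVec v := fun x v => rfl
  have hρinj : Function.Injective ρ := by
    intro x y h
    exact Subtype.ext (hσ (Matrix.toLinAlgEquiv'.injective h))
  obtain ⟨H, hHf, m, hm⟩ := induct hA w hw g
    (fun h hh => hid h fun i => hGΔ (hh i)) _ (Fin k → F) rfl ρ (by
      intro φ v
      refine ⟨∑ i, ∑ j, (φ (fun l => if i = l then 1 else 0) * v j) • fun x => σ x i j,
        A.sum_mem fun i _ => A.sum_mem fun j _ => A.smul_mem (hent i j) _, fun x => ?_⟩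
      rw [hρ, LinearMap.pi_apply_eq_sum_univ φ]
      simp only [Finset.sum_apply, Pi.smul_apply, smul_eq_mul, Matrix.mulVec, dotProduct,
        Finset.sum_mul]
      refine Finset.sum_congr rfl fun i _ => Finset.sum_congr rfl fun j _ => ?_
      ring)
  have hsol : Group.IsSolvable H := by
    refine ⟨m, ?_⟩
    rw [← Subgroup.map_eq_bot_iff_of_injective _ H.subtype_injective, eq_bot_iff]
    intro x hx
    rw [Subgroup.mem_bot]
    apply hρinj
    rw [hm x (map_derivedSeries_le H m hx), map_one]
  refine ⟨H.map G.subtype, ⟨?_⟩, ?_⟩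
  · rw [Subgroup.index_map_subtype]
    exact mul_ne_zero hHf.index_ne_zero hGf.index_ne_zero
  · exact Group.isSolvable_of_surjective
      (f := (H.equivMapOfInjective G.subtype G.subtype_injective).toMonoidHom)
      (H.equivMapOfInjective G.subtype G.subtype_injective).surjective

end Algebraic

/-- A finitely generated linear group which satisfies a coset identity is virtually
solvable. -/
theorem virtually_solvable_of_coset_identity (Γ : Type u) [Group Γ] [Group.FG Γ]
    (hlin : IsLinearGroup.{u, v} Γ) (hci : SatisfiesCosetIdentity Γ) :
    IsVirtuallySolvable Γ := by
  obtain ⟨F, _, k, ρ, hρ⟩ := hlin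
  obtain ⟨n, w, hw, Δ, hΔ, g, hid⟩ := hci
  let j : F →+* AlgebraicClosure F := algebraMap F (AlgebraicClosure F)
  let σ : Γ →* Matrix (Fin k) (Fin k) (AlgebraicClosure F) :=
    (j.mapMatrix.toMonoidHom.comp (Units.coeHom _)).comp ρ
  have hσ : Function.Injective σ := by
    intro x y h
    apply hρ
    apply Units.ext
    exact Matrix.map_injective j.injective h
  refine main_aux_s16 σ hσ w hw g Δ fun h hh => hid h fun i => ?_
  rw [Set.mem_smul_set_iff_inv_smul_mem]
  exact hh i
end
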